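/- arXiv:1003.5811 — 7 statements merged into one kernel-verified Lean document; each statement's English description precedes it below -/
import Mathlib

section
/- The operator ad h on g is diagonalizable with all eigenvalues in ℤ; that is, g decomposes as the internal direct sum g = ⊕_{i∈ℤ} g(i) of the integer eigenspaces g(i) = {x ∈ g : [h,x] = i·x} of ad h. -/
open Module in
lemma aux_nilp {K V : Type*} [Field K] [CharZero K] [AddCommGroup V] [Module K V]
    [FiniteDimensional K V] (H X : End K V) (c : K) (hc : c ≠ 0)
    (hHX : H * X - X * H = c • X) : ∃ n : ℕ, X ^ n = 0 := by
  by_contra! contra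
  have key : ∀ n : ℕ, H * X ^ n - X ^ n * H = (n * c : K) • X ^ n := by
    intro n
    induction n with
    | zero => simp
    | succ n ih =>
      have : H * X ^ (n+1) - X ^ (n+1) * H
          = (H * X ^ n - X ^ n * H) * X + X ^ n * (H * X - X * H) := by
        rw [pow_succ]; noncomm_ring
      rw [this, ih, hHX, smul_mul_assoc, mul_smul_comm, ← pow_succ, ← add_smul]
      congr 1; push_cast; ring
  let T : End K (End K V) := LinearMap.mulLeft K H - LinearMap.mulRight K H
  have hinj : Function.Injective (fun n : ℕ => (n * c : K)) := fun a b hab => by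
    simpa [hc] using hab
  have aux (μ : Set.range (fun n : ℕ => (n * c : K))) :
      T.HasEigenvector μ (X ^ (μ.property.choose)) := by
    refine ⟨?_, contra _⟩
    rw [Module.End.mem_eigenspace_iff]
    have h1 := key μ.property.choose
    have h2 := μ.property.choose_spec
    simp only at h2
    rw [h2] at h1
    simpa [T] using h1
  have _i := (T.eigenvectors_linearIndependent _ _ aux).finite
  exact (Set.infinite_range_of_injective hinj) (Set.toFinite _)

open Module in
lemma aux_EF {K V : Type*} [Field K] [AddCommGroup V] [Module K V]
    (E H F : End K V)
    (hHF : H * F - F * H = (-2 : K) • F) (hEF : E * F - F * E = H)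
    (v : V) (hv : F (E v) = 0) (j : ℕ) :
    E ((F ^ (j+1)) v) = ((j : K) + 1) • (F ^ j) (H v - (j : K) • v) := by
  have hF : ∀ x, H (F x) = F (H x) - (2 : K) • F x := fun x => by
    have := congrArg (fun T : End K V => T x) hHF
    simp only [LinearMap.sub_apply, Module.End.mul_apply, LinearMap.smul_apply] at this
    rw [sub_eq_iff_eq_add] at this
    rw [this]; module
  have hE : ∀ x, E (F x) = F (E x) + H x := fun x => by
    have := congrArg (fun T : End K V => T x) hEF
    simp only [LinearMap.sub_apply, Module.End.mul_apply] at this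
    rw [← this]; abel
  have hHj : ∀ j : ℕ, H ((F ^ j) v) = (F ^ j) (H v) - (2 * j : K) • (F ^ j) v := by
    intro j
    induction j with
    | zero => simp
    | succ j ih =>
      simp only [pow_succ', Module.End.mul_apply]
      rw [hF, ih]; simp only [map_sub, map_smul]; push_cast; module
  induction j with
  | zero => simp [hE, hv]
  | succ j ih =>
    rw [pow_succ', Module.End.mul_apply, hE, ih, hHj]
    simp only [map_sub, map_smul, pow_succ', Module.End.mul_apply]; push_cast; module

open Module in
lemma aux_nat {K V : Type*} [Field K] [CharZero K] [AddCommGroup V] [Module K V]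
    [FiniteDimensional K V] (E H F : End K V)
    (hHE : H * E - E * H = (2 : K) • E)
    (hHF : H * F - F * H = (-2 : K) • F) (hEF : E * F - F * E = H)
    (μ : K) (v : V) (hv0 : v ≠ 0) (hv : F (E v) = 0) (hH : H v = μ • v) : ∃ n : ℕ, μ = n := by
  obtain ⟨N, hN⟩ := aux_nilp H F (-2) (by norm_num) hHF
  obtain ⟨n, hn, hn'⟩ := Nat.exists_not_and_succ_of_not_zero_of_exists
    (p := fun n => (F ^ n) v = 0) (by simpa using hv0) ⟨N, by simp [hN]⟩
  refine ⟨n, ?_⟩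
  have := aux_EF E H F hHF hEF v hv n
  rw [hn', map_zero, hH, ← sub_smul, map_smul, smul_smul, eq_comm, smul_eq_zero] at this
  rcases this with h | h
  · rcases mul_eq_zero.1 h with h | h
    · exact absurd h (Nat.cast_add_one_ne_zero n)
    · exact sub_eq_zero.1 h
  · exact absurd h hn

open Module in
lemma aux_step {K V : Type*} [Field K] [CharZero K] [AddCommGroup V] [Module K V]
    [FiniteDimensional K V] (E H F : End K V)
    (hHE : H * E - E * H = (2 : K) • E)
    (hHF : H * F - F * H = (-2 : K) • F) (hEF : E * F - F * E = H)
    (n : ℕ) (v : V) (hv : H (H v - (n : K) • v) = (n : K) • (H v - (n : K) • v))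
    (hv0 : H v - (n : K) • v ≠ 0) :
    ∃ v : V, H (H v - ((n + 2 : ℕ) : K) • v) = ((n + 2 : ℕ) : K) • (H v - ((n + 2 : ℕ) : K) • v) ∧
      H v - ((n + 2 : ℕ) : K) • v ≠ 0 := by
  have hF : ∀ x, H (F x) = F (H x) - (2 : K) • F x := fun x => by
    have := congrArg (fun T : End K V => T x) hHF
    simp only [LinearMap.sub_apply, Module.End.mul_apply, LinearMap.smul_apply] at this
    rw [sub_eq_iff_eq_add] at this
    rw [this]; module
  have hE : ∀ x, H (E x) = E (H x) + (2 : K) • E x := fun x => by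
    have := congrArg (fun T : End K V => T x) hHE
    simp only [LinearMap.sub_apply, Module.End.mul_apply, LinearMap.smul_apply] at this
    rw [sub_eq_iff_eq_add] at this
    rw [this]; module
  have hEFx : ∀ x, E (F x) = F (E x) + H x := fun x => by
    have := congrArg (fun T : End K V => T x) hEF
    simp only [LinearMap.sub_apply, Module.End.mul_apply] at this
    rw [← this]; abel
  have hEs : H (E v) - ((n + 2 : ℕ) : K) • E v = E (H v - (n : K) • v) := by
    rw [hE, map_sub, map_smul]; push_cast; module
  by_contra! contra
  have h1 := contra (E v) (by
    rw [hEs, hE, hv, map_smul]; push_cast; module)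
  -- surjectivity
  let W := End.eigenspace H ((n + 2 : ℕ) : K)
  have hW : ∀ x ∈ W, (E * F) x ∈ W := by
    intro x hx
    rw [End.mem_eigenspace_iff] at hx ⊢
    rw [Module.End.mul_apply, hE, hF, hx]; simp only [map_sub, map_smul]; module
  have hinj : Function.Injective ((E * F).restrict hW) := by
    rw [← LinearMap.ker_eq_bot, LinearMap.ker_eq_bot']
    rintro ⟨x, hx⟩ h0
    by_contra hx0
    have hx0' : x ≠ 0 := fun h => hx0 (by simpa using h)
    have h0' : E (F x) = 0 := by simpa [Subtype.ext_iff, LinearMap.restrict_apply] using h0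
    rw [End.mem_eigenspace_iff] at hx
    obtain ⟨m, hm⟩ := aux_nat F (-H) E
      (by rw [neg_mul, mul_neg, sub_neg_eq_add, neg_add_eq_sub, ← neg_sub, hHF]; module)
      (by rw [neg_mul, mul_neg, sub_neg_eq_add, neg_add_eq_sub, ← neg_sub, hHE]; module)
      (by rw [← neg_sub, hEF]) (-((n + 2 : ℕ) : K)) x hx0' h0' (by rw [LinearMap.neg_apply, hx, neg_smul])
    have : ((m + (n + 2) : ℕ) : K) = 0 := by
      rw [Nat.cast_add, ← hm]; ring
    have := Nat.cast_eq_zero.1 this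
    omega
  have hsurj := LinearMap.injective_iff_surjective.1 hinj
  obtain ⟨⟨y, hy⟩, hy'⟩ := hsurj ⟨E v, by
    rw [End.mem_eigenspace_iff]; exact sub_eq_zero.1 h1⟩
  have hy' : E (F y) = E v := by simpa [Subtype.ext_iff, LinearMap.restrict_apply] using hy'
  rw [End.mem_eigenspace_iff] at hy
  have hw : H (F y) = (n : K) • F y := by
    rw [hF, hy, map_smul]; push_cast; module
  set v' := v - F y with hv'
  have hEv' : E v' = 0 := by rw [hv', map_sub, hy', sub_self]
  have hu : H v' - (n : K) • v' = H v - (n : K) • v := by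
    rw [hv', map_sub, hw]; module
  rw [← hu] at hv hv0
  set u := H v' - (n : K) • v' with hudef
  have hHv' : H v' = (n : K) • v' + u := by rw [hudef]; abel
  have hEu : E u = 0 := by
    rw [hu, ← hEs, h1]
  -- powers of F
  have ku := aux_EF E H F hHF hEF u (by rw [hEu, map_zero])
  have kv := aux_EF E H F hHF hEF v' (by rw [hEv', map_zero])
  simp only [hv, ← sub_smul, map_smul, smul_smul] at ku
  have hne : ∀ j : ℕ, j ≤ n → (F ^ j) u ≠ 0 := by
    intro j
    induction j with
    | zero => intro _; simpa using hv0
    | succ j ih =>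
      intro hj h0
      have := ku j
      rw [h0, map_zero, eq_comm, smul_eq_zero] at this
      rcases this with h | h
      · rcases mul_eq_zero.1 h with h | h
        · exact absurd h (Nat.cast_add_one_ne_zero j)
        · have := Nat.cast_injective (sub_eq_zero.1 h); omega
      · exact ih (by omega) h
  obtain ⟨N, hN⟩ := aux_nilp H F (-2) (by norm_num) hHF
  -- F^(n+1) u = 0
  have hz : (F ^ (n+1)) u = 0 := by
    by_contra hz
    obtain ⟨m, hm, hm'⟩ := Nat.exists_not_and_succ_of_not_zero_of_exists
      (p := fun k => (F ^ (n + 1 + k)) u = 0) (by simpa using hz) ⟨N, by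
        simp [pow_add, hN]⟩
    have := ku (n + 1 + m)
    rw [show n + 1 + m + 1 = n + 1 + (m + 1) by ring, hm', map_zero, eq_comm, smul_eq_zero] at this
    rcases this with h | h
    · rcases mul_eq_zero.1 h with h | h
      · exact absurd h (Nat.cast_add_one_ne_zero _)
      · have := Nat.cast_injective (sub_eq_zero.1 h); omega
    · exact hm h
  have hnv : ∀ k : ℕ, (F ^ (n + 1 + k)) v' ≠ 0 := by
    intro k
    induction k with
    | zero =>
      intro h0
      have := kv n
      rw [add_zero] at h0
      rw [h0, map_zero, ← hudef, eq_comm, smul_eq_zero] at this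
      exact this.elim (Nat.cast_add_one_ne_zero _) (hne n le_rfl)
    | succ k ih =>
      intro h0
      have := kv (n + 1 + k)
      have hz' : (F ^ (n + 1 + k)) u = 0 := by
        rw [add_comm, pow_add, Module.End.mul_apply, hz, map_zero]
      rw [show n + 1 + k + 1 = n + 1 + (k + 1) by ring, h0, map_zero, hHv', add_sub_right_comm,
        map_add, hz', add_zero, ← sub_smul, map_smul, smul_smul, eq_comm, smul_eq_zero] at this
      rcases this with h | h
      · rcases mul_eq_zero.1 h with h | h
        · exact absurd h (Nat.cast_add_one_ne_zero _)
        · have := Nat.cast_injective (sub_eq_zero.1 h); omega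
      · exact ih h
  exact hnv N (by simp [pow_add, hN])

open Module in
lemma aux_semi {K V : Type*} [Field K] [CharZero K] [AddCommGroup V] [Module K V]
    [FiniteDimensional K V] (E H F : End K V)
    (hHE : H * E - E * H = (2 : K) • E)
    (hHF : H * F - F * H = (-2 : K) • F) (hEF : E * F - F * E = H)
    (n : ℕ) (v : V) (hv : H (H v - (n : K) • v) = (n : K) • (H v - (n : K) • v)) :
    H v - (n : K) • v = 0 := by
  by_contra hv0
  have key : ∀ k : ℕ, ∃ v : V, H (H v - ((n + 2 * k : ℕ) : K) • v) =
      ((n + 2 * k : ℕ) : K) • (H v - ((n + 2 * k : ℕ) : K) • v) ∧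
      H v - ((n + 2 * k : ℕ) : K) • v ≠ 0 := by
    intro k
    induction k with
    | zero => exact ⟨v, hv, hv0⟩
    | succ k ih =>
      obtain ⟨w, h1, h2⟩ := ih
      exact aux_step E H F hHE hHF hEF (n + 2 * k) w h1 h2
  have hinj : Function.Injective (fun k : ℕ => ((n + 2 * k : ℕ) : K)) := fun a b hab => by
    have := Nat.cast_injective (R := K) hab
    omega
  refine (Set.infinite_range_of_injective hinj) ((End.finite_hasEigenvalue H).subset ?_)
  rintro _ ⟨k, rfl⟩
  obtain ⟨w, h1, h2⟩ := key k
  exact End.hasEigenvalue_of_hasEigenvector ⟨End.mem_eigenspace_iff.2 h1, h2⟩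

open Module in
lemma aux_main {K V : Type*} [Field K] [IsAlgClosed K] [CharZero K] [AddCommGroup V] [Module K V]
    [FiniteDimensional K V] (E H F : End K V)
    (hHE : H * E - E * H = (2 : K) • E)
    (hHF : H * F - F * H = (-2 : K) • F) (hEF : E * F - F * E = H) :
    ⨆ i : ℤ, End.eigenspace H (i : K) = ⊤ := by
  have hE : ∀ x, H (E x) = E (H x) + (2 : K) • E x := fun x => by
    have := congrArg (fun T : End K V => T x) hHE
    simp only [LinearMap.sub_apply, Module.End.mul_apply, LinearMap.smul_apply] at this
    rw [sub_eq_iff_eq_add] at this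
    rw [this]; module
  have hint : ∀ μ : K, H.HasEigenvalue μ → ∃ i : ℤ, μ = i := by
    intro μ hμ
    obtain ⟨v, hv, hv0⟩ := hμ.exists_hasEigenvector
    rw [End.mem_eigenspace_iff] at hv
    obtain ⟨N, hN⟩ := aux_nilp H E 2 (by norm_num) hHE
    obtain ⟨k, hk, hk'⟩ := Nat.exists_not_and_succ_of_not_zero_of_exists
      (p := fun n => (E ^ n) v = 0) (by simpa using hv0) ⟨N, by simp [hN]⟩
    have hw : ∀ k : ℕ, H ((E ^ k) v) = (μ + 2 * k) • (E ^ k) v := by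
      intro k
      induction k with
      | zero => simp [hv]
      | succ k ih =>
        rw [pow_succ', Module.End.mul_apply, hE, ih, map_smul]; push_cast; module
    rw [pow_succ', Module.End.mul_apply] at hk'
    obtain ⟨n, hn⟩ := aux_nat E H F hHE hHF hEF _ _ hk (by rw [hk', map_zero]) (hw k)
    exact ⟨n - 2 * k, by push_cast; rw [← hn]; ring⟩
  have hsemi : ∀ (i : ℤ) (v : V), H (H v - (i : K) • v) = (i : K) • (H v - (i : K) • v) →
      H v - (i : K) • v = 0 := by
    intro i v hv
    obtain ⟨n, rfl | rfl⟩ := i.eq_nat_or_neg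
    · simp only [Int.cast_natCast] at hv ⊢
      exact aux_semi E H F hHE hHF hEF n v hv
    · simp only [Int.cast_neg, Int.cast_natCast] at hv ⊢
      have := aux_semi F (-H) E
        (by rw [neg_mul, mul_neg, sub_neg_eq_add, neg_add_eq_sub, ← neg_sub, hHF]; module)
        (by rw [neg_mul, mul_neg, sub_neg_eq_add, neg_add_eq_sub, ← neg_sub, hHE]; module)
        (by rw [← neg_sub, hEF]) n v (by
          have e : (-H) v - (n : K) • v = - (H v - (-(n : K)) • v) := by
            simp only [LinearMap.neg_apply]; module
          rw [e, map_neg, LinearMap.neg_apply, hv]; module)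
      rw [← neg_eq_zero, ← this]
      simp only [LinearMap.neg_apply]; module
  rw [eq_top_iff, ← End.iSup_maxGenEigenspace_eq_top H]
  refine iSup_le fun μ => ?_
  by_cases hμ : H.HasEigenvalue μ
  · obtain ⟨i, rfl⟩ := hint μ hμ
    refine le_trans ?_ (le_iSup _ i)
    intro x hx
    rw [End.mem_maxGenEigenspace] at hx
    obtain ⟨k, hk⟩ := hx
    rw [End.mem_eigenspace_iff, ← sub_eq_zero]
    induction k generalizing x with
    | zero =>
      have : x = 0 := by simpa using hk
      simp [this]
    | succ k ih =>
      rw [pow_succ, Module.End.mul_apply] at hk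
      have := ih hk
      apply hsemi
      rw [← sub_eq_zero]
      simpa using this
  · have : H.maxGenEigenspace μ = ⊥ := by
      by_contra hne
      rw [Submodule.eq_bot_iff] at hne
      push Not at hne
      obtain ⟨x, hx, hx0⟩ := hne
      rw [End.mem_maxGenEigenspace] at hx
      obtain ⟨k, hk, hk'⟩ := Nat.exists_not_and_succ_of_not_zero_of_exists
        (p := fun n => ((H - μ • (1 : End K V)) ^ n) x = 0) (by simpa using hx0) hx
      apply hμ
      refine End.hasEigenvalue_of_hasEigenvector (x := ((H - μ • (1 : End K V)) ^ k) x) ⟨?_, hk⟩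
      rw [pow_succ', Module.End.mul_apply] at hk'
      rw [End.mem_eigenspace_iff, ← sub_eq_zero]
      simpa using hk'
    rw [this]; exact bot_le

/-- The operator `ad h` on `g` is diagonalizable with all eigenvalues in `ℤ`;
that is, `g` decomposes as the internal direct sum `g = ⊕_{i ∈ ℤ} g(i)` of the integer
eigenspaces `g(i) = {x ∈ g : ⁅h, x⁆ = i • x}` of `ad h`. -/
theorem ad_h_diagonalizable_with_integer_eigenvalues
    (K : Type*) [Field K] [IsAlgClosed K] [CharZero K]
    (g : Type*) [LieRing g] [LieAlgebra K g] [FiniteDimensional K g]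
    [LieAlgebra.IsSemisimple K g]
    (e h f : g) (he : e ≠ 0)
    (hhe : ⁅h, e⁆ = (2 : K) • e) (hhf : ⁅h, f⁆ = (-2 : K) • f) (hef : ⁅e, f⁆ = h) :
    DirectSum.IsInternal
      (fun i : ℤ => Module.End.eigenspace (LieAlgebra.ad K g h) (i : K)) := by
  rw [DirectSum.isInternal_submodule_iff_iSupIndep_and_iSup_eq_top]
  constructor
  · exact (Module.End.eigenspaces_iSupIndep (LieAlgebra.ad K g h)).comp
      (f := fun i : ℤ => (i : K)) Int.cast_injective
  · apply aux_main (LieAlgebra.ad K g e) _ (LieAlgebra.ad K g f)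
    · refine LinearMap.ext fun x => ?_
      have := leibniz_lie h e x
      rw [hhe, smul_lie] at this
      simp only [LinearMap.sub_apply, Module.End.mul_apply, LieAlgebra.ad_apply,
        LinearMap.smul_apply]
      rw [this, add_sub_cancel_right]
    · refine LinearMap.ext fun x => ?_
      have := leibniz_lie h f x
      rw [hhf, smul_lie] at this
      simp only [LinearMap.sub_apply, Module.End.mul_apply, LieAlgebra.ad_apply,
        LinearMap.smul_apply]
      rw [this, add_sub_cancel_right]
    · refine LinearMap.ext fun x => ?_
      have := leibniz_lie e f x
      rw [hef] at this
      simp only [LinearMap.sub_apply, Module.End.mul_apply, LieAlgebra.ad_apply,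
        LinearMap.smul_apply]
      rw [this, add_sub_cancel_right]
end

section
/- The restriction of the form ω_χ to g(-1) is nondegenerate: for every nonzero x ∈ g(-1) there exists y ∈ g(-1) with κ(e,[x,y]) ≠ 0. -/
open Polynomial in
/-- auxiliary polynomials -/
noncomputable def auxPQ (K : Type*) [Field K] : ℕ → K[X] × K[X]
  | 0 => (1, 0)
  | k + 1 => ((X - C (4 * ((k : K) + 1) ^ 2)) * (auxPQ K k).1,
      (X - C (4 * ((k : K) + 1) ^ 2)) * (auxPQ K k).2 + C (4 * ((k : K) + 1)) * (auxPQ K k).1)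

open Polynomial in
lemma auxPQ_eval_ne (K : Type*) [Field K] [CharZero K] (k : ℕ) (m : ℕ) (hm : m = 0 ∨ k < m) :
    (auxPQ K k).1.eval (4 * (m : K) ^ 2) ≠ 0 := by
  induction k with
  | zero => simp [auxPQ]
  | succ k ih =>
    simp only [auxPQ, eval_mul, eval_sub, eval_X, eval_C]
    refine mul_ne_zero ?_ (ih (by omega))
    intro h0
    have h1 : ((4 * m ^ 2 : ℕ) : K) = ((4 * (k + 1) ^ 2 : ℕ) : K) := by
      push_cast; linear_combination h0
    have h2 := Nat.cast_injective h1
    have h3 : m ^ 2 = (k + 1) ^ 2 := by omega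
    have h4 := Nat.pow_left_injective (n := 2) (by norm_num) h3
    omega

open Polynomial in
lemma X_sub_C_coprime_of_eval {K : Type*} [Field K] (a : K) (p : K[X]) (h : p.eval a ≠ 0) :
    IsCoprime (X - C a) p :=
  (irreducible_X_sub_C a).coprime_iff_not_dvd.2 (by rwa [dvd_iff_isRoot])

open Polynomial in
lemma auxPQ_coprime (K : Type*) [Field K] [CharZero K] (k : ℕ) :
    IsCoprime (auxPQ K k).1 (auxPQ K k).2 := by
  induction k with
  | zero => simpa [auxPQ] using isCoprime_one_left
  | succ k ih =>
    have hc : IsCoprime (X - C (4 * ((k : K) + 1) ^ 2)) (auxPQ K k).1 := by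
      apply X_sub_C_coprime_of_eval
      have := auxPQ_eval_ne K k (k + 1) (by omega)
      push_cast at this; exact this
    have hb : IsUnit (C (4 * ((k : K) + 1))) := by
      rw [isUnit_C, isUnit_iff_ne_zero]
      exact mul_ne_zero (by norm_num) (Nat.cast_add_one_ne_zero k)
    simp only [auxPQ]
    refine IsCoprime.mul_left ?_ ?_
    · refine (IsCoprime.mul_add_left_right_iff).2 ?_
      exact (isCoprime_mul_unit_left_right hb _ _).2 hc
    · refine (IsCoprime.add_mul_right_right_iff).2 ?_
      exact IsCoprime.mul_right hc.symm ih

open Polynomial in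
lemma auxPQ_coprime' (K : Type*) [Field K] [CharZero K] (k : ℕ) :
    IsCoprime (auxPQ K k).1 (X * (auxPQ K k).2) := by
  refine IsCoprime.mul_right ?_ (auxPQ_coprime K k)
  have := X_sub_C_coprime_of_eval (0 : K) (auxPQ K k).1
    (by simpa using auxPQ_eval_ne K k 0 (Or.inl rfl))
  simpa using this.symm

section ops
variable {K V : Type*} [Field K] [CharZero K] [AddCommGroup V] [Module K V]

lemma aux_HE (H E : Module.End K V) (c : K) (hE : H * E - E * H = c • E) (k : ℕ) :
    H * E ^ k = E ^ k * H + (k * c) • E ^ k := by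
  induction k with
  | zero => simp
  | succ k ih =>
    have h1 : H * E = E * H + c • E := by rw [← hE]; abel
    rw [pow_succ, ← mul_assoc, ih, add_mul, mul_assoc, h1, mul_add, ← mul_assoc]
    simp only [smul_mul_assoc, mul_smul_comm]
    push_cast
    module

lemma aux_nilp_s1 [FiniteDimensional K V] (H E : Module.End K V) (c : K) (hc : c ≠ 0)
    (hE : H * E - E * H = c • E) : ∃ n : ℕ, ∀ k, n ≤ k → E ^ k = 0 := by
  suffices ∃ n, E ^ n = 0 by
    obtain ⟨n, hn⟩ := this
    exact ⟨n, fun k hk => pow_eq_zero_of_le hk hn⟩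
  by_contra! hcon
  let T : Module.End K (Module.End K V) := LinearMap.mulLeft K H - LinearMap.mulRight K H
  have hT : ∀ k : ℕ, T.HasEigenvalue (k * c) := fun k => by
    refine Module.End.hasEigenvalue_of_hasEigenvector (x := E ^ k) ⟨?_, hcon k⟩
    rw [Module.End.mem_eigenspace_iff]
    simp [T, aux_HE H E c hE k]
  have hfin : Set.Finite {μ | T.HasEigenvalue μ} := Module.End.finite_hasEigenvalue T
  have hinj : Function.Injective (fun k : ℕ => (k : K) * c) := fun a b hab => by
    simpa [hc] using hab
  exact (Set.infinite_range_of_injective hinj) (hfin.subset (by rintro _ ⟨k, rfl⟩; exact hT k))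

open Polynomial in
/-- key semisimplicity at weight one -/
lemma aux_key [FiniteDimensional K V] (H E F : Module.End K V)
    (hE : H * E - E * H = (2 : K) • E) (hF : H * F - F * H = (-2 : K) • F)
    (hEF : E * F - F * E = H) (w : V) (hw : (H - 1) ((H - 1) w) = 0) : (H - 1) w = 0 := by
  set Cas : Module.End K V := (H + 1) * (H + 1) + (4 : K) • (F * E) with hCas
  set N : Module.End K V := H - 1 with hN
  have hHE : H * E = E * H + (2 : K) • E := by rw [← hE]; abel
  have hHF : H * F = F * H + (-2 : K) • F := by rw [← hF]; abel
  have hCH : Commute Cas H := by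
    have : Commute (F * E) H := by
      show F * E * H = H * (F * E)
      rw [← mul_assoc H, hHF, add_mul, mul_assoc F H, hHE, mul_add, smul_mul_assoc,
        mul_smul_comm, mul_assoc]
      module
    exact (((Commute.refl H).add_left (Commute.one_left H)).mul_left
      ((Commute.refl H).add_left (Commute.one_left H))).add_left (this.smul_left _)
  have hCN : Commute Cas N := hCH.sub_right (Commute.one_right _)
  have vHE : ∀ v, H (E v) = E (H v) + (2 : K) • E v := fun v => LinearMap.congr_fun hHE v
  have vHF : ∀ v, H (F v) = F (H v) + (-2 : K) • F v := fun v => LinearMap.congr_fun hHF v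
  have vEF : ∀ v, E (F v) = F (E v) + H v := fun v => by
    rw [← hEF]; simp
  have two_eq : (2 : Module.End K V) = (2 : K) • 1 := by rw [ofNat_smul_eq_nsmul]; simp
  have hFE : (4 : K) • (F * E) = Cas - (N + 2) * (N + 2) := by
    ext v
    simp only [hCas, hN, two_eq, Module.End.mul_apply, LinearMap.smul_apply, LinearMap.sub_apply,
      LinearMap.add_apply, Module.End.one_apply, map_add, map_sub, map_smul]
    module
  have hEF' : (4 : K) • (E * F) = Cas - N * N := by
    ext v
    simp only [hCas, hN, Module.End.mul_apply, LinearMap.smul_apply, LinearMap.sub_apply,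
      LinearMap.add_apply, Module.End.one_apply, map_add, map_sub, map_smul, vEF]
    module
  have hNE : ∀ k : ℕ, N * E ^ k = E ^ k * N + (2 * k : K) • E ^ k := fun k => by
    rw [hN, sub_mul, mul_sub, aux_HE H E 2 hE k]; simp [mul_comm]; abel
  have hNF : ∀ k : ℕ, N * F ^ k = F ^ k * N - (2 * k : K) • F ^ k := fun k => by
    rw [hN, sub_mul, mul_sub, aux_HE H F (-2) hF k]; simp [mul_comm]; abel
  have hCE : Cas * E = E * Cas := by
    ext v
    simp only [hCas, Module.End.mul_apply, LinearMap.smul_apply, LinearMap.sub_apply,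
      LinearMap.add_apply, Module.End.one_apply, map_add, map_sub, map_smul, vEF, vHE, vHF]
    module
  replace hCE : Commute Cas E := hCE
  have hCF : Cas * F = F * Cas := by
    ext v
    simp only [hCas, Module.End.mul_apply, LinearMap.smul_apply, LinearMap.sub_apply,
      LinearMap.add_apply, Module.End.one_apply, map_add, map_sub, map_smul, vEF, vHE, vHF]
    module
  replace hCF : Commute Cas F := hCF
  -- e side
  have hT : ∀ (k : ℕ) (v : V), N (N v) = 0 → (4 : K) ^ k • (F ^ k) ((E ^ k) v) =
      aeval Cas (auxPQ K k).1 v - aeval Cas (auxPQ K k).2 (N v) := by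
    intro k
    induction k with
    | zero => intro v _; simp [auxPQ]
    | succ k ih =>
      intro v hv
      have hstep : (4 : K) • F (E ((E ^ k) v)) =
          (E ^ k) (Cas v - (4 * ((k : K) + 1) ^ 2) • v - (4 * ((k : K) + 1)) • N v) := by
        have h1 := LinearMap.congr_fun hFE ((E ^ k) v)
        have h2 := fun v => LinearMap.congr_fun (hNE k) v
        have h3 := LinearMap.congr_fun ((hCE.pow_right k).eq) v
        have h4 : (2 : Module.End K V) = (2 : K) • 1 := by rw [ofNat_smul_eq_nsmul]; simp
        simp only [h4, Module.End.mul_apply, LinearMap.smul_apply, LinearMap.sub_apply,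
          LinearMap.add_apply, Module.End.one_apply, map_add, map_smul] at h1 h2 h3
        rw [h1, h3, h2]
        simp only [map_add, map_smul, h2, map_sub, hv, map_zero]
        module
      set v' := Cas v - (4 * ((k : K) + 1) ^ 2) • v - (4 * ((k : K) + 1)) • N v with hv'
      have hCNv : ∀ u, N (Cas u) = Cas (N u) := fun u => (LinearMap.congr_fun hCN.eq u).symm
      have hNv' : N v' = Cas (N v) - (4 * ((k : K) + 1) ^ 2) • N v := by
        simp [hv', hv, hCNv]
      have hNNv' : N (N v') = 0 := by simp [hNv', hCNv, hv]
      have := ih v' hNNv'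
      have e1 : (F ^ (k + 1)) ((E ^ (k + 1)) v) = (F ^ k) (F (E ((E ^ k) v))) := by
        rw [pow_succ F, pow_succ' E]; rfl
      rw [e1, pow_succ, mul_smul, ← map_smul, hstep, this, hNv', hv']
      simp only [auxPQ]
      rw [mul_comm (X - C _), mul_comm (X - C _), mul_comm (C _)]
      simp only [map_mul, map_sub, map_add, aeval_X, aeval_C, Module.End.mul_apply,
        LinearMap.sub_apply, LinearMap.add_apply, Module.algebraMap_end_apply, map_smul]
      module
  have hU : ∀ (k : ℕ) (v : V), N (N v) = 0 → (4 : K) ^ (k + 1) • (E ^ (k + 1)) ((F ^ (k + 1)) v) =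
      aeval Cas (X * (auxPQ K k).1) v + aeval Cas (X * (auxPQ K k).2) (N v) := by
    intro k
    induction k with
    | zero =>
      intro v hv
      have h1 := LinearMap.congr_fun hEF' v
      simp only [Module.End.mul_apply, LinearMap.smul_apply, LinearMap.sub_apply, hv] at h1
      simp [auxPQ, h1]
    | succ k ih =>
      intro v hv
      have hstep : (4 : K) • E (F ((F ^ (k + 1)) v)) =
          (F ^ (k + 1)) (Cas v - (4 * ((k : K) + 1) ^ 2) • v + (4 * ((k : K) + 1)) • N v) := by
        have h1 := LinearMap.congr_fun hEF' ((F ^ (k + 1)) v)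
        have h2 := fun v => LinearMap.congr_fun (hNF (k + 1)) v
        have h3 := LinearMap.congr_fun ((hCF.pow_right (k + 1)).eq) v
        simp only [Module.End.mul_apply, LinearMap.smul_apply, LinearMap.sub_apply,
          LinearMap.add_apply, Module.End.one_apply, map_add, map_smul] at h1 h2 h3
        rw [h1, h3, h2]
        simp only [map_add, map_smul, h2, map_sub, hv, map_zero]
        push_cast
        module
      set v' := Cas v - (4 * ((k : K) + 1) ^ 2) • v + (4 * ((k : K) + 1)) • N v with hv'
      have hCNv : ∀ u, N (Cas u) = Cas (N u) := fun u => (LinearMap.congr_fun hCN.eq u).symm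
      have hNv' : N v' = Cas (N v) - (4 * ((k : K) + 1) ^ 2) • N v := by
        simp [hv', hv, hCNv]
      have hNNv' : N (N v') = 0 := by simp [hNv', hCNv, hv]
      have := ih v' hNNv'
      have e1 : (E ^ (k + 1 + 1)) ((F ^ (k + 1 + 1)) v)
          = (E ^ (k + 1)) (E (F ((F ^ (k + 1)) v))) := by
        rw [pow_succ E, pow_succ' F]; rfl
      rw [e1, pow_succ, mul_smul, ← map_smul, hstep, this, hNv', hv']
      simp only [auxPQ]
      rw [mul_comm (X - C _), mul_comm (X - C _), mul_comm (C _)]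
      simp only [map_mul, map_sub, map_add, aeval_X, aeval_C, Module.End.mul_apply,
        LinearMap.sub_apply, LinearMap.add_apply, Module.algebraMap_end_apply, map_smul]
      module
  obtain ⟨n₁, hn₁⟩ := aux_nilp_s1 H E 2 two_ne_zero hE
  obtain ⟨n₂, hn₂⟩ := aux_nilp_s1 H F (-2) (by simp) hF
  set k := max n₁ n₂
  have hEk := hn₁ k (le_max_left _ _)
  have hFk := hn₂ (k + 1) ((le_max_right _ _).trans (Nat.le_succ _))
  have r1 := hT k w hw
  have r2 := hT k (N w) (by simp [hw])
  have r3 := hU k w hw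
  simp only [hEk, hFk, hw, map_zero, LinearMap.zero_apply, smul_zero, sub_zero] at r1 r2 r3
  have r4 : aeval Cas (X * (auxPQ K k).2) (N w) = 0 := by
    have r1' := (sub_eq_zero.1 r1.symm)
    rw [map_mul, map_mul, Module.End.mul_apply, Module.End.mul_apply, r1', ← two_smul K] at r3
    rw [map_mul, Module.End.mul_apply]
    exact (smul_eq_zero.1 r3.symm).resolve_left two_ne_zero
  obtain ⟨a, b, hab⟩ := auxPQ_coprime' K k
  have := congrArg (fun p => aeval Cas p (N w)) hab
  simp only [map_add, LinearMap.add_apply, map_one, Module.End.one_apply] at this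
  rw [map_mul, map_mul _ b, Module.End.mul_apply, Module.End.mul_apply, ← r2, r4] at this
  simpa using this.symm

end ops


/-- The restriction of the form `ω_χ` to `g(-1)` is nondegenerate: for every
nonzero `x ∈ g(-1)` there exists `y ∈ g(-1)` with `κ(e, ⁅x, y⁆) ≠ 0`. -/
theorem omega_chi_nondegenerate_on_weight_neg_one
    (K : Type*) [Field K] [IsAlgClosed K] [CharZero K]
    (g : Type*) [LieRing g] [LieAlgebra K g] [FiniteDimensional K g]
    [LieAlgebra.IsSemisimple K g]
    (e h f : g) (he : e ≠ 0)
    (hhe : ⁅h, e⁆ = (2 : K) • e) (hhf : ⁅h, f⁆ = (-2 : K) • f) (hef : ⁅e, f⁆ = h)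
    (x : g) (hx : x ∈ Module.End.eigenspace (LieAlgebra.ad K g h) ((-1 : ℤ) : K))
    (hx0 : x ≠ 0) :
    ∃ y ∈ Module.End.eigenspace (LieAlgebra.ad K g h) ((-1 : ℤ) : K),
      killingForm K g e ⁅x, y⁆ ≠ 0 := by
  have hh0 : h ≠ 0 := by
    rintro rfl
    rw [zero_lie] at hhe
    exact he ((smul_eq_zero.1 hhe.symm).resolve_left two_ne_zero)
  have t : IsSl2Triple h e f :=
    { h_ne_zero := hh0
      lie_e_f := hef
      lie_h_e_nsmul := by rw [hhe, ← Nat.cast_smul_eq_nsmul K]; simp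
      lie_h_f_nsmul := by rw [hhf, ← Nat.cast_smul_eq_nsmul K]; simp }
  rw [Module.End.mem_eigenspace_iff, LieAlgebra.ad_apply] at hx
  have hz0 : ⁅e, x⁆ ≠ 0 := by
    intro h0
    have P : t.HasPrimitiveVectorWith x ((-1 : ℤ) : K) := ⟨hx0, hx, h0⟩
    obtain ⟨n, hn⟩ := P.exists_nat
    have : (-1 : ℤ) = (n : ℤ) := Int.cast_injective (α := K) (by simpa using hn)
    omega
  by_contra! hcon
  set H := LieAlgebra.ad K g h with hH
  set B := killingForm K g with hB
  have hBnd : B.Nondegenerate := LieAlgebra.IsKilling.killingForm_nondegenerate K g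
  have hinv : ∀ a b c : g, B ⁅a, b⁆ c = B a ⁅b, c⁆ :=
    fun a b c => LieModule.traceForm_apply_lie_apply K g g a b c
  have hmem : ⁅e, x⁆ ∈ LinearMap.range (H - 1) := by
    have hrefl : B.IsRefl := (LieModule.traceForm_isSymm K g g).isRefl
    rw [← LinearMap.BilinForm.orthogonal_orthogonal hBnd hrefl (LinearMap.range (H - 1))]
    intro y hy
    have hy' : y ∈ Module.End.eigenspace H ((-1 : ℤ) : K) := by
      rw [Module.End.mem_eigenspace_iff]
      have : H y + y = 0 := by
        apply hBnd.2
        intro w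
        have h1 : B ((H - 1) w) y = 0 := hy _ (LinearMap.mem_range_self _ w)
        have h2 : (H - 1) w = -⁅w, h⁆ - w := by simp [hH]
        rw [h2, map_sub, map_neg, LinearMap.sub_apply, LinearMap.neg_apply, hinv] at h1
        rw [hH, LieAlgebra.ad_apply, map_add]
        linear_combination -h1
      simpa using eq_neg_of_add_eq_zero_left this
    have := hcon y hy'
    rw [← hinv] at this
    exact hrefl _ _ this
  obtain ⟨w, hw⟩ := hmem
  apply hz0
  rw [← hw]
  have hlie : ∀ a b : g, LieAlgebra.ad K g a * LieAlgebra.ad K g b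
      - LieAlgebra.ad K g b * LieAlgebra.ad K g a = LieAlgebra.ad K g ⁅a, b⁆ := fun a b => by
    ext v; simp [lie_lie]
  refine aux_key H (LieAlgebra.ad K g e) (LieAlgebra.ad K g f) ?_ ?_ ?_ w ?_
  · rw [hlie, hhe, map_smul]
  · rw [hlie, hhf, map_smul]
  · rw [hlie, hef]
  · rw [hw, LinearMap.sub_apply, hH, LieAlgebra.ad_apply, leibniz_lie, hhe, hx]
    rw [Module.End.one_apply, smul_lie, lie_smul]
    push_cast
    module
end

section
/- The Slodowy slice S = e + ker(ad f) is transverse to the adjoint orbit of e at e: g decomposes as the internal direct sum g = [e,g] ⊕ ker(ad f) of the image of ad e and the kernel of ad f. -/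
open LieAlgebra in
theorem slod_nilp {K : Type*} [Field K] [CharZero K] {g : Type*} [LieRing g] [LieAlgebra K g]
    [FiniteDimensional K g] {h e f : g} (t : IsSl2Triple h e f) (x : g) (μ : K)
    (hx : ⁅h, x⁆ = μ • x) : ∃ k, ((LieModule.toEnd K g g e) ^ k) x = 0 := by
  by_contra! contra
  have h_inj : Function.Injective (fun n : ℕ => μ + 2 * (n : K)) := fun a b hab ↦ by
    simpa [add_right_inj, mul_eq_mul_left_iff, Nat.cast_inj] using hab
  have aux (ν : Set.range (fun n : ℕ => μ + 2 * (n : K))) :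
      (LieModule.toEnd K g g h).HasEigenvector ν
        (((LieModule.toEnd K g g e) ^ ν.property.choose) x) := by
    refine ⟨?_, contra _⟩
    have h1 := ν.property.choose_spec
    have h2 := t.lie_h_pow_toEnd_e hx ν.property.choose
    simp only at h1
    rw [h1] at h2
    rw [Module.End.mem_eigenspace_iff, LieModule.toEnd_apply_apply]
    exact h2
  have _i := ((LieModule.toEnd K g g h).eigenvectors_linearIndependent _ _ aux).finite
  exact (Set.infinite_range_of_injective h_inj) (Set.toFinite _)

theorem slod_disj {K : Type*} [Field K] [IsAlgClosed K] [CharZero K] {g : Type*} [LieRing g]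
    [LieAlgebra K g] [FiniteDimensional K g] {h e f : g} (t : IsSl2Triple h e f) :
    Disjoint (LinearMap.range (LieAlgebra.ad K g e)) (LinearMap.ker (LieAlgebra.ad K g f)) := by
  rw [disjoint_iff]
  by_contra hW
  have he2 := t.lie_h_e_smul K
  have hf2 := t.lie_lie_smul_f K
  have hEH (y : g) : ⁅h, ⁅e, y⁆⁆ = ⁅e, ⁅h, y⁆ + (2 : K) • y⁆ := by
    rw [leibniz_lie h, he2, lie_add, lie_smul, smul_lie, add_comm]
  have hFH (y : g) : ⁅h, ⁅f, y⁆⁆ = ⁅f, ⁅h, y⁆ - (2 : K) • y⁆ := by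
    rw [leibniz_lie h, hf2, lie_sub, lie_smul, neg_lie, smul_lie]; abel
  set W := LinearMap.range (LieAlgebra.ad K g e) ⊓ LinearMap.ker (LieAlgebra.ad K g f) with hWd
  have hst : ∀ w ∈ W, LieAlgebra.ad K g h w ∈ W := by
    rintro w ⟨⟨y, rfl⟩, hw⟩
    refine ⟨⟨⁅h, y⁆ + (2 : K) • y, ?_⟩, ?_⟩
    · simp only [LieAlgebra.ad_apply]; exact (hEH y).symm
    · simp only [SetLike.mem_coe, LinearMap.mem_ker, LieAlgebra.ad_apply] at hw ⊢
      have := hFH ⁅e, y⁆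
      rw [hw, lie_zero, lie_sub, lie_smul, hw, smul_zero, sub_zero] at this
      exact this.symm
  have : Nontrivial W := Submodule.nontrivial_iff_ne_bot.mpr hW
  obtain ⟨μ, hμ⟩ := Module.End.exists_eigenvalue ((LieAlgebra.ad K g h).restrict hst)
  obtain ⟨⟨v, hvW⟩, hv⟩ := hμ.exists_hasEigenvector
  have hv0 : v ≠ 0 := fun h0 => hv.2 (by simpa using h0)
  have hvμ : ⁅h, v⁆ = μ • v := by
    simpa using congrArg Subtype.val hv.apply_eq_smul
  obtain ⟨⟨x, hx⟩, hfv⟩ := hvW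
  simp only [SetLike.mem_coe, LinearMap.mem_ker, LieAlgebra.ad_apply] at hx hfv
  obtain ⟨n, hn⟩ := (IsSl2Triple.HasPrimitiveVectorWith.mk (t := t.symm) (m := v) (μ := -μ)
    hv0 (by simp [hvμ]) hfv).exists_nat
  obtain rfl : μ = -(n : K) := by rw [← hn, neg_neg]
  -- `h + n + 2` is bijective on `ker e`
  set T : Module.End K g := LieAlgebra.ad K g h + ((n : K) + 2) • (1 : Module.End K g) with hT
  have hTa (y : g) : T y = ⁅h, y⁆ + ((n : K) + 2) • y := by simp [hT]
  have hTst : ∀ w ∈ LinearMap.ker (LieAlgebra.ad K g e), T w ∈ LinearMap.ker (LieAlgebra.ad K g e) := by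
    intro w hw
    simp only [LinearMap.mem_ker, LieAlgebra.ad_apply] at hw ⊢
    have := hEH w
    rw [hw, lie_zero, lie_add, lie_smul, hw, smul_zero, add_zero] at this
    rw [hTa, lie_add, lie_smul, hw, ← this]; simp
  have hinj : Function.Injective (T.restrict hTst) := by
    rw [← LinearMap.ker_eq_bot, LinearMap.ker_eq_bot']
    rintro ⟨w, hw⟩ hw'
    by_contra hw0
    have hw1 : T w = 0 := by simpa using congrArg Subtype.val hw'
    rw [hTa, add_eq_zero_iff_eq_neg, ← neg_smul] at hw1
    obtain ⟨m, hm⟩ := (IsSl2Triple.HasPrimitiveVectorWith.mk (t := t) (m := w)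
      (fun h0 => hw0 (by simpa using h0)) hw1 (by simpa using hw)).exists_nat
    have : ((m + n + 2 : ℕ) : K) = 0 := by push_cast; rw [← hm]; ring
    exact absurd (Nat.cast_eq_zero.mp this) (by omega)
  have hsurj := LinearMap.injective_iff_surjective.mp hinj
  have hwk : T x ∈ LinearMap.ker (LieAlgebra.ad K g e) := by
    simp only [LinearMap.mem_ker, LieAlgebra.ad_apply]
    have := hEH x
    rw [hx, hvμ, lie_add, lie_smul, hx] at this
    rw [hTa, lie_add, lie_smul, hx, add_smul, add_comm ((n : K) • v), ← add_assoc, ← this]; simp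
  obtain ⟨⟨w, hw⟩, hw'⟩ := hsurj ⟨T x, hwk⟩
  have hw1 : T w = T x := by simpa using congrArg Subtype.val hw'
  simp only [LinearMap.mem_ker, LieAlgebra.ad_apply] at hw
  obtain ⟨y, hy⟩ : ∃ y, y = x - w := ⟨_, rfl⟩
  have hey : ⁅e, y⁆ = v := by rw [hy, lie_sub, hx, hw, sub_zero]
  have hhy : ⁅h, y⁆ = (-((n : K) + 2)) • y := by
    have : T y = 0 := by rw [hy, map_sub, hw1, sub_self]
    rw [hTa, add_eq_zero_iff_eq_neg, ← neg_smul] at this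
    exact this
  have hy0 : y ≠ 0 := by rintro rfl; exact hv0 (by simpa using hey.symm)
  have hhF (k : ℕ) : ⁅h, ((LieModule.toEnd K g g f) ^ k) y⁆
      = (-((n : K) + 2) - 2 * k) • ((LieModule.toEnd K g g f) ^ k) y := by
    have := t.symm.lie_h_pow_toEnd_e (m := y) (μ := (n : K) + 2) (by rw [neg_lie, hhy, neg_smul, neg_neg]) k
    rw [neg_lie, neg_eq_iff_eq_neg, ← neg_smul] at this
    rw [this]; congr 1; ring
  have hE (k : ℕ) : ⁅e, ((LieModule.toEnd K g g f) ^ (k + 1)) y⁆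
      = (-((k + 1) * ((n : K) + 2 + k))) • ((LieModule.toEnd K g g f) ^ k) y := by
    induction k with
    | zero =>
      simp only [zero_add, pow_one, LieModule.toEnd_apply_apply, pow_zero, Module.End.one_apply]
      rw [leibniz_lie e, t.lie_e_f, hey, hfv, hhy]; simp
    | succ k ih =>
      rw [pow_succ', Module.End.mul_apply, LieModule.toEnd_apply_apply, leibniz_lie e, t.lie_e_f,
        hhF, ih, lie_smul, ← LieModule.toEnd_apply_apply K g g f, ← Module.End.mul_apply,
        ← pow_succ', ← add_smul]
      congr 1; push_cast; ring
  have hne (k : ℕ) : ((LieModule.toEnd K g g f) ^ k) y ≠ 0 := by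
    induction k with
    | zero => simpa using hy0
    | succ k ih =>
      intro h0
      have := hE k
      rw [h0, lie_zero, eq_comm, smul_eq_zero_iff_left ih, neg_eq_zero] at this
      have h1 : (((k + 1) * (n + 2 + k) : ℕ) : K) = 0 := by push_cast; exact this
      exact absurd (Nat.cast_eq_zero.mp h1) (by positivity)
  obtain ⟨k, hk⟩ := slod_nilp t.symm y ((n : K) + 2) (by rw [neg_lie, hhy, neg_smul, neg_neg])
  exact hne k hk


/-- The Slodowy slice `S = e + ker(ad f)` is transverse to the adjoint orbit of
`e` at `e`: `g` decomposes as the internal direct sum `g = [e, g] ⊕ ker(ad f)` of the image of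
`ad e` and the kernel of `ad f`. -/
theorem range_ad_e_isCompl_ker_ad_f
    (K : Type*) [Field K] [IsAlgClosed K] [CharZero K]
    (g : Type*) [LieRing g] [LieAlgebra K g] [FiniteDimensional K g]
    [LieAlgebra.IsSemisimple K g]
    (e h f : g) (he : e ≠ 0)
    (hhe : ⁅h, e⁆ = (2 : K) • e) (hhf : ⁅h, f⁆ = (-2 : K) • f) (hef : ⁅e, f⁆ = h) :
    IsCompl (LinearMap.range (LieAlgebra.ad K g e)) (LinearMap.ker (LieAlgebra.ad K g f)) := by

  have t : IsSl2Triple h e f := by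
    refine ⟨?_, hef, ?_, ?_⟩
    · rintro rfl
      rw [zero_lie, eq_comm, smul_eq_zero] at hhe
      exact hhe.elim two_ne_zero he
    · rw [hhe, two_smul, two_nsmul]
    · rw [hhf, neg_smul, two_smul, two_nsmul]
  have d1 := slod_disj (K := K) t
  have d2 := slod_disj (K := K) t.symm
  refine ⟨d1, codisjoint_iff.mpr ?_⟩
  apply Submodule.eq_top_of_disjoint _ _ _ d1
  have r1 := LinearMap.finrank_range_add_finrank_ker (LieAlgebra.ad K g e)
  have r2 := LinearMap.finrank_range_add_finrank_ker (LieAlgebra.ad K g f)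
  have i2 := Submodule.finrank_add_finrank_le_of_disjoint d2
  omega
end

section
/- Let l ⊆ g(-1) be a Lagrangian (maximal isotropic) subspace for the restriction of ω_χ to g(-1), and set m := l ⊕ ⊕_{i ≤ -2} g(i). Then 2·dim m = dim g − dim z_g(e), where z_g(e) = ker(ad e) is the centralizer of e; i.e. dim m equals half the dimension of the adjoint orbit of e. -/
namespace SlAux
open LieModule Module

set_option linter.unusedSectionVars false

variable {K L M : Type*} [Field K] [CharZero K] [LieRing L] [LieAlgebra K L]
  [AddCommGroup M] [Module K M] [LieRingModule L M] [LieModule K L M] [FiniteDimensional K M]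
  {h e f : L}

lemma nilE (t : IsSl2Triple h e f) {m : M} {μ : K} (hm : ⁅h, m⁆ = μ • m) :
    ∃ k, ((toEnd K L M e) ^ k) m = 0 := by
  by_contra! contra
  let evals (n : ℕ) : K := μ + 2 * (n : K)
  have h_inj : Function.Injective evals := fun a b hab ↦ by
    simpa [evals, add_right_inj, mul_eq_mul_left_iff, Nat.cast_inj] using hab
  have aux (ν : Set.range evals) : (toEnd K L M h).HasEigenvector ν
      (((toEnd K L M e) ^ (ν.property.choose)) m) := by
    refine ⟨?_, contra _⟩
    have h1 := t.lie_h_pow_toEnd_e hm ν.property.choose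
    have h2 : μ + 2 * (ν.property.choose : K) = ν := ν.property.choose_spec
    rw [h2] at h1
    rw [Module.End.mem_eigenspace_iff, toEnd_apply_apply]
    exact h1
  have _i := ((toEnd K L M h).eigenvectors_linearIndependent (Set.range evals) _ aux).finite
  exact (Set.infinite_range_of_injective h_inj) (Set.toFinite _)

lemma h_pow_e (t : IsSl2Triple h e f) {v u : M} {μ : K} (hv : ⁅h, v⁆ = μ • v + u) (k : ℕ) :
    ⁅h, (toEnd K L M e ^ k) v⁆ = (μ + 2 * k) • (toEnd K L M e ^ k) v + (toEnd K L M e ^ k) u := by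
  induction k with
  | zero => simpa using hv
  | succ k ih =>
    simp only [pow_succ', Module.End.mul_apply, toEnd_apply_apply]
    rw [leibniz_lie, ih, t.lie_h_e_smul K, smul_lie, lie_add, lie_smul]
    push_cast
    module

lemma h_pow_f (t : IsSl2Triple h e f) {v u : M} {μ : K} (hv : ⁅h, v⁆ = μ • v + u) (k : ℕ) :
    ⁅h, (toEnd K L M f ^ k) v⁆ = (μ - 2 * k) • (toEnd K L M f ^ k) v + (toEnd K L M f ^ k) u := by
  induction k with
  | zero => simpa using hv
  | succ k ih =>
    simp only [pow_succ', Module.End.mul_apply, toEnd_apply_apply]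
    rw [leibniz_lie, ih, t.lie_lie_smul_f K, neg_lie, smul_lie, lie_add, lie_smul]
    push_cast
    module

lemma nilE2 (t : IsSl2Triple h e f) {v u : M} {μ : K} (hv : ⁅h, v⁆ = μ • v + u)
    (hu : ⁅h, u⁆ = μ • u) :
    ∃ k, ((toEnd K L M e) ^ k) v = 0 := by
  obtain ⟨k, hk⟩ := nilE t hu
  have := h_pow_e t hv k
  rw [hk, add_zero] at this
  obtain ⟨j, hj⟩ := nilE t this
  exact ⟨j + k, by rw [pow_add, Module.End.mul_apply, hj]⟩

lemma nilF2 (t : IsSl2Triple h e f) {v u : M} {μ : K} (hv : ⁅h, v⁆ = μ • v + u)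
    (hu : ⁅h, u⁆ = μ • u) :
    ∃ k, ((toEnd K L M f) ^ k) v = 0 := by
  refine nilE2 t.symm (μ := -μ) (u := -u) ?_ ?_
  · rw [neg_lie, hv]; module
  · rw [neg_lie, lie_neg, hu]; module

lemma P1 (t : IsSl2Triple h e f) {v u : M} {μ : K} (hv : ⁅h, v⁆ = μ • v + u)
    (hu : ⁅h, u⁆ = μ • u) (hev : ⁅e, v⁆ = 0) : u = 0 := by
  by_contra hu0
  have heu : ⁅e, u⁆ = 0 := by
    have h1 : u = ⁅h, v⁆ - μ • v := by rw [hv]; module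
    rw [h1, lie_sub, lie_smul, hev, smul_zero, sub_zero, leibniz_lie, hev, lie_zero, add_zero,
      ← lie_skew, t.lie_h_e_smul K, neg_lie, smul_lie, hev, smul_zero, neg_zero]
  have P : t.HasPrimitiveVectorWith u μ := ⟨hu0, hu, heu⟩
  obtain ⟨n, hn⟩ := P.exists_nat
  have hv0 : v ≠ 0 := by
    rintro rfl
    simp at hv
    exact hu0 hv.symm
  obtain ⟨m, hm, hm'⟩ := Nat.exists_not_and_succ_of_not_zero_of_exists
    (p := fun k => ((toEnd K L M f) ^ k) v = 0) (by simpa using hv0) (nilF2 t hv hu)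
  have key : ∀ k : ℕ, ⁅e, (toEnd K L M f ^ (k+1)) v⁆ =
      ((k : K) + 1) • ((μ - k) • (toEnd K L M f ^ k) v + (toEnd K L M f ^ k) u) := by
    intro k
    induction k with
    | zero => simp [leibniz_lie e, t.lie_e_f, hev, hv]
    | succ k ih =>
      have h2 := h_pow_f t hv (k+1)
      rw [pow_succ', Module.End.mul_apply, toEnd_apply_apply, leibniz_lie e, t.lie_e_f, h2, ih,
        lie_smul, lie_add, lie_smul]
      simp only [pow_succ', Module.End.mul_apply, toEnd_apply_apply]
      push_cast
      module
  have h3 := key m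
  rw [hm', lie_zero, eq_comm, smul_eq_zero_iff_right (Nat.cast_add_one_ne_zero m)] at h3
  have h4 : (toEnd K L M f ^ m) u = -((μ - m) • (toEnd K L M f ^ m) v) := by
    rw [eq_neg_iff_add_eq_zero, add_comm]; exact h3
  have h5 := h_pow_f t hv m
  have h6 := P.lie_h_pow_toEnd_f m
  have h7 : (μ - m) • (toEnd K L M f ^ m) u = 0 := by
    rw [h4, lie_neg, lie_smul, h5, h4] at h6
    rw [h4]
    have := sub_eq_zero.mpr h6.symm
    rw [← this]; module
  rcases smul_eq_zero.mp h7 with h8 | h8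
  · have : n = m := by
      rw [hn, sub_eq_zero] at h8; exact_mod_cast h8
    subst this
    rw [h8, zero_smul, neg_zero] at h4
    exact P.pow_toEnd_f_ne_zero_of_eq_nat hn le_rfl h4
  · rw [h8, add_zero] at h3
    rcases smul_eq_zero.mp h3 with h9 | h9
    · have : n = m := by
        rw [hn, sub_eq_zero] at h9; exact_mod_cast h9
      subst this
      exact P.pow_toEnd_f_ne_zero_of_eq_nat hn le_rfl h8
    · exact hm h9

lemma inj (t : IsSl2Triple h e f) {w : M} {n : ℕ} (hw : ⁅h, w⁆ = ((n : K) + 2) • w)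
    (h0 : ⁅e, ⁅f, w⁆⁆ = 0) : w = 0 := by
  by_contra hw0
  obtain ⟨N, hN, hN'⟩ := Nat.exists_not_and_succ_of_not_zero_of_exists
    (p := fun k => ((toEnd K L M e) ^ k) w = 0) (by simpa using hw0) (nilE t hw)
  have P : t.HasPrimitiveVectorWith ((toEnd K L M e ^ N) w) ((n : K) + 2 + 2 * N) :=
    ⟨hN, t.lie_h_pow_toEnd_e hw N, by rw [IsSl2Triple.lie_e_pow_toEnd_e]; exact hN'⟩
  have hfe : ∀ x : M, ⁅f, ⁅e, x⁆⁆ = ⁅e, ⁅f, x⁆⁆ - ⁅h, x⁆ := by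
    intro x
    rw [leibniz_lie e, t.lie_e_f]; abel
  have key : ∀ k : ℕ, ∃ c : K, ⁅f, (toEnd K L M e ^ (k+1)) w⁆ = c • (toEnd K L M e ^ k) w := by
    intro k
    induction k with
    | zero => exact ⟨-((n : K) + 2), by simp only [zero_add, pow_one, pow_zero, toEnd_apply_apply, hfe, h0, hw, Module.End.one_apply]; module⟩
    | succ k ih =>
      obtain ⟨c, hc⟩ := ih
      refine ⟨c - ((n : K) + 2 + 2 * (k + 1 : ℕ)), ?_⟩
      rw [pow_succ', Module.End.mul_apply, toEnd_apply_apply, hfe, hc, lie_smul,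
        t.lie_h_pow_toEnd_e hw, IsSl2Triple.lie_e_pow_toEnd_e]
      module
  have key2 : ∀ k : ℕ, ∃ c : K, (toEnd K L M f ^ k) ((toEnd K L M e ^ k) w) = c • w := by
    intro k
    induction k with
    | zero => exact ⟨1, by simp⟩
    | succ k ih =>
      obtain ⟨c, hc⟩ := ih
      obtain ⟨d, hd⟩ := key k
      refine ⟨d * c, ?_⟩
      rw [pow_succ (toEnd K L M f), Module.End.mul_apply, toEnd_apply_apply, hd, map_smul, hc,
        smul_smul]
  obtain ⟨c, hc⟩ := key2 N
  have h1 := P.lie_e_pow_succ_toEnd_f N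
  rw [pow_succ', Module.End.mul_apply, hc, toEnd_apply_apply, lie_smul, lie_smul, h0, smul_zero,
    eq_comm, ← hc] at h1
  rcases smul_eq_zero.mp h1 with h2 | h2
  · have : ((N : K) + 1) * ((n : K) + 2 + 2 * N - N) = (((N + 1) * (n + 2 + N) : ℕ) : K) := by
      push_cast; ring
    rw [this] at h2
    have := Nat.cast_eq_zero.mp h2
    simp at this
  · exact P.pow_toEnd_f_ne_zero_of_eq_nat (n := n + 2 + 2 * N) (by push_cast; ring) (by omega) h2

lemma surj (t : IsSl2Triple h e f) {w : M} {n : ℕ} (hw : ⁅h, w⁆ = ((n : K) + 2) • w) :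
    ∃ x : M, ⁅h, x⁆ = ((n : K) + 2) • x ∧ ⁅e, ⁅f, x⁆⁆ = w := by
  set X := (toEnd K L M h).eigenspace ((n : K) + 2) with hX
  have hmem : ∀ x, x ∈ X ↔ ⁅h, x⁆ = ((n : K) + 2) • x := fun x => by
    rw [hX, Module.End.mem_eigenspace_iff, toEnd_apply_apply]
  have hst : ∀ x ∈ X, (toEnd K L M e * toEnd K L M f) x ∈ X := by
    intro x hx
    rw [hmem] at hx ⊢
    simp only [Module.End.mul_apply, toEnd_apply_apply]
    rw [leibniz_lie h e, leibniz_lie h f, t.lie_h_e_smul K, t.lie_lie_smul_f K, hx]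
    simp only [neg_lie, smul_lie, lie_add, lie_neg, lie_smul]
    module
  have hinj : Function.Injective ((toEnd K L M e * toEnd K L M f).restrict hst) := by
    rw [← LinearMap.ker_eq_bot, LinearMap.ker_eq_bot']
    rintro ⟨x, hx⟩ h0
    rw [Subtype.ext_iff] at h0 ⊢
    exact inj t ((hmem x).mp hx) (by simpa using h0)
  obtain ⟨⟨x, hx⟩, hxw⟩ := LinearMap.surjective_of_injective hinj ⟨w, (hmem w).mpr hw⟩
  exact ⟨x, (hmem x).mp hx, by simpa [Subtype.ext_iff] using hxw⟩

lemma diag2 (t : IsSl2Triple h e f) (k : ℕ) : ∀ {v u : M} {μ : K} (_ : ⁅h, v⁆ = μ • v + u)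
    (_ : ⁅h, u⁆ = μ • u), (toEnd K L M e ^ k) v = 0 → u = 0 := by
  induction k with
  | zero =>
    intro v u μ hv hu h0
    have h0 : v = 0 := by simpa using h0
    subst h0
    simpa using hv.symm
  | succ k ih =>
    intro v u μ hv hu h0
    have h1 := h_pow_e t hv 1
    have h2 := t.lie_h_pow_toEnd_e hu 1
    simp only [pow_one] at h1 h2
    have heu : ⁅e, u⁆ = 0 := ih h1 h2 (by
      rw [← Module.End.mul_apply, ← pow_succ, h0])
    by_contra hu0
    have P : t.HasPrimitiveVectorWith u μ := ⟨hu0, hu, heu⟩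
    obtain ⟨n, hn⟩ := P.exists_nat
    subst hn
    simp only [toEnd_apply_apply, heu, Nat.cast_one, mul_one, add_zero] at h1
    obtain ⟨x, hx, hxw⟩ := surj t h1
    have h3 := h_pow_f t (v := x) (u := 0) (μ := (n : K) + 2) (by rw [hx, add_zero]) 1
    simp only [pow_one, toEnd_apply_apply, map_zero, Nat.cast_one, add_zero, lie_zero] at h3
    refine hu0 (P1 t (v := v - ⁅f, x⁆) (u := u) (μ := (n : K)) ?_ hu ?_)
    · rw [lie_sub, hv, h3]; module
    · rw [lie_sub, hxw, sub_self]

lemma diag (t : IsSl2Triple h e f) (μ : K) (k : ℕ) : ∀ v : M,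
    ((toEnd K L M h - μ • (1 : End K M)) ^ k) v = 0 → ⁅h, v⁆ = μ • v := by
  induction k with
  | zero => intro v hv; have : v = 0 := by simpa using hv
            simp [this]
  | succ k ih =>
    intro v hv
    rw [pow_succ, Module.End.mul_apply] at hv
    have h1 := ih _ hv
    have hv' : ⁅h, v⁆ = μ • v + (toEnd K L M h - μ • (1 : End K M)) v := by simp
    obtain ⟨j, hj⟩ := nilE2 t hv' h1
    have := diag2 t j hv' h1 hj
    rw [hv', this, add_zero]

lemma int_weight (t : IsSl2Triple h e f) {m : M} {μ : K} (hm : ⁅h, m⁆ = μ • m) (h0 : m ≠ 0) :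
    ∃ i : ℤ, μ = i := by
  obtain ⟨N, hN, hN'⟩ := Nat.exists_not_and_succ_of_not_zero_of_exists
    (p := fun k => ((toEnd K L M e) ^ k) m = 0) (by simpa using h0) (nilE t hm)
  have P : t.HasPrimitiveVectorWith ((toEnd K L M e ^ N) m) (μ + 2 * N) :=
    ⟨hN, t.lie_h_pow_toEnd_e hm N, by rw [IsSl2Triple.lie_e_pow_toEnd_e]; exact hN'⟩
  obtain ⟨n, hn⟩ := P.exists_nat
  exact ⟨n - 2 * N, by push_cast; rw [← hn]; ring⟩

lemma iSup_top [IsAlgClosed K] (t : IsSl2Triple h e f) :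
    ⨆ i : ℤ, (toEnd K L M h).eigenspace (i : K) = ⊤ := by
  rw [eq_top_iff, ← Module.End.iSup_maxGenEigenspace_eq_top (toEnd K L M h)]
  refine iSup_le fun μ v hv => ?_
  rw [Module.End.mem_maxGenEigenspace] at hv
  obtain ⟨k, hk⟩ := hv
  have hv := diag t μ k v hk
  by_cases h0 : v = 0
  · simp [h0]
  obtain ⟨i, rfl⟩ := int_weight t hv h0
  exact Submodule.mem_iSup_of_mem i (by rw [Module.End.mem_eigenspace_iff]; exact hv)

lemma ker_neg (t : IsSl2Triple h e f) {m : M} {i : ℤ} (hi : i < 0) (hm : ⁅h, m⁆ = (i : K) • m)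
    (he : ⁅e, m⁆ = 0) : m = 0 := by
  by_contra h0
  obtain ⟨n, hn⟩ := (⟨h0, hm, he⟩ : t.HasPrimitiveVectorWith m (i : K)).exists_nat
  have : i = n := by exact_mod_cast hn
  omega

end SlAux

/-- Let `l ⊆ g(-1)` be a Lagrangian (maximal isotropic) subspace for the
restriction of `ω_χ` to `g(-1)`, and set `m := l ⊕ ⊕_{i ≤ -2} g(i)`. Then
`2 • dim m = dim g − dim z_g(e)`, where `z_g(e) = ker(ad e)`; i.e. `dim m` equals half the
dimension of the adjoint orbit of `e`. -/
theorem dim_m_eq_half_dim_orbit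
    (K : Type*) [Field K] [IsAlgClosed K] [CharZero K]
    (g : Type*) [LieRing g] [LieAlgebra K g] [FiniteDimensional K g]
    [LieAlgebra.IsSemisimple K g]
    (e h f : g) (he : e ≠ 0)
    (hhe : ⁅h, e⁆ = (2 : K) • e) (hhf : ⁅h, f⁆ = (-2 : K) • f) (hef : ⁅e, f⁆ = h)
    (l : Submodule K g)
    (hl : l ≤ Module.End.eigenspace (LieAlgebra.ad K g h) ((-1 : ℤ) : K))
    (hiso : ∀ x ∈ l, ∀ y ∈ l, killingForm K g e ⁅x, y⁆ = 0)
    (hmax : ∀ l' : Submodule K g,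
      l' ≤ Module.End.eigenspace (LieAlgebra.ad K g h) ((-1 : ℤ) : K) →
      (∀ x ∈ l', ∀ y ∈ l', killingForm K g e ⁅x, y⁆ = 0) → l ≤ l' → l' = l)
    (m : Submodule K g)
    (hm : m = l ⊔ ⨆ i : ℤ, ⨆ _ : i ≤ -2,
      Module.End.eigenspace (LieAlgebra.ad K g h) (i : K)) :
    2 * Module.finrank K m =
      Module.finrank K g - Module.finrank K (LinearMap.ker (LieAlgebra.ad K g e)) := by
  have hh0 : h ≠ 0 := by
    rintro rfl
    rw [zero_lie, eq_comm, smul_eq_zero_iff_right two_ne_zero] at hhe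
    exact he hhe
  have t : IsSl2Triple h e f := ⟨hh0, hef, by rw [hhe]; module, by rw [hhf]; module⟩
  set G : ℤ → Submodule K g := fun i => Module.End.eigenspace (LieAlgebra.ad K g h) (i : K)
    with hG
  have mG : ∀ i x, x ∈ G i ↔ ⁅h, x⁆ = (i : K) • x := fun i x => by
    rw [hG]; exact Module.End.mem_eigenspace_iff
  have htop : ⨆ i, G i = ⊤ := SlAux.iSup_top (K := K) (L := g) (M := g) t
  have hind : iSupIndep G :=
    (Module.End.eigenspaces_iSupIndep (LieAlgebra.ad K g h)).comp Int.cast_injective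
  have heG : ∀ i x, x ∈ G i → ⁅e, x⁆ ∈ G (i + 2) := by
    intro i x hx
    rw [mG] at hx ⊢
    rw [leibniz_lie, hhe, hx, lie_smul, smul_lie]
    push_cast; module
  have inv : ∀ x y z : g, killingForm K g ⁅x, y⁆ z = killingForm K g x ⁅y, z⁆ :=
    fun x y z => LieModule.traceForm_apply_lie_apply K g g x y z
  have inv' : ∀ x y z : g, killingForm K g ⁅x, y⁆ z = - killingForm K g y ⁅x, z⁆ :=
    fun x y z => LieModule.traceForm_apply_lie_apply' K g g x y z
  have ort : ∀ i j x y, x ∈ G i → y ∈ G j → i + j ≠ 0 → killingForm K g x y = 0 := by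
    intro i j x y hx hy hij
    rw [mG] at hx hy
    have h1 := inv' h x y
    rw [hx, hy, map_smul, map_smul, LinearMap.smul_apply, smul_eq_mul, smul_eq_mul] at h1
    have h2 : ((i + j : ℤ) : K) * killingForm K g x y = 0 := by
      push_cast; linear_combination h1
    exact (mul_eq_zero.mp h2).resolve_left (by exact_mod_cast hij)
  have nd : ∀ x, (∀ y, killingForm K g x y = 0) → x = 0 :=
    fun x hx => (LieAlgebra.IsKilling.killingForm_nondegenerate K g).1 x hx
  let B : LinearMap.BilinForm K g := killingForm K g ∘ₗ LieAlgebra.ad K g e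
  have hB : ∀ x y, B x y = killingForm K g ⁅e, x⁆ y := fun x y => rfl
  have hBalt : ∀ x y, B x y = - B y x := fun x y => by
    rw [hB, hB, inv', LieModule.traceForm_comm]
  have hBort : ∀ i j x y, x ∈ G i → y ∈ G j → i + j ≠ -2 → B x y = 0 := by
    intro i j x y hx hy hij
    exact ort (i + 2) j _ _ (heG i x hx) hy (by omega)
  have hker : B.ker = LinearMap.ker (LieAlgebra.ad K g e) := by
    ext x
    simp only [LinearMap.mem_ker]
    constructor
    · intro hx
      exact nd _ fun y => by
        have := LinearMap.congr_fun hx y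
        exact this
    · intro hx
      ext y
      change killingForm K g (LieAlgebra.ad K g e x) y = 0
      rw [hx]; simp
  have hlm : l ≤ m := hm ▸ le_sup_left
  have hGm : ∀ i ≤ -2, G i ≤ m := fun i hi => by
    rw [hm]
    exact le_sup_of_le_right (le_iSup₂_of_le i hi le_rfl)
  have hmle : ∀ p : Submodule K g, l ≤ p → (∀ i ≤ -2, G i ≤ p) → m ≤ p := fun p h1 h2 => by
    rw [hm]
    exact sup_le h1 (iSup₂_le h2)
  have hisoB : ∀ x ∈ l, ∀ y ∈ l, B x y = 0 := fun x hx y hy => by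
    rw [hB, inv]; exact hiso x hx y hy
  have hliso : l ≤ B.orthogonal m := by
    intro y hy x hx
    have : m ≤ LinearMap.ker (B.flip y) := by
      refine hmle _ (fun x hx => hisoB x hx y hy) fun i hi x hx => ?_
      exact hBort i (-1) x y hx (hl hy) (by omega)
    exact this hx
  have hGiso : ∀ i ≤ -2, G i ≤ B.orthogonal m := by
    intro i hi y hy x hx
    have : m ≤ LinearMap.ker (B.flip y) := by
      refine hmle _ (fun x hx => ?_) fun j hj x hx => ?_
      · exact hBort (-1) i x y (hl hx) hy (by omega)
      · exact hBort j i x y hx hy (by omega)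
    exact this hx
  have hzorth : LinearMap.ker (LieAlgebra.ad K g e) ≤ B.orthogonal m := by
    intro y hy x _
    have hy' : ⁅e, y⁆ = 0 := hy
    change B x y = 0
    rw [hBalt, hB, hy']; simp
  -- the orthogonal of `m`
  have horth : B.orthogonal m = m ⊔ LinearMap.ker (LieAlgebra.ad K g e) := by
    refine le_antisymm ?_ (sup_le (hmle _ hliso hGiso) hzorth)
    intro x hx
    obtain ⟨c, hc, hcx⟩ := (Submodule.mem_iSup_iff_exists_finsupp G x).mp (htop ▸ trivial)
    have hcomp : ∀ i j y, y ∈ G j → i + j = -2 → B y x = B y (c i) := by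
      intro i j y hy hij
      rw [← hcx, Finsupp.sum, map_sum]
      refine Finset.sum_eq_single i (fun k _ hk => ?_) (fun hi => ?_)
      · exact hBort j k y (c k) hy (hc k) (by omega)
      · rw [Finsupp.notMem_support_iff.mp hi, map_zero]
    rw [← hcx]
    refine Submodule.sum_mem _ fun i _ => ?_
    rcases lt_trichotomy i (-1) with hi | hi | hi
    · exact Submodule.mem_sup_left (hGm i (by omega) (hc i))
    · refine Submodule.mem_sup_left (hlm ?_)
      have hci : c i ∈ G (-1) := hi ▸ hc i
      have hcl : ∀ y ∈ l, B y (c i) = 0 := fun y hy => by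
        rw [← hcomp i (-1) y (hl hy) (by omega)]
        exact hx y (hlm hy)
      have hcc : B (c i) (c i) = 0 := by
        rw [hB, inv, lie_self, map_zero]
      have := hmax (l ⊔ K ∙ c i) (sup_le hl ((Submodule.span_singleton_le_iff_mem _ _).mpr hci))
        (by
          intro x hx y hy
          rw [← inv, ← hB]
          obtain ⟨x1, hx1, x2, hx2, rfl⟩ := Submodule.mem_sup.mp hx
          obtain ⟨y1, hy1, y2, hy2, rfl⟩ := Submodule.mem_sup.mp hy
          obtain ⟨a, rfl⟩ := Submodule.mem_span_singleton.mp hx2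
          obtain ⟨b, rfl⟩ := Submodule.mem_span_singleton.mp hy2
          simp only [map_add, map_smul, LinearMap.add_apply, LinearMap.smul_apply,
            hisoB x1 hx1 y1 hy1, hcl x1 hx1, hcc, hBalt (c i) y1, hcl y1 hy1]
          simp) le_sup_left
      rw [← this]
      exact Submodule.mem_sup_right (Submodule.mem_span_singleton_self _)
    · refine Submodule.mem_sup_right ?_
      refine nd _ fun y => ?_
      have : (⊤ : Submodule K g) ≤ LinearMap.ker (B (c i)) := by
        rw [← htop]
        refine iSup_le fun j y hy => ?_
        change B (c i) y = 0
        by_cases hij : i + j = -2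
        · rw [hBalt, ← hcomp i j y hy hij, neg_eq_zero]
          exact hx y (hGm j (by omega) hy)
        · exact hBort i j _ _ (hc i) hy hij
      exact this (Submodule.mem_top (x := y))
  have hdisj : m ⊓ LinearMap.ker (LieAlgebra.ad K g e) = ⊥ := by
    rw [eq_bot_iff]
    rintro x ⟨hxm, hxe⟩
    have hxe : ⁅e, x⁆ = 0 := hxe
    have h1 : m ≤ ⨆ i : {i : ℤ // i < 0}, G i :=
      hmle _ (hl.trans (le_iSup (fun i : {i : ℤ // i < 0} => G i) ⟨-1, by omega⟩))
        fun i hi => le_iSup (fun i : {i : ℤ // i < 0} => G i) ⟨i, by omega⟩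
    obtain ⟨c, hc, hcx⟩ := (Submodule.mem_iSup_iff_exists_finsupp _ x).mp (h1 hxm)
    have hind' : iSupIndep (fun i : {i : ℤ // i < 0} => G (i + 2)) :=
      hind.comp (f := fun i : {i : ℤ // i < 0} => (i : ℤ) + 2) fun a b hab => by
        apply Subtype.ext; simpa using hab
    rw [iSupIndep_iff_finsetSum_eq_zero_imp_eq_zero] at hind'
    have h2 := hind' c.support (fun i => ⁅e, c i⁆) (fun i _ => heG _ _ (hc i)) (by
      rw [← lie_sum, ← hxe, ← hcx, Finsupp.sum])
    rw [← hcx]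
    refine Submodule.sum_mem _ fun i hi => ?_
    exact SlAux.ker_neg t i.2 ((mG _ _).mp (hc i)) (h2 i hi)
  have e1 := LinearMap.BilinForm.finrank_add_finrank_orthogonal' (B := B) m
  rw [hker, hdisj, finrank_bot, horth] at e1
  have e2 := Submodule.finrank_sup_add_finrank_inf_eq m (LinearMap.ker (LieAlgebra.ad K g e))
  rw [hdisj, finrank_bot] at e2
  omega
end

section
/- Let l ⊆ g(-1) be isotropic for the restriction of ω_χ to g(-1), let l^∠ := {x ∈ g(-1) : ω_χ(x,y) = 0 for all y ∈ l} be its skew-orthogonal complement in g(-1), and set m := l ⊕ ⊕_{i ≤ -2} g(i) and n := l^∠ ⊕ ⊕_{i ≤ -2} g(i). Then the κ-orthogonal complement of m in g decomposes as the internal direct sum {z ∈ g : κ(z,x) = 0 for all x ∈ m} = [e, n] ⊕ ker(ad f). -/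
/-- The skew-symmetric bilinear form `ω_χ(x, y) := κ(e, ⁅x, y⁆)` on `g`. -/
noncomputable def omegaChi
    (K : Type*) [Field K]
    (g : Type*) [LieRing g] [LieAlgebra K g] [Module.Finite K g]
    (e : g) : LinearMap.BilinForm K g :=
  LinearMap.mk₂ K (fun x y => killingForm K g e ⁅x, y⁆)
    (fun x x' y => by simp only [add_lie, map_add])
    (fun c x y => by simp only [smul_lie, map_smul])
    (fun x y y' => by simp only [lie_add, map_add])
    (fun c x y => by simp only [lie_smul, map_smul])

namespace SlTwoAux

open Module

set_option linter.unusedSectionVars false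

variable {K V : Type*} [Field K] [CharZero K] [AddCommGroup V] [Module K V]

/-- Sum of the integral eigenspaces with index in `s`. -/
def G (H : End K V) (s : Set ℤ) : Submodule K V :=
  ⨆ i : ℤ, ⨆ _ : i ∈ s, End.eigenspace H (i : K)

lemma G_le_eq (H : End K V) : (⨆ i : ℤ, ⨆ _ : i ≤ -2, End.eigenspace H (i : K)) =
    G H {i | i ≤ -2} := by
  simp only [G, Set.mem_ofPred_eq]

lemma G_le {H : End K V} {s : Set ℤ} {W : Submodule K V}
    (h : ∀ i ∈ s, ∀ x, H x = (i : K) • x → x ∈ W) : G H s ≤ W :=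
  iSup₂_le fun i hi x hx => h i hi x (End.mem_eigenspace_iff.1 hx)

lemma mem_G {H : End K V} {s : Set ℤ} {i : ℤ} (hi : i ∈ s) {x : V} (hx : H x = (i : K) • x) :
    x ∈ G H s :=
  (le_iSup₂_of_le (f := fun (i : ℤ) (_ : i ∈ s) => End.eigenspace H (i : K)) i hi le_rfl)
    (End.mem_eigenspace_iff.2 hx)

lemma G_mono {H : End K V} {s t : Set ℤ} (h : s ⊆ t) : G H s ≤ G H t :=
  G_le fun _ hi _ hx => mem_G (h hi) hx

lemma G_neg (H : End K V) (s : Set ℤ) : G (-H) s ≤ G H {i | -i ∈ s} := by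
  refine G_le fun i hi x hx => mem_G (i := -i) (by simpa using hi) ?_
  rw [LinearMap.neg_apply, neg_eq_iff_eq_neg] at hx
  simpa using hx

lemma G_disjoint (H : End K V) {s t : Set ℤ} (h : Disjoint s t) : Disjoint (G H s) (G H t) := by
  have := (End.eigenspaces_iSupIndep H).comp (f := fun i : ℤ => (i : K)) Int.cast_injective
  have h2 := this.disjoint_biSup_biSup h
  exact h2

lemma G_union (H : End K V) {s t u : Set ℤ} (h : s ⊆ t ∪ u) : G H s ≤ G H t ⊔ G H u := by
  refine G_le fun i hi x hx => ?_
  rcases h hi with h | h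
  · exact Submodule.mem_sup_left (mem_G h hx)
  · exact Submodule.mem_sup_right (mem_G h hx)

lemma nilp [FiniteDimensional K V] (E H : End K V) (c : K) (hc : c ≠ 0)
    (hHE : ∀ x, H (E x) = E (H x) + c • E x) : ∃ N, E ^ N = 0 := by
  by_contra! hne
  let T : End K (End K V) := LinearMap.mulLeft K H - LinearMap.mulRight K H
  have hE : H * E = E * H + c • E := LinearMap.ext hHE
  have key : ∀ n : ℕ, H * E ^ n = E ^ n * H + (n * c) • E ^ n := by
    intro n
    induction n with
    | zero => simp
    | succ n ih =>
      rw [pow_succ, ← mul_assoc, ih, add_mul, mul_assoc, hE, mul_add, smul_mul_assoc,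
        mul_smul_comm, ← mul_assoc, add_assoc, ← add_smul]
      congr 2
      push_cast; ring
  have hli := End.eigenvectors_linearIndependent' T (fun n : ℕ => (n * c : K))
    (fun a b hab => by simpa [hc] using hab) (fun n => E ^ n)
    (fun n => ⟨by
      rw [End.mem_eigenspace_iff]
      simp [T, key n], hne n⟩)
  have := hli.finite
  exact not_finite ℕ

lemma comm_aux (E H F : End K V)
    (hHF : ∀ x, H (F x) = F (H x) - (2 : K) • F x)
    (hEF : ∀ x, E (F x) = F (E x) + H x) (v : V) (hv : F (E v) = 0) (n : ℕ) :
    H ((F ^ n) v) = (F ^ n) (H v) - (2 * n : K) • (F ^ n) v ∧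
    E ((F ^ (n + 1)) v) = (n + 1 : K) • (F ^ n) (H v - (n : K) • v) := by
  induction n with
  | zero => simp [hEF, hv]
  | succ n ih =>
    have h1 : H ((F ^ (n+1)) v) = (F ^ (n+1)) (H v) - (2 * (n+1 : ℕ) : K) • (F ^ (n+1)) v := by
      simp only [pow_succ', End.mul_apply, hHF, ih.1, map_sub, map_smul]
      push_cast; module
    refine ⟨h1, ?_⟩
    rw [pow_succ', End.mul_apply, hEF, ih.2, h1]
    simp only [pow_succ', End.mul_apply, map_sub, map_smul]
    push_cast; module

lemma mem_of_pow (E H F : End K V)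
    (hHE : ∀ x, H (E x) = E (H x) + (2 : K) • E x)
    (hHF : ∀ x, H (F x) = F (H x) - (2 : K) • F x)
    (hEF : ∀ x, E (F x) = F (E x) + H x) (N : ℕ) :
    ∀ v : V, F (E v) = 0 → (F ^ N) v = 0 → v ∈ G H {i | 0 ≤ i ∧ i < N} := by
  induction N with
  | zero => intro v _ hv; simp at hv; simp [hv]
  | succ N ih =>
    intro v hv hN
    have h2 := (comm_aux E H F hHF hEF v hv N).2
    rw [hN, map_zero, eq_comm, smul_eq_zero_iff_right (by exact_mod_cast N.succ_ne_zero)] at h2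
    have h3 : F (E (H v - (N : K) • v)) = 0 := by
      have h4 : E (H v) = H (E v) - (2 : K) • E v := by rw [hHE]; simp
      have h5 := hHF (E v)
      rw [hv] at h5
      simp only [map_sub, map_smul, h4, hv, smul_zero, sub_zero]
      simpa using h5.symm
    have h6 := ih _ h3 h2
    have h7 : G H {i | 0 ≤ i ∧ i < (N : ℤ)} ≤
        (G H {i | 0 ≤ i ∧ i < (N : ℤ)}).map (H - (N : K) • LinearMap.id) := by
      refine G_le fun i hi x hx => ?_
      have hne : (i : K) - N ≠ 0 := by
        rw [sub_ne_zero]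
        exact_mod_cast hi.2.ne
      refine ⟨((i : K) - N)⁻¹ • x, Submodule.smul_mem _ _ (mem_G hi hx), ?_⟩
      simp only [map_smul, LinearMap.sub_apply, hx, LinearMap.smul_apply, LinearMap.id_apply,
        ← sub_smul]
      rw [smul_smul, inv_mul_cancel₀ hne, one_smul]
    obtain ⟨u, hu, huv⟩ := h7 h6
    have h8 : v = u + (v - u) := by abel
    rw [h8]
    refine Submodule.add_mem _ (G_mono ?_ hu) (mem_G (i := N) ?_ ?_)
    · intro i hi
      have := hi.2
      have := hi.1
      refine ⟨hi.1, ?_⟩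
      push_cast; omega
    · simp
    · simp only [LinearMap.sub_apply, LinearMap.smul_apply, LinearMap.id_apply] at huv
      rw [map_sub, smul_sub, Int.cast_natCast]
      rw [sub_eq_sub_iff_add_eq_add] at huv ⊢; rw [← huv, add_comm]

lemma map_E (E H : End K V)
    (hHE : ∀ x, H (E x) = E (H x) + (2 : K) • E x) {s t : Set ℤ} (h : ∀ i ∈ s, i + 2 ∈ t) {x : V} (hx : x ∈ G H s) :
    E x ∈ G H t := by
  have : G H s ≤ (G H t).comap E := by
    refine G_le fun i hi x hx => mem_G (h i hi) ?_
    rw [hHE, hx, map_smul]; push_cast; module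
  exact this hx

section
variable [FiniteDimensional K V] (E H F : End K V)
    (hHE : ∀ x, H (E x) = E (H x) + (2 : K) • E x)
    (hHF : ∀ x, H (F x) = F (H x) - (2 : K) • F x)
    (hEF : ∀ x, E (F x) = F (E x) + H x)

include hHE hHF hEF

lemma mem_nonneg (v : V) (hv : F (E v) = 0) : v ∈ G H {i | 0 ≤ i} := by
  obtain ⟨N, hN⟩ := nilp F H (-2) (by norm_num) (fun x => by rw [hHF]; module)
  exact G_mono (fun i hi => hi.1) (mem_of_pow E H F hHE hHF hEF N v hv (by simp [hN]))

lemma mem_nonpos (v : V) (hv : E (F v) = 0) : v ∈ G H {i | i ≤ 0} := by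
  have := G_neg H _ (mem_nonneg F (-H) E (fun x => by simp only [LinearMap.neg_apply, hHF, map_neg]; abel)
    (fun x => by simp only [LinearMap.neg_apply, hHE, map_neg]; abel)
    (fun x => by simp [hEF]) v hv)
  exact G_mono (fun i hi => by simpa using hi) this

lemma disj : Disjoint (LinearMap.range E) (LinearMap.ker F) := by
  rw [Submodule.disjoint_def]
  rintro _ ⟨v, rfl⟩ hw
  rw [LinearMap.mem_ker] at hw
  have h1 := map_E E H hHE (t := {i | 2 ≤ i}) (fun i hi => by simpa using hi)
    (mem_nonneg E H F hHE hHF hEF v hw)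
  have h2 := mem_nonpos E H F hHE hHF hEF (E v) (by simp [hw])
  refine Submodule.disjoint_def.1 (G_disjoint H ?_) _ h1 h2
  rw [Set.disjoint_left]
  intro i hi hi'
  simp only [Set.mem_ofPred_eq] at hi hi'
  omega

lemma sup_top : LinearMap.range E ⊔ LinearMap.ker F = ⊤ := by
  have d1 := disj E H F hHE hHF hEF
  have d2 := disj F (-H) E (fun x => by simp only [LinearMap.neg_apply, hHF, map_neg]; abel)
    (fun x => by simp only [LinearMap.neg_apply, hHE, map_neg]; abel)
    (fun x => by simp [hEF])
  apply Submodule.eq_top_of_disjoint _ _ _ d1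
  have e1 := LinearMap.finrank_range_add_finrank_ker E
  have e2 := LinearMap.finrank_range_add_finrank_ker F
  have e3 := Submodule.finrank_add_finrank_le_of_disjoint d2
  omega

lemma G_top : G H Set.univ = ⊤ := by
  obtain ⟨N, hN⟩ := nilp E H 2 (by norm_num) hHE
  have key : ∀ n : ℕ, ∀ v : V, ∃ u, v - (E ^ n) u ∈ G H Set.univ := by
    intro n
    induction n with
    | zero => intro v; exact ⟨v, by simp⟩
    | succ n ih =>
      intro v
      obtain ⟨u, hu⟩ := ih v
      have : u ∈ LinearMap.range E ⊔ LinearMap.ker F := by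
        rw [sup_top E H F hHE hHF hEF]; trivial
      obtain ⟨_, ⟨a, rfl⟩, b, hb, rfl⟩ := Submodule.mem_sup.1 this
      refine ⟨a, ?_⟩
      have hb' : b ∈ G H Set.univ := G_mono (Set.subset_univ _)
        (mem_nonpos E H F hHE hHF hEF b (by rw [LinearMap.mem_ker.1 hb, map_zero]))
      have hk : ∀ k : ℕ, (E ^ k) b ∈ G H Set.univ := by
        intro k
        induction k with
        | zero => simpa
        | succ k ih => rw [pow_succ']; exact map_E E H hHE (by simp) ih
      have h3 : v - (E ^ (n + 1)) a = (v - (E ^ n) (E a + b)) + (E ^ n) b := by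
        rw [pow_succ, End.mul_apply, map_add]; abel
      rw [h3]
      exact Submodule.add_mem _ hu (hk n)
  rw [eq_top_iff]
  intro v _
  obtain ⟨u, hu⟩ := key N v
  simpa [hN] using hu

end

lemma kappa_zero {g : Type*} [LieRing g] [LieAlgebra K g] [FiniteDimensional K g] (h : g)
    {s t : Set ℤ} (hst : ∀ i ∈ s, ∀ j ∈ t, i + j ≠ 0) {x y : g}
    (hx : x ∈ G (LieAlgebra.ad K g h) s) (hy : y ∈ G (LieAlgebra.ad K g h) t) :
    killingForm K g x y = 0 := by
  have h1 : G (LieAlgebra.ad K g h) s ≤ LinearMap.ker ((killingForm K g).flip y) := by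
    refine G_le fun i hi x hx => ?_
    have h2 : G (LieAlgebra.ad K g h) t ≤ LinearMap.ker (killingForm K g x) := by
      refine G_le fun j hj y hy => ?_
      rw [LinearMap.mem_ker]
      have h3 := LieModule.traceForm_apply_lie_apply' K g g h x y
      rw [LieAlgebra.ad_apply] at hx hy
      rw [hx, hy] at h3
      simp only [map_smul, LinearMap.smul_apply, smul_eq_mul] at h3
      have h4 : ((i + j : ℤ) : K) * killingForm K g x y = 0 := by
        push_cast
        change (i : K) * killingForm K g x y = -((j : K) * killingForm K g x y) at h3
        linear_combination h3
      exact (mul_eq_zero.1 h4).resolve_left (by exact_mod_cast hst i hi j hj)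
    exact h2 hy
  exact h1 hx

lemma omega_eq {g : Type*} [LieRing g] [LieAlgebra K g] [FiniteDimensional K g] (e x y : g) :
    omegaChi K g e x y = killingForm K g ⁅e, x⁆ y := by
  have h1 : omegaChi K g e x y = killingForm K g e ⁅x, y⁆ := by
    unfold omegaChi
    rw [LinearMap.mk₂_apply]
  rw [h1]
  exact (LieModule.traceForm_apply_lie_apply K g g e x y).symm

end SlTwoAux

set_option maxHeartbeats 800000 in
/-- Let `l ⊆ g(-1)` be isotropic for the restriction of `ω_χ` to `g(-1)`, let
`l^∠ := {x ∈ g(-1) : ω_χ(x, y) = 0 for all y ∈ l}` be its skew-orthogonal complement in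
`g(-1)`, and set `m := l ⊕ ⊕_{i ≤ -2} g(i)` and `n := l^∠ ⊕ ⊕_{i ≤ -2} g(i)`. Then the
`κ`-orthogonal complement of `m` in `g` decomposes as the internal direct sum
`{z ∈ g : κ(z, x) = 0 ∀ x ∈ m} = [e, n] ⊕ ker(ad f)`. -/
theorem orthogonal_of_m_decomposition
    (K : Type*) [Field K] [IsAlgClosed K] [CharZero K]
    (g : Type*) [LieRing g] [LieAlgebra K g] [FiniteDimensional K g]
    [LieAlgebra.IsSemisimple K g]
    (e h f : g) (he : e ≠ 0)
    (hhe : ⁅h, e⁆ = (2 : K) • e) (hhf : ⁅h, f⁆ = (-2 : K) • f) (hef : ⁅e, f⁆ = h)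
    (l : Submodule K g)
    (hl : l ≤ Module.End.eigenspace (LieAlgebra.ad K g h) ((-1 : ℤ) : K))
    (hiso : ∀ x ∈ l, ∀ y ∈ l, omegaChi K g e x y = 0)
    (lperp : Submodule K g)
    (hlperp : lperp = Module.End.eigenspace (LieAlgebra.ad K g h) ((-1 : ℤ) : K) ⊓
      ⨅ y ∈ l, LinearMap.ker ((omegaChi K g e).flip y))
    (m n : Submodule K g)
    (hm : m = l ⊔ ⨆ i : ℤ, ⨆ _ : i ≤ -2,
      Module.End.eigenspace (LieAlgebra.ad K g h) (i : K))
    (hn : n = lperp ⊔ ⨆ i : ℤ, ⨆ _ : i ≤ -2,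
      Module.End.eigenspace (LieAlgebra.ad K g h) (i : K)) :
    (∀ z : g, (∀ x ∈ m, killingForm K g z x = 0) ↔
      z ∈ Submodule.map (LieAlgebra.ad K g e) n ⊔ LinearMap.ker (LieAlgebra.ad K g f)) ∧
    Submodule.map (LieAlgebra.ad K g e) n ⊓ LinearMap.ker (LieAlgebra.ad K g f) = ⊥ := by
  have hhe' : ∀ x, LieAlgebra.ad K g h (LieAlgebra.ad K g e x) =
      LieAlgebra.ad K g e (LieAlgebra.ad K g h x) + (2 : K) • LieAlgebra.ad K g e x := by
    intro x
    simp only [LieAlgebra.ad_apply]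
    rw [leibniz_lie, hhe, smul_lie, add_comm]
  have hhf' : ∀ x, LieAlgebra.ad K g h (LieAlgebra.ad K g f x) =
      LieAlgebra.ad K g f (LieAlgebra.ad K g h x) - (2 : K) • LieAlgebra.ad K g f x := by
    intro x
    simp only [LieAlgebra.ad_apply]
    rw [leibniz_lie, hhf, smul_lie]
    module
  have hef' : ∀ x, LieAlgebra.ad K g e (LieAlgebra.ad K g f x) =
      LieAlgebra.ad K g f (LieAlgebra.ad K g e x) + LieAlgebra.ad K g h x := by
    intro x
    simp only [LieAlgebra.ad_apply]
    rw [leibniz_lie, hef, add_comm]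
  have hom : ∀ x y, omegaChi K g e x y = killingForm K g ⁅e, x⁆ y := fun x y =>
    SlTwoAux.omega_eq e x y
  have hdisj := SlTwoAux.disj _ _ _ hhe' hhf' hef'
  have hsup := SlTwoAux.sup_top _ _ _ hhe' hhf' hef'
  have htop := SlTwoAux.G_top _ _ _ hhe' hhf' hef'
  have hnonpos := SlTwoAux.mem_nonpos _ _ _ hhe' hhf' hef'
  have hmapE := fun (s t : Set ℤ) (hst : ∀ i ∈ s, i + 2 ∈ t) (x : g) =>
    SlTwoAux.map_E (LieAlgebra.ad K g e) _ hhe' hst (x := x)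
  have hκ := fun (s t : Set ℤ) (hst : ∀ i ∈ s, ∀ j ∈ t, i + j ≠ 0) (x y : g) =>
    SlTwoAux.kappa_zero (K := K) h hst (x := x) (y := y)
  rw [SlTwoAux.G_le_eq] at hm hn
  have hmemperp : ∀ x, x ∈ lperp ↔ LieAlgebra.ad K g h x = ((-1 : ℤ) : K) • x ∧
      ∀ y ∈ l, killingForm K g ⁅e, x⁆ y = 0 := by
    intro x
    simp [hlperp, Submodule.mem_iInf, hom]
  have hl' : ∀ x ∈ l, x ∈ SlTwoAux.G (LieAlgebra.ad K g h) {-1} := fun x hx =>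
    SlTwoAux.mem_G (Set.mem_singleton _) (Module.End.mem_eigenspace_iff.1 (hl hx))
  have hkerf : ∀ w, ⁅f, w⁆ = 0 → ∀ y ∈ m, killingForm K g w y = 0 := by
    intro w hw y hy
    have hy' : y ∈ SlTwoAux.G (LieAlgebra.ad K g h) {i | i ≤ -1} := by
      have : m ≤ SlTwoAux.G (LieAlgebra.ad K g h) {i | i ≤ -1} := by
        rw [hm]
        refine sup_le (fun x hx => SlTwoAux.G_mono ?_ (hl' x hx)) (SlTwoAux.G_mono ?_)
        · simp
        · intro i hi
          simp only [Set.mem_ofPred_eq] at hi ⊢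
          omega
      exact this hy
    refine hκ {i | i ≤ 0} {i | i ≤ -1} ?_ w y (hnonpos w ?_) hy'
    · intro i hi j hj
      simp only [Set.mem_ofPred_eq] at hi hj
      omega
    · simp [hw]
  refine ⟨fun z => ⟨fun hz => ?_, fun hz => ?_⟩, ?_⟩
  · have hz' : z ∈ LinearMap.range (LieAlgebra.ad K g e) ⊔ LinearMap.ker (LieAlgebra.ad K g f) := by
      rw [hsup]; trivial
    obtain ⟨_, ⟨x, rfl⟩, w, hw, rfl⟩ := Submodule.mem_sup.1 hz'
    refine Submodule.add_mem_sup ?_ hw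
    have hz1 : ∀ y ∈ m, killingForm K g ⁅e, x⁆ y = 0 := by
      intro y hy
      have h1 := hz y hy
      rw [map_add, LinearMap.add_apply, hkerf w hw y hy, add_zero] at h1
      exact h1
    have hx : x ∈ SlTwoAux.G (LieAlgebra.ad K g h) {i | i ≤ -2} ⊔
        (SlTwoAux.G (LieAlgebra.ad K g h) {-1} ⊔ SlTwoAux.G (LieAlgebra.ad K g h) {i | 0 ≤ i}) := by
      have h1 : x ∈ SlTwoAux.G (LieAlgebra.ad K g h) Set.univ := by rw [htop]; trivial
      have h2 := SlTwoAux.G_union (LieAlgebra.ad K g h) (s := Set.univ) (t := {i | i ≤ -2})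
        (u := {i | -1 ≤ i}) (by
          intro i _
          simp only [Set.mem_union, Set.mem_ofPred_eq]
          omega)
      have h3 := SlTwoAux.G_union (LieAlgebra.ad K g h) (s := {i | -1 ≤ i}) (t := {-1})
        (u := {i | 0 ≤ i}) (by
          intro i hi
          simp only [Set.mem_union, Set.mem_ofPred_eq, Set.mem_singleton_iff] at hi ⊢
          omega)
      exact (h2.trans (sup_le_sup_left h3 _)) h1
    obtain ⟨a, ha, _, hbp, rfl⟩ := Submodule.mem_sup.1 hx
    obtain ⟨b, hb, p, hp, rfl⟩ := Submodule.mem_sup.1 hbp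
    have hea := hmapE {i | i ≤ -2} {i | i ≤ 0} (by
      intro i hi; simp only [Set.mem_ofPred_eq] at hi ⊢; omega) a ha
    have heb := hmapE {-1} {1} (by simp) b hb
    have hep := hmapE {i | 0 ≤ i} {i | 2 ≤ i} (by simp) p hp
    rw [LieAlgebra.ad_apply] at hea heb hep
    have hp0 : ⁅e, p⁆ = 0 := by
      have hnd := LieAlgebra.IsKilling.ker_killingForm_eq_bot K g
      rw [← Submodule.mem_bot K, ← hnd, LinearMap.mem_ker]
      ext y
      rw [LinearMap.zero_apply]
      have hy : y ∈ SlTwoAux.G (LieAlgebra.ad K g h) {i | i ≤ -2} ⊔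
          SlTwoAux.G (LieAlgebra.ad K g h) {i | -1 ≤ i} := by
        refine SlTwoAux.G_union (LieAlgebra.ad K g h) (s := Set.univ) ?_ (by rw [htop]; trivial)
        intro i _
        simp only [Set.mem_union, Set.mem_ofPred_eq]
        omega
      obtain ⟨c, hc, d, hd, rfl⟩ := Submodule.mem_sup.1 hy
      have h1 := hκ {i | 2 ≤ i} {i | -1 ≤ i} (by
        intro i hi j hj; simp only [Set.mem_ofPred_eq] at hi hj; omega) _ _ hep hd
      have h2 := hκ {i | i ≤ 0} {i | i ≤ -2} (by
        intro i hi j hj; simp only [Set.mem_ofPred_eq] at hi hj; omega) _ _ hea hc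
      have h3 := hκ {1} {i | i ≤ -2} (by
        intro i hi j hj
        simp only [Set.mem_ofPred_eq, Set.mem_singleton_iff] at hi hj; omega) _ _ heb hc
      have h4 := hz1 c (by rw [hm]; exact Submodule.mem_sup_right hc)
      simp only [lie_add, map_add, LinearMap.add_apply, h2, h3, zero_add] at h4
      rw [map_add, h4, h1, zero_add]
    refine ⟨b + a, ?_, ?_⟩
    · rw [SetLike.mem_coe, hn]
      refine Submodule.add_mem_sup ((hmemperp b).2 ⟨?_, fun y hy => ?_⟩) ha
      · have : SlTwoAux.G (LieAlgebra.ad K g h) {-1} ≤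
            Module.End.eigenspace (LieAlgebra.ad K g h) ((-1 : ℤ) : K) := by
          refine SlTwoAux.G_le fun i hi x hx => ?_
          rw [Set.mem_singleton_iff] at hi
          subst hi
          exact Module.End.mem_eigenspace_iff.2 hx
        exact Module.End.mem_eigenspace_iff.1 (this hb)
      · have h4 := hz1 y (by rw [hm]; exact Submodule.mem_sup_left hy)
        have h2 := hκ {i | i ≤ 0} {-1} (by
          intro i hi j hj
          simp only [Set.mem_ofPred_eq, Set.mem_singleton_iff] at hi hj; omega) _ _ hea (hl' y hy)
        simpa only [lie_add, map_add, LinearMap.add_apply, h2, hp0, zero_add, add_zero, map_zero,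
          LinearMap.zero_apply] using h4
    · simp only [LieAlgebra.ad_apply, lie_add, hp0, add_zero]
      abel
  · obtain ⟨_, ⟨x, hx, rfl⟩, w, hw, rfl⟩ := Submodule.mem_sup.1 hz
    intro y hy
    rw [map_add, LinearMap.add_apply, hkerf w hw y hy, add_zero]
    rw [SetLike.mem_coe, hn] at hx
    rw [hm] at hy
    obtain ⟨b, hb, a, ha, rfl⟩ := Submodule.mem_sup.1 hx
    obtain ⟨c, hc, d, hd, rfl⟩ := Submodule.mem_sup.1 hy
    obtain ⟨hb1, hb2⟩ := (hmemperp b).1 hb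
    have hea := hmapE {i | i ≤ -2} {i | i ≤ 0} (by
      intro i hi; simp only [Set.mem_ofPred_eq] at hi ⊢; omega) a ha
    have heb := hmapE {-1} {1} (by simp) b (SlTwoAux.mem_G (Set.mem_singleton _) hb1)
    rw [LieAlgebra.ad_apply] at hea heb
    have h1 := hκ {i | i ≤ 0} {i | i ≤ -2} (by
      intro i hi j hj; simp only [Set.mem_ofPred_eq] at hi hj; omega) _ _ hea hd
    have h2 := hκ {1} {i | i ≤ -2} (by
      intro i hi j hj
      simp only [Set.mem_ofPred_eq, Set.mem_singleton_iff] at hi hj; omega) _ _ heb hd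
    have h3 := hκ {i | i ≤ 0} {-1} (by
      intro i hi j hj
      simp only [Set.mem_ofPred_eq, Set.mem_singleton_iff] at hi hj; omega) _ _ hea (hl' c hc)
    simp only [LieAlgebra.ad_apply, lie_add, map_add, LinearMap.add_apply, h1, h2, h3, hb2 c hc,
      add_zero]
  · rw [← disjoint_iff]
    refine hdisj.mono_left ?_
    rintro _ ⟨x, _, rfl⟩
    exact ⟨x, rfl⟩
end

section
/- The composition of the inclusion Z(U) ⊆ U of the center of U with the quotient map U → U/U·m_χ is injective; i.e. Z(U) ∩ U·m_χ = 0. -/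
namespace CIT
open UniversalEnvelopingAlgebra
attribute [local instance 100] LieRing.ofAssociativeRing

section basic
variable {K : Type*} [Field K] {g : Type*} [LieRing g] [LieAlgebra K g]

theorem iota_lie (x y : g) : ι K ⁅x, y⁆ = ι K x * ι K y - ι K y * ι K x := by
  rw [LieHom.map_lie, LieRing.of_associative_ring_bracket]

variable (K g) in
/-- The standard filtration, shifted: `Fil (n+1)` is spanned by products of at most `n` elements. -/
def Fil : ℕ → Submodule K (UniversalEnvelopingAlgebra K g)
  | 0 => ⊥
  | n + 1 => Submodule.span K ({1} ∪ {v | ∃ u ∈ Fil n, ∃ y : g, v = u * ι K y})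

theorem one_mem (n : ℕ) : (1 : UniversalEnvelopingAlgebra K g) ∈ Fil K g (n + 1) :=
  Submodule.subset_span (Or.inl rfl)

theorem mul_iota_mem {n : ℕ} {u : UniversalEnvelopingAlgebra K g} (hu : u ∈ Fil K g n) (y : g) :
    u * ι K y ∈ Fil K g (n + 1) :=
  Submodule.subset_span (Or.inr ⟨u, hu, y, rfl⟩)

theorem Fil_le {n : ℕ} (W : Submodule K (UniversalEnvelopingAlgebra K g)) (h1 : 1 ∈ W)
    (h2 : ∀ u ∈ Fil K g n, ∀ y : g, u * ι K y ∈ W) : Fil K g (n + 1) ≤ W := by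
  rw [Fil, Submodule.span_le]
  rintro v (rfl | ⟨u, hu, y, rfl⟩)
  · exact h1
  · exact h2 u hu y

theorem Fil_succ (n : ℕ) : Fil K g n ≤ Fil K g (n + 1) := by
  induction n with
  | zero => simp [Fil]
  | succ n ih => exact Fil_le _ (one_mem _) fun u hu y => mul_iota_mem (ih hu) y

theorem Fil_mono {n m : ℕ} (h : n ≤ m) : Fil K g n ≤ Fil K g m :=
  monotone_nat_of_le_succ (f := Fil K g) Fil_succ h

theorem iota_mul_mem {n : ℕ} {u : UniversalEnvelopingAlgebra K g} (hu : u ∈ Fil K g n) (y : g) :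
    ι K y * u ∈ Fil K g (n + 1) := by
  induction n generalizing u with
  | zero => simp [Fil] at hu; simp [hu]
  | succ n ih =>
    have : Fil K g (n + 1) ≤ (Fil K g (n + 2)).comap (LinearMap.mulLeft K (ι K y)) := by
      apply Fil_le
      · simpa using mul_iota_mem (one_mem n) y
      · intro u hu z
        simpa [mul_assoc] using mul_iota_mem (ih hu) z
    exact this hu

theorem comm_mem {n : ℕ} {u : UniversalEnvelopingAlgebra K g} (hu : u ∈ Fil K g n) (y : g) :
    ι K y * u - u * ι K y ∈ Fil K g n := by
  induction n generalizing u with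
  | zero => simp [Fil] at hu; simp [hu]
  | succ n ih =>
    have : Fil K g (n + 1) ≤ (Fil K g (n + 1)).comap
        (LinearMap.mulLeft K (ι K y) - LinearMap.mulRight K (ι K y)) := by
      apply Fil_le
      · simp
      · intro u hu z
        have h1 := mul_iota_mem (ih hu) z
        have h2 := mul_iota_mem hu ⁅y, z⁆
        have := add_mem h1 h2
        rw [iota_lie] at this
        simp only [Submodule.mem_comap, LinearMap.sub_apply, LinearMap.mulLeft_apply,
          LinearMap.mulRight_apply]
        convert this using 1
        noncomm_ring
    exact this hu

theorem mul_mem {n m : ℕ} {u v : UniversalEnvelopingAlgebra K g} (hu : u ∈ Fil K g n)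
    (hv : v ∈ Fil K g m) : u * v ∈ Fil K g (n + m) := by
  induction m generalizing v with
  | zero => simp [Fil] at hv; simp [hv]
  | succ m ih =>
    have : Fil K g (m + 1) ≤ (Fil K g (n + (m + 1))).comap (LinearMap.mulLeft K u) := by
      apply Fil_le
      · simpa using Fil_mono (by omega) hu
      · intro v hv z
        have := mul_iota_mem (ih hv) z
        rw [mul_assoc] at this
        exact this
    exact this hv

theorem exists_mem (u : UniversalEnvelopingAlgebra K g) : ∃ n, u ∈ Fil K g n := by
  obtain ⟨t, rfl⟩ : ∃ t, mkAlgHom K g t = u := RingCon.mkₐ_surjective _ u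
  induction t using TensorAlgebra.induction with
  | algebraMap r =>
    refine ⟨1, ?_⟩
    rw [AlgHom.commutes, Algebra.algebraMap_eq_smul_one]
    exact Submodule.smul_mem _ _ (one_mem 0)
  | ι x =>
    refine ⟨2, ?_⟩
    have := mul_iota_mem (one_mem (K := K) 0) x
    simpa using this
  | mul a b ha hb =>
    obtain ⟨n, hn⟩ := ha
    obtain ⟨m, hm⟩ := hb
    exact ⟨n + m, by rw [map_mul]; exact mul_mem hn hm⟩
  | add a b ha hb =>
    obtain ⟨n, hn⟩ := ha
    obtain ⟨m, hm⟩ := hb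
    exact ⟨n + m, by
      rw [map_add]; exact add_mem (Fil_mono (by omega) hn) (Fil_mono (by omega) hm)⟩

/-! convolution -/

open TensorProduct

variable (K g) in
/-- the coproduct on generators -/
noncomputable def copL : g →ₗ⁅K⁆
    (UniversalEnvelopingAlgebra K g ⊗[K] UniversalEnvelopingAlgebra K g) where
  toFun x := ι K x ⊗ₜ 1 + 1 ⊗ₜ ι K x
  map_add' x y := by simp [TensorProduct.add_tmul, TensorProduct.tmul_add]; abel
  map_smul' r x := by simp [TensorProduct.smul_tmul']
  map_lie' {x y} := by
    simp only [iota_lie, LieRing.of_associative_ring_bracket, mul_add, add_mul,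
      Algebra.TensorProduct.tmul_mul_tmul, one_mul, mul_one, TensorProduct.sub_tmul,
      TensorProduct.tmul_sub]
    abel

/-- convolution of functionals -/
noncomputable def conv (φ ψ : UniversalEnvelopingAlgebra K g →ₗ[K] K) :
    UniversalEnvelopingAlgebra K g →ₗ[K] K :=
  LinearMap.mul' K K ∘ₗ TensorProduct.map φ ψ ∘ₗ (lift K (copL K g)).toLinearMap

/-- right translate of functionals -/
noncomputable def rt (x : g) (φ : UniversalEnvelopingAlgebra K g →ₗ[K] K) :
    UniversalEnvelopingAlgebra K g →ₗ[K] K := φ ∘ₗ LinearMap.mulRight K (ι K x)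

@[simp] theorem rt_apply (x : g) (φ : UniversalEnvelopingAlgebra K g →ₗ[K] K) (u) :
    rt x φ u = φ (u * ι K x) := rfl

theorem conv_one (φ ψ : UniversalEnvelopingAlgebra K g →ₗ[K] K) :
    conv φ ψ 1 = φ 1 * ψ 1 := by
  simp [conv, Algebra.TensorProduct.one_def]

theorem conv_mul (φ ψ : UniversalEnvelopingAlgebra K g →ₗ[K] K) (u) (x : g) :
    conv φ ψ (u * ι K x) = conv (rt x φ) ψ u + conv φ (rt x ψ) u := by
  have key : ∀ t : UniversalEnvelopingAlgebra K g ⊗[K] UniversalEnvelopingAlgebra K g,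
      TensorProduct.map φ ψ (t * (ι K x ⊗ₜ 1 + 1 ⊗ₜ ι K x)) =
      TensorProduct.map (rt x φ) ψ t + TensorProduct.map φ (rt x ψ) t := by
    intro t
    induction t with
    | zero => simp
    | tmul a b => simp only [mul_add, Algebra.TensorProduct.tmul_mul_tmul, mul_one, map_add,
        TensorProduct.map_tmul, rt_apply]
    | add a b ha hb => rw [add_mul, map_add, ha, hb, map_add, map_add]; abel
  have h : lift K (copL K g) (ι K x) = ι K x ⊗ₜ 1 + 1 ⊗ₜ ι K x := lift_ι_apply K _ x
  simp only [conv, LinearMap.comp_apply, AlgHom.toLinearMap_apply, map_mul, h, key, map_add]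

theorem conv_add_left (φ φ' ψ : UniversalEnvelopingAlgebra K g →ₗ[K] K) :
    conv (φ + φ') ψ = conv φ ψ + conv φ' ψ := by
  ext u; simp [conv, TensorProduct.map_add_left]

theorem conv_add_right (φ ψ ψ' : UniversalEnvelopingAlgebra K g →ₗ[K] K) :
    conv φ (ψ + ψ') = conv φ ψ + conv φ ψ' := by
  ext u; simp [conv, TensorProduct.map_add_right]

theorem conv_smul_left (r : K) (φ ψ : UniversalEnvelopingAlgebra K g →ₗ[K] K) :
    conv (r • φ) ψ = r • conv φ ψ := by
  ext u; simp [conv, TensorProduct.map_smul_left]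

theorem conv_smul_right (r : K) (φ ψ : UniversalEnvelopingAlgebra K g →ₗ[K] K) :
    conv φ (r • ψ) = r • conv φ ψ := by
  ext u; simp [conv, TensorProduct.map_smul_right]

/-- vanishing to order `n` -/
def Van (n : ℕ) (φ : UniversalEnvelopingAlgebra K g →ₗ[K] K) : Prop := ∀ u ∈ Fil K g n, φ u = 0

theorem Van.rt {n : ℕ} {φ : UniversalEnvelopingAlgebra K g →ₗ[K] K} (h : Van (n + 1) φ) (x : g) :
    Van n (rt x φ) := fun _ hu => h _ (mul_iota_mem hu x)

theorem van_conv {N a b : ℕ} (hN : N ≤ a + b) {φ ψ : UniversalEnvelopingAlgebra K g →ₗ[K] K}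
    (h1 : Van a φ) (h2 : Van b ψ) : Van N (conv φ ψ) := by
  induction N generalizing a b φ ψ with
  | zero => intro u hu; simp [Fil] at hu; simp [hu]
  | succ N ih =>
    have : Fil K g (N + 1) ≤ LinearMap.ker (conv φ ψ) := by
      apply Fil_le
      · rw [LinearMap.mem_ker, conv_one]
        rcases a with _ | a
        · rcases b with _ | b
          · omega
          · rw [h2 1 (one_mem _), mul_zero]
        · rw [h1 1 (one_mem _), zero_mul]
      · intro u hu y
        rw [LinearMap.mem_ker, conv_mul]
        have A : conv (rt y φ) ψ u = 0 := by
          rcases a with _ | a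
          · exact ih (a := 0) (b := b) (by omega) (fun u hu => by
              simp [Fil] at hu; simp [hu]) h2 u hu |> fun h => h
          · exact ih (by omega) (h1.rt y) h2 u hu
        have B : conv φ (rt y ψ) u = 0 := by
          rcases b with _ | b
          · exact ih (a := a) (b := 0) (by omega) h1 (fun u hu => by
              simp [Fil] at hu; simp [hu]) u hu
          · exact ih (by omega) h1 (h2.rt y) u hu
        rw [A, B, add_zero]
    exact fun u hu => this hu

variable (K g) in
/-- the counit -/
noncomputable def eps : UniversalEnvelopingAlgebra K g →ₗ[K] K :=
  (lift K (0 : g →ₗ⁅K⁆ K)).toLinearMap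

theorem eps_one : eps K g 1 = 1 := by simp [eps]

theorem eps_mul (u) (x : g) : eps K g (u * ι K x) = 0 := by
  have : lift K (0 : g →ₗ⁅K⁆ K) (ι K x) = 0 := lift_ι_apply K _ x
  rw [eps, AlgHom.toLinearMap_apply, map_mul, this, mul_zero]

theorem conv_eps (ψ : UniversalEnvelopingAlgebra K g →ₗ[K] K) : conv (eps K g) ψ = ψ := by
  have : ∀ n, ∀ ψ : UniversalEnvelopingAlgebra K g →ₗ[K] K,
      Fil K g n ≤ LinearMap.ker (conv (eps K g) ψ - ψ) := by
    intro n
    induction n with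
    | zero => intro ψ; simp [Fil]
    | succ n ih =>
      intro ψ
      apply Fil_le
      · simp [conv_one, eps_one]
      · intro u hu y
        have h := ih (rt y ψ) hu
        have h0 : rt y (eps K g) = (0 : K) • eps K g := by ext u; simp [-ι_apply, eps_mul]
        rw [LinearMap.mem_ker, LinearMap.sub_apply, rt_apply] at h
        rw [LinearMap.mem_ker, LinearMap.sub_apply, conv_mul, h0, conv_smul_left]
        simpa using h
  ext u
  obtain ⟨n, hn⟩ := exists_mem u
  have := this n ψ hn
  rwa [LinearMap.mem_ker, LinearMap.sub_apply, sub_eq_zero] at this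

/-- convolution powers -/
noncomputable def cpow (φ : UniversalEnvelopingAlgebra K g →ₗ[K] K) :
    ℕ → (UniversalEnvelopingAlgebra K g →ₗ[K] K)
  | 0 => eps K g
  | n + 1 => conv φ (cpow φ n)

theorem van_one {φ : UniversalEnvelopingAlgebra K g →ₗ[K] K} (h : φ 1 = 0) : Van 1 φ := by
  have : Fil K g 1 ≤ LinearMap.ker φ := by
    apply Fil_le
    · exact h
    · intro u hu; simp [Fil] at hu; simp [hu]
  exact fun u hu => this hu

theorem van_cpow {φ : UniversalEnvelopingAlgebra K g →ₗ[K] K} (h : φ 1 = 0) (n : ℕ) :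
    Van n (cpow φ n) := by
  induction n with
  | zero => intro u hu; simp [Fil] at hu; simp [hu]
  | succ n ih => exact van_conv (by omega) (van_one h) ih

theorem cpow_mul {φ : UniversalEnvelopingAlgebra K g →ₗ[K] K} (h : φ 1 = 0) (n : ℕ) (x : g) :
    Van (n + 1) (rt x (cpow φ (n + 1)) - (((n : K) + 1) * φ (ι K x)) • cpow φ n) := by
  induction n with
  | zero =>
    apply van_one
    rw [LinearMap.sub_apply, rt_apply, LinearMap.smul_apply, cpow, cpow, conv_mul, conv_one,
      conv_one, eps_one, h, rt_apply, one_mul]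
    simp [-ι_apply, cpow, eps_one]
  | succ n ih =>
    set R := rt x (cpow φ (n + 1)) - (((n : K) + 1) * φ (ι K x)) • cpow φ n with hR
    have h1 : Van (n + 2) (conv φ R) := van_conv (by omega) (van_one h) ih
    have h2 : Van 1 (rt x φ + (- φ (ι K x)) • eps K g) := van_one (by simp [eps_one])
    have h3 : Van (n + 2) (conv (rt x φ + (- φ (ι K x)) • eps K g) (cpow φ (n + 1))) :=
      van_conv (by omega) h2 (van_cpow h (n + 1))
    intro u hu
    have e1 := h1 u hu
    have e2 := h3 u hu
    have e0 := conv_add_right φ R ((((n : K) + 1) * φ (ι K x)) • cpow φ n)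
    rw [hR, sub_add_cancel, ← hR, conv_smul_right] at e0
    rw [conv_add_left, conv_smul_left, conv_eps] at e2
    have e3 : rt x (cpow φ (n + 1 + 1)) u =
        conv (rt x φ) (cpow φ (n + 1)) u + conv φ (rt x (cpow φ (n + 1))) u := by
      rw [rt_apply, cpow, conv_mul]
    have e4 : cpow φ (n + 1) = conv φ (cpow φ n) := rfl
    rw [LinearMap.sub_apply, e3, e0]
    simp only [LinearMap.add_apply, LinearMap.smul_apply, smul_eq_mul] at e1 e2 ⊢
    rw [← e4]
    push_cast
    linear_combination e1 + e2

theorem cpow_list {φ : UniversalEnvelopingAlgebra K g →ₗ[K] K} (h : φ 1 = 0) (l : List g) :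
    (l.map (ι K)).prod ∈ Fil K g (l.length + 1) ∧
    cpow φ l.length (l.map (ι K)).prod = (l.length.factorial : K) * (l.map (fun x => φ (ι K x))).prod := by
  induction l using List.reverseRecOn with
  | nil => exact ⟨by simpa using one_mem 0, by simp [cpow, eps_one]⟩
  | append_singleton l x ih =>
    have hl : (l ++ [x]).length = l.length + 1 := by simp
    rw [hl]
    simp only [List.map_append, List.prod_append, List.map_cons, List.map_nil, List.prod_cons,
      List.prod_nil, mul_one]
    refine ⟨mul_iota_mem ih.1 x, ?_⟩
    have := cpow_mul h l.length x _ ih.1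
    rw [LinearMap.sub_apply, rt_apply, LinearMap.smul_apply, ih.2, sub_eq_zero] at this
    rw [this, Nat.factorial_succ]
    push_cast
    simp only [smul_eq_mul]
    ring

end basic

section pbw
open MvPolynomial
variable {K : Type*} [Field K] {g : Type*} [LieRing g] [LieAlgebra K g]
variable {ι' : Type*} (b : Module.Basis ι' K g)

theorem hom_induct (P : ℕ → MvPolynomial ι' K → Prop) (h1 : P 0 1) (h0 : ∀ n, P n 0)
    (hadd : ∀ n p q, P n p → P n q → P n (p + q)) (hsmul : ∀ n (r : K) p, P n p → P n (r • p))
    (hX : ∀ n p i, p.IsHomogeneous n → P n p → P (n + 1) (p * X i)) :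
    ∀ n p, p.IsHomogeneous n → P n p := by
  have hmon : ∀ n (s : ι' →₀ ℕ), s.degree = n → P n (monomial s 1) := by
    intro n
    induction n with
    | zero =>
      intro s hs
      obtain rfl : s = 0 := (Finsupp.degree_eq_zero_iff s).mp hs
      exact h1
    | succ n ih =>
      intro s hs
      have hne : s ≠ 0 := by rintro rfl; simp at hs
      obtain ⟨i, hi⟩ := Finsupp.ne_iff.mp hne
      have hi' : Finsupp.single i 1 ≤ s := by
        rw [Finsupp.single_le_iff]; exact Nat.one_le_iff_ne_zero.mpr hi
      have hs' : s - Finsupp.single i 1 + Finsupp.single i 1 = s := tsub_add_cancel_of_le hi'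
      have hd : (s - Finsupp.single i 1).degree = n := by
        have := congrArg Finsupp.degree hs'
        rw [map_add, Finsupp.degree_single, hs] at this
        omega
      have := hX n _ i (isHomogeneous_monomial (1 : K) hd) (ih _ hd)
      rwa [X, monomial_mul, hs', mul_one] at this
  intro n p hp
  rw [p.as_sum]
  have : ∀ t : Finset (ι' →₀ ℕ), t ⊆ p.support → P n (∑ v ∈ t, monomial v (coeff v p)) := by
    classical
    intro t
    induction t using Finset.induction_on with
    | empty => intro _; simpa using h0 n
    | insert a t ha ih =>
      intro ht
      rw [Finset.sum_insert ha]
      refine hadd _ _ _ ?_ (ih (fun x hx => ht (Finset.mem_insert_of_mem hx)))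
      have hd := hp.degree_eq_sum_deg_support (ht (Finset.mem_insert_self a t))
      have := hsmul n (coeff a p) _ (hmon n a hd.symm)
      rwa [smul_monomial, smul_eq_mul, mul_one] at this
  exact this _ subset_rfl

/-- a choice of ordered monomials, extended linearly -/
noncomputable def ord : MvPolynomial ι' K →ₗ[K] UniversalEnvelopingAlgebra K g :=
  (basisMonomials ι' K).constr K
    (fun s => (((Finsupp.toMultiset s).toList.map b).map (ι K)).prod)

theorem ord_monomial (s : ι' →₀ ℕ) :
    ord b (monomial s 1) = (((Finsupp.toMultiset s).toList.map b).map (ι K)).prod := by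
  have := (basisMonomials ι' K).constr_basis K
    (fun s => (((Finsupp.toMultiset s).toList.map b).map (ι K)).prod) s
  rwa [coe_basisMonomials] at this

theorem list_mem (l : List g) : (l.map (ι K)).prod ∈ Fil K g (l.length + 1) :=
  (cpow_list (φ := 0) (by simp) l).1

theorem perm_mem {l l' : List g} (h : l.Perm l') :
    (l.map (ι K)).prod - (l'.map (ι K)).prod ∈ Fil K g l.length := by
  induction h with
  | nil => simp
  | cons x h ih =>
    simp only [List.map_cons, List.prod_cons, List.length_cons, ← mul_sub]
    exact iota_mul_mem ih x
  | swap x y l =>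
    have := iota_mul_mem (list_mem (K := K) l) ⁅y, x⁆
    rw [iota_lie] at this
    simp only [List.map_cons, List.prod_cons, List.length_cons]
    convert this using 1
    noncomm_ring
  | trans h1 h2 ih1 ih2 =>
    rw [← h1.length_eq] at ih2
    have := add_mem ih1 ih2
    rwa [sub_add_sub_cancel] at this

theorem length_toList (s : ι' →₀ ℕ) :
    ((Finsupp.toMultiset s).toList.map b).length = s.degree := by
  rw [List.length_map, Multiset.length_toList, Finsupp.card_toMultiset]
  rfl

theorem isHom_induct_mon (n : ℕ) (P : MvPolynomial ι' K → Prop) (h0 : P 0)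
    (hadd : ∀ p q, P p → P q → P (p + q)) (hsmul : ∀ (r : K) p, P p → P (r • p))
    (hmon : ∀ s : ι' →₀ ℕ, s.degree = n → P (monomial s 1)) :
    ∀ p, p.IsHomogeneous n → P p := by
  intro p hp
  rw [p.as_sum]
  have : ∀ t : Finset (ι' →₀ ℕ), t ⊆ p.support → P (∑ v ∈ t, monomial v (coeff v p)) := by
    classical
    intro t
    induction t using Finset.induction_on with
    | empty => intro _; simpa using h0
    | insert a t ha ih =>
      intro ht
      rw [Finset.sum_insert ha]
      refine hadd _ _ ?_ (ih (fun x hx => ht (Finset.mem_insert_of_mem hx)))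
      have hd := hp.degree_eq_sum_deg_support (ht (Finset.mem_insert_self a t))
      have := hsmul (coeff a p) _ (hmon a hd.symm)
      rwa [smul_monomial, smul_eq_mul, mul_one] at this
  exact this _ subset_rfl

theorem ord_mem {n : ℕ} {p : MvPolynomial ι' K} (hp : p.IsHomogeneous n) :
    ord b p ∈ Fil K g (n + 1) := by
  refine isHom_induct_mon n (fun p => ord b p ∈ Fil K g (n + 1)) (by simp) ?_ ?_ ?_ p hp
  · intro p q hp hq; rw [map_add]; exact add_mem hp hq
  · intro r p hp; rw [map_smul]; exact Submodule.smul_mem _ _ hp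
  · intro s hs
    have := list_mem (K := K) ((Finsupp.toMultiset s).toList.map b)
    rwa [length_toList, hs, ← ord_monomial] at this

theorem ord_mul_X {n : ℕ} {p : MvPolynomial ι' K} (hp : p.IsHomogeneous n) (i : ι') :
    ord b (p * X i) - ord b p * ι K (b i) ∈ Fil K g (n + 1) := by
  refine isHom_induct_mon n (fun p => ord b (p * X i) - ord b p * ι K (b i) ∈ Fil K g (n + 1))
    (by simp) ?_ ?_ ?_ p hp
  · intro p q hp hq
    have := add_mem hp hq
    rw [add_mul, map_add, map_add, add_mul]; convert this using 1; abel
  · intro r p hp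
    have := Submodule.smul_mem _ r hp
    rw [smul_mul_assoc, map_smul, map_smul, smul_mul_assoc, ← smul_sub]; exact this
  · intro s hs
    have hperm : ((Finsupp.toMultiset (s + Finsupp.single i 1)).toList.map b).Perm
        ((Finsupp.toMultiset s).toList.map b ++ [b i]) := by
      rw [show [b i] = [i].map b from rfl, ← List.map_append]
      apply List.Perm.map
      rw [← Multiset.coe_eq_coe, ← Multiset.coe_add]
      simp
    have := perm_mem (K := K) hperm
    rw [length_toList, map_add, Finsupp.degree_single, hs, List.map_append, List.prod_append,
      ← ord_monomial, ← ord_monomial] at this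
    rw [X, monomial_mul, mul_one]
    simpa [-ι_apply] using this


/-- linear polynomial attached to an element -/
noncomputable def Lin : g →ₗ[K] MvPolynomial ι' K :=
  b.constr K (fun i => (X i : MvPolynomial ι' K))

theorem Lin_basis (i : ι') : Lin b (b i) = X i := b.constr_basis K _ i

theorem Lin_hom (y : g) : (Lin b y).IsHomogeneous 1 := by
  have : (⊤ : Submodule K g) ≤ (homogeneousSubmodule ι' K 1).comap (Lin b) := by
    rw [← b.span_eq, Submodule.span_le]
    rintro _ ⟨i, rfl⟩
    simp only [Submodule.comap_coe, Set.mem_preimage, SetLike.mem_coe, Lin_basis]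
    exact isHomogeneous_X _ _
  exact this (Submodule.mem_top (x := y))

theorem ord_mul_Lin {n : ℕ} {p : MvPolynomial ι' K} (hp : p.IsHomogeneous n) (y : g) :
    ord b (p * Lin b y) - ord b p * ι K y ∈ Fil K g (n + 1) := by
  have : (⊤ : Submodule K g) ≤ (Fil K g (n + 1)).comap
      ((ord b ∘ₗ LinearMap.mulLeft K p ∘ₗ Lin b) -
        (LinearMap.mulLeft K (ord b p) ∘ₗ (ι K : g →ₗ⁅K⁆ _).toLinearMap)) := by
    rw [← b.span_eq, Submodule.span_le]
    rintro _ ⟨i, rfl⟩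
    have := ord_mul_X b hp i
    rw [← Lin_basis b i] at this
    exact this
  exact this (Submodule.mem_top (x := y))

theorem ord_one : ord b (1 : MvPolynomial ι' K) = 1 := by
  have := ord_monomial b (0 : ι' →₀ ℕ)
  simpa using this

theorem exists_symbol {n : ℕ} {u : UniversalEnvelopingAlgebra K g} (hu : u ∈ Fil K g (n + 1)) :
    ∃ p : MvPolynomial ι' K, p.IsHomogeneous n ∧ u - ord b p ∈ Fil K g n := by
  let W : ∀ n : ℕ, Submodule K (UniversalEnvelopingAlgebra K g) := fun n =>
    Submodule.map (ord b) (homogeneousSubmodule ι' K n) ⊔ Fil K g n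
  have key : ∀ n, Fil K g (n + 1) ≤ W n := by
    intro n
    induction n with
    | zero =>
      apply Fil_le
      · exact Submodule.mem_sup_left ⟨1, isHomogeneous_one _ _, ord_one b⟩
      · intro u hu; simp [Fil] at hu; simp [hu]
    | succ n ih =>
      apply Fil_le
      · exact Submodule.mem_sup_right (one_mem n)
      · intro u hu y
        obtain ⟨_, ⟨p, hp, rfl⟩, v, hv, rfl⟩ := Submodule.mem_sup.mp (ih hu)
        have h1 := ord_mul_Lin b hp y
        have h2 := mul_iota_mem hv y
        have h3 := sub_mem h2 h1
        refine Submodule.mem_sup.mpr ⟨_, ⟨p * Lin b y, IsHomogeneous.mul hp (Lin_hom b y), rfl⟩, _,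
          h3, ?_⟩
        noncomm_ring
  obtain ⟨_, ⟨p, hp, rfl⟩, v, hv, rfl⟩ := Submodule.mem_sup.mp (key n hu)
  exact ⟨p, hp, by simpa using hv⟩

theorem prod_map_toMultiset (f : ι' → K) (s : ι' →₀ ℕ) :
    ((Finsupp.toMultiset s).map f).prod = s.prod fun i k => f i ^ k := by
  classical
  induction s using Finsupp.induction_linear with
  | zero => simp
  | add s t hs ht =>
    rw [map_add, Multiset.map_add, Multiset.prod_add, hs, ht,
      Finsupp.prod_add_index' (by simp) (by intros; rw [pow_add])]
  | single i n => simp [Finsupp.toMultiset_single, Multiset.map_nsmul, Multiset.prod_nsmul]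

theorem cpow_ord {φ : UniversalEnvelopingAlgebra K g →ₗ[K] K} (h : φ 1 = 0)
    {n : ℕ} {p : MvPolynomial ι' K} (hp : p.IsHomogeneous n) :
    cpow φ n (ord b p) = (n.factorial : K) * eval (fun i => φ (ι K (b i))) p := by
  refine isHom_induct_mon n (fun p => cpow φ n (ord b p) =
    (n.factorial : K) * eval (fun i => φ (ι K (b i))) p) (by simp) ?_ ?_ ?_ p hp
  · intro p q hp hq; rw [map_add, map_add, map_add, hp, hq, mul_add]
  · intro r p hp; rw [map_smul, map_smul, hp, smul_eval, smul_eq_mul]; ring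
  · intro s hs
    have := (cpow_list h ((Finsupp.toMultiset s).toList.map b)).2
    rw [length_toList, hs, ← ord_monomial] at this
    rw [this, eval_monomial, one_mul, List.map_map]
    congr 1
    rw [← Multiset.prod_coe, ← Multiset.map_coe, Multiset.coe_toList]
    exact prod_map_toMultiset _ s

theorem ord_inj [CharZero K] (hι : Function.Injective (ι K : g → UniversalEnvelopingAlgebra K g))
    {n : ℕ} {p : MvPolynomial ι' K} (hp : p.IsHomogeneous n) (h : ord b p ∈ Fil K g n) : p = 0 := by
  apply MvPolynomial.funext
  intro a
  let ιL : g →ₗ[K] UniversalEnvelopingAlgebra K g := (ι K : g →ₗ⁅K⁆ _).toLinearMap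
  obtain ⟨r, hr⟩ := LinearMap.exists_leftInverse_of_injective ιL (LinearMap.ker_eq_bot.mpr hι)
  let φ0 : UniversalEnvelopingAlgebra K g →ₗ[K] K := (b.constr K a) ∘ₗ r
  let φ := φ0 - (φ0 1) • eps K g
  have h1 : φ 1 = 0 := by simp [φ, eps_one]
  have h2 : ∀ i, φ (ι K (b i)) = a i := by
    intro i
    have e1 : eps K g (ι K (b i)) = 0 := by simpa [-ι_apply] using eps_mul (K := K) 1 (b i)
    have e2 : r (ι K (b i)) = b i := LinearMap.congr_fun hr (b i)
    simp only [φ, φ0, LinearMap.sub_apply, LinearMap.smul_apply, e1, LinearMap.comp_apply, e2,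
      Module.Basis.constr_basis]
    simp
  have := cpow_ord b h1 hp
  rw [van_cpow h1 n _ h] at this
  simp only [h2] at this
  have hn : (n.factorial : K) ≠ 0 := Nat.cast_ne_zero.mpr n.factorial_ne_zero
  simpa [hn] using this.symm

/-- the derivation of the symmetric algebra extending the adjoint action -/
noncomputable def D (y : g) : Derivation K (MvPolynomial ι' K) (MvPolynomial ι' K) :=
  mkDerivation K (fun i => Lin b ⁅y, b i⁆)

theorem D_X (y : g) (i : ι') : D b y (X i) = Lin b ⁅y, b i⁆ := mkDerivation_X _ _ _

theorem D_hom (y : g) {n : ℕ} {p : MvPolynomial ι' K} (hp : p.IsHomogeneous n) :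
    (D b y p).IsHomogeneous n := by
  refine hom_induct (fun n p => (D b y p).IsHomogeneous n) ?_ ?_ ?_ ?_ ?_ n p hp
  · simpa using isHomogeneous_zero _ _ _
  · intro n; simpa using isHomogeneous_zero _ _ _
  · intro n p q hp hq; simpa using hp.add hq
  · intro n r p hp
    rw [Derivation.map_smul, smul_eq_C_mul]; exact hp.C_mul r
  · intro n p i hp h
    rw [Derivation.leibniz, D_X, smul_eq_mul, smul_eq_mul, mul_comm (X i)]
    exact (hp.mul (Lin_hom b _)).add (h.mul (isHomogeneous_X _ _))

theorem D_ord (y : g) {n : ℕ} {p : MvPolynomial ι' K} (hp : p.IsHomogeneous n) :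
    ι K y * ord b p - ord b p * ι K y - ord b (D b y p) ∈ Fil K g n := by
  refine hom_induct (fun n p => ι K y * ord b p - ord b p * ι K y - ord b (D b y p) ∈ Fil K g n)
    ?_ ?_ ?_ ?_ ?_ n p hp
  · simp [ord_one]
  · simp
  · intro n p q hp hq
    have := add_mem hp hq
    simp only [map_add]
    convert this using 1
    noncomm_ring
  · intro n r p hp
    have := Submodule.smul_mem _ r hp
    simp only [map_smul, Derivation.map_smul, smul_mul_assoc, mul_smul_comm]
    simpa only [smul_sub] using this
  · intro n p i hp h
    have h1 := ord_mul_X b hp i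
    have h2 := comm_mem h1 y
    have h3 := mul_iota_mem h (b i)
    have h4 := ord_mul_X b (D_hom b y hp) i
    have h5 := ord_mul_Lin b hp ⁅y, b i⁆
    have := sub_mem (sub_mem (add_mem h2 h3) h4) h5
    rw [iota_lie] at this
    have e : D b y (p * X i) = p * Lin b ⁅y, b i⁆ + D b y p * X i := by
      rw [Derivation.leibniz, D_X, smul_eq_mul, smul_eq_mul, mul_comm (X i)]
    rw [e, map_add]
    convert this using 1
    noncomm_ring

end pbw

section flag
open MvPolynomial
variable {K : Type*} [Field K] [CharZero K] {g : Type*} [LieRing g] [LieAlgebra K g]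
variable {ι' : Type*} (b : Module.Basis ι' K g) (c : ι' → K)

/-- shifted generators -/
noncomputable def gen (i : ι') : UniversalEnvelopingAlgebra K g :=
  ι K (b i) - algebraMap K (UniversalEnvelopingAlgebra K g) (c i)

/-- left ideal -/
noncomputable def J (s : Set ι') :
    Submodule (UniversalEnvelopingAlgebra K g) (UniversalEnvelopingAlgebra K g) :=
  Submodule.span _ (gen b c '' s)

theorem mul_gen_mem {n : ℕ} {u : UniversalEnvelopingAlgebra K g} (hu : u ∈ Fil K g n) (i : ι') :
    u * gen b c i ∈ Fil K g (n + 1) := by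
  rw [gen, mul_sub]
  refine sub_mem (mul_iota_mem hu _) (Fil_succ n ?_)
  rw [← Algebra.commutes, ← Algebra.smul_def]
  exact Submodule.smul_mem _ _ hu

theorem ord_mul_gen {n : ℕ} {p : MvPolynomial ι' K} (hp : p.IsHomogeneous n) (i : ι') :
    ord b (p * X i) - ord b p * gen b c i ∈ Fil K g (n + 1) := by
  have h : ord b p * algebraMap K (UniversalEnvelopingAlgebra K g) (c i) ∈ Fil K g (n + 1) := by
    rw [← Algebra.commutes, ← Algebra.smul_def]
    exact Submodule.smul_mem _ _ (ord_mem b hp)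
  have := add_mem (ord_mul_X b hp i) h
  rw [gen]
  convert this using 1
  noncomm_ring

theorem ord_ideal {s : Set ι'} {k : ℕ} {q : MvPolynomial ι' K} (hq : q.IsHomogeneous k)
    (hs : q ∈ Ideal.span (X '' s : Set (MvPolynomial ι' K))) :
    ∃ j ∈ J b c s, ord b q - j ∈ Fil K g k := by
  rw [mem_ideal_span_X_image] at hs
  rw [q.as_sum]
  have : ∀ t : Finset (ι' →₀ ℕ), t ⊆ q.support →
      ∃ j ∈ J b c s, ord b (∑ v ∈ t, monomial v (coeff v q)) - j ∈ Fil K g k := by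
    classical
    intro t
    induction t using Finset.induction_on with
    | empty => intro _; exact ⟨0, zero_mem _, by simp⟩
    | insert a t ha ih =>
      intro ht
      obtain ⟨j, hj, hj'⟩ := ih (fun x hx => ht (Finset.mem_insert_of_mem hx))
      have hat := ht (Finset.mem_insert_self a t)
      have hd : k = a.degree := hq.degree_eq_sum_deg_support hat
      obtain ⟨i, his, hi⟩ := hs a hat
      have hi' : Finsupp.single i 1 ≤ a := by
        rw [Finsupp.single_le_iff]; exact Nat.one_le_iff_ne_zero.mpr hi
      have hs' : a - Finsupp.single i 1 + Finsupp.single i 1 = a := tsub_add_cancel_of_le hi'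
      obtain ⟨k', rfl⟩ : ∃ k', k = k' + 1 := by
        have := congrArg Finsupp.degree hs'
        rw [map_add, Finsupp.degree_single] at this
        exact ⟨(a - Finsupp.single i 1).degree, by rw [this, ← hd]⟩
      have hd' : (a - Finsupp.single i 1).degree = k' := by
        have := congrArg Finsupp.degree hs'
        rw [map_add, Finsupp.degree_single, ← hd] at this
        omega
      have h1 := ord_mul_gen b c (isHomogeneous_monomial (coeff a q) hd') i
      rw [X, monomial_mul, hs', mul_one] at h1
      refine ⟨ord b (monomial (a - Finsupp.single i 1) (coeff a q)) * gen b c i + j,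
        add_mem ?_ hj, ?_⟩
      · exact Submodule.smul_mem _ _ (Submodule.subset_span ⟨i, his, rfl⟩)
      · rw [Finset.sum_insert ha, map_add]
        have := add_mem h1 hj'
        convert this using 1
        abel
  exact this _ subset_rfl

theorem flag (hι : Function.Injective (ι K : g → UniversalEnvelopingAlgebra K g))
    (w : ι' → ℤ) (M : Finset ι')
    (hM : ∀ i ∈ M, ∀ a ∈ M, ι K ⁅b i, b a⁆ ∈
      Submodule.span K (gen b c '' {j | j ∈ M ∧ w j < w a})) (s : Finset ι') :
    s ⊆ M → (∀ i ∈ s, ∀ j ∈ M, w j < w i → j ∈ s) →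
    ∀ (n : ℕ) (u : UniversalEnvelopingAlgebra K g) (p : MvPolynomial ι' K),
      u ∈ Fil K g (n + 1) → u ∈ J b c s → p.IsHomogeneous n → u - ord b p ∈ Fil K g n →
      p ∈ Ideal.span (X '' (s : Set ι') : Set (MvPolynomial ι' K)) := by
  classical
  induction s using Finset.induction_on_max_value w with
  | empty =>
    intro _ _ n u p hu hJ hp h
    simp [J] at hJ
    rw [hJ, zero_sub, neg_mem_iff] at h
    rw [ord_inj b hι hp h]
    exact zero_mem _
  | insert a s ha hmax ih =>
    intro hsM hcl
    have haM : a ∈ M := hsM (Finset.mem_insert_self _ _)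
    have hsM' : s ⊆ M := fun x hx => hsM (Finset.mem_insert_of_mem hx)
    have hcl' : ∀ i ∈ s, ∀ j ∈ M, w j < w i → j ∈ s := by
      intro i hi j hj hij
      rcases Finset.mem_insert.mp (hcl i (Finset.mem_insert_of_mem hi) j hj hij) with rfl | h
      · exact absurd (hmax i hi) (by omega)
      · exact h
    have ih := ih hsM' hcl'
    have hsub : (X '' (s : Set ι') : Set (MvPolynomial ι' K)) ⊆
        X '' ((insert a s : Finset ι') : Set ι') :=
      Set.image_mono (by simp)
    -- stability
    have hstab : ∀ v ∈ J b c (s : Set ι'), v * gen b c a ∈ J b c (s : Set ι') := by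
      intro v hv
      rw [J] at hv
      induction hv using Submodule.span_induction with
      | mem v hv =>
        obtain ⟨i, hi, rfl⟩ := hv
        have e : gen b c i * gen b c a = gen b c a * gen b c i + ι K ⁅b i, b a⁆ := by
          rw [iota_lie, gen, gen]
          have h1 := Algebra.commutes (c i) (ι K (b a))
          have h2 := Algebra.commutes (c a) (ι K (b i))
          have h3 := Algebra.commutes (A := UniversalEnvelopingAlgebra K g) (c a)
            (algebraMap K _ (c i))
          simp only [sub_mul, mul_sub, h1, h2, h3]
          abel
        rw [e]
        refine add_mem (Submodule.smul_mem _ _ (Submodule.subset_span ⟨i, hi, rfl⟩)) ?_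
        have hle : Submodule.span K (gen b c '' {j | j ∈ M ∧ w j < w a}) ≤
            (J b c (s : Set ι')).restrictScalars K := by
          rw [Submodule.span_le]
          rintro _ ⟨j, ⟨hj, hj'⟩, rfl⟩
          refine Submodule.subset_span ⟨j, ?_, rfl⟩
          rcases Finset.mem_insert.mp (hcl a (Finset.mem_insert_self _ _) j hj hj') with rfl | h
          · exact absurd hj' (lt_irrefl _)
          · exact h
        exact hle (hM i (hsM' hi) a haM)
      | zero => simp
      | add x y _ _ hx hy => rw [add_mul]; exact add_mem hx hy
      | smul r x _ hx => rw [smul_eq_mul, mul_assoc]; exact Submodule.smul_mem _ r hx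
    -- main induction
    have main : ∀ (k n : ℕ) (v w' : UniversalEnvelopingAlgebra K g) (p : MvPolynomial ι' K),
        w' ∈ Fil K g k → v ∈ J b c (s : Set ι') → v + w' * gen b c a ∈ Fil K g (n + 1) →
        p.IsHomogeneous n → v + w' * gen b c a - ord b p ∈ Fil K g n →
        p ∈ Ideal.span (X '' ((insert a s : Finset ι') : Set ι') : Set (MvPolynomial ι' K)) := by
      intro k
      induction k with
      | zero =>
        intro n v w' p hw hv hu hp h
        simp [Fil] at hw
        subst hw
        rw [zero_mul, add_zero] at hu h
        exact Ideal.span_mono hsub (ih n v p hu hv hp h)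
      | succ k ihk =>
        intro n v w' p hw hv hu hp h
        obtain ⟨q, hq, hwq⟩ := exists_symbol b hw
        have h1 := mul_gen_mem b c hwq a
        have h2 := ord_mul_gen b c hq a
        have h3 : w' * gen b c a - ord b (q * X a) ∈ Fil K g (k + 1) := by
          have := sub_mem h1 h2
          convert this using 1
          noncomm_ring
        have hqX : (q * X a).IsHomogeneous (k + 1) := hq.mul (isHomogeneous_X _ _)
        rcases lt_trichotomy (k + 1) n with hlt | heq | hgt
        · -- contribution of lower order
          have hlow : w' * gen b c a ∈ Fil K g n := Fil_mono (by omega) (mul_gen_mem b c hw a)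
          have e1 : v ∈ Fil K g (n + 1) := by
            have := sub_mem hu (Fil_succ n hlow); simpa using this
          have e2 : v - ord b p ∈ Fil K g n := by
            have := sub_mem h hlow
            convert this using 1; abel
          exact Ideal.span_mono hsub (ih n v p e1 hv hp e2)
        · subst heq
          have hlow : w' * gen b c a ∈ Fil K g (k + 1 + 1) := mul_gen_mem b c hw a
          have e1 : v ∈ Fil K g (k + 1 + 1) := by
            have := sub_mem hu hlow; simpa using this
          have e2 : v - ord b (p - q * X a) ∈ Fil K g (k + 1) := by
            have := sub_mem h h3
            rw [map_sub]
            convert this using 1; abel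
          have e3 := Ideal.span_mono hsub (ih (k + 1) v _ e1 hv (hp.sub hqX) e2)
          have e4 : q * X a ∈ Ideal.span (X '' ((insert a s : Finset ι') : Set ι') :
              Set (MvPolynomial ι' K)) :=
            Ideal.mul_mem_left _ _ (Ideal.subset_span ⟨a, by simp, rfl⟩)
          have := add_mem e3 e4
          simpa using this
        · have hlow : w' * gen b c a ∈ Fil K g (k + 1 + 1) := mul_gen_mem b c hw a
          have hu' : v + w' * gen b c a ∈ Fil K g (k + 1) := Fil_mono (by omega) hu
          have e1 : v ∈ Fil K g (k + 1 + 1) := by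
            have := sub_mem (Fil_succ _ hu') hlow; simpa using this
          have e2 : v - ord b (-(q * X a)) ∈ Fil K g (k + 1) := by
            have := sub_mem hu' h3
            rw [map_neg]
            convert this using 1; abel
          have e3 := ih (k + 1) v _ e1 hv hqX.neg e2
          rw [neg_mem_iff] at e3
          have e4 : q ∈ Ideal.span (X '' (s : Set ι') : Set (MvPolynomial ι' K)) := by
            rw [mem_ideal_span_X_image] at e3 ⊢
            intro t ht
            obtain ⟨i, hi, hi'⟩ := e3 (t + Finsupp.single a 1) (by
              rw [mem_support_iff, coeff_mul_X]; exact mem_support_iff.mp ht)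
            refine ⟨i, hi, ?_⟩
            have : a ≠ i := by rintro rfl; exact ha hi
            simpa [Finsupp.single_apply, this] using hi'
          obtain ⟨j, hj, hj'⟩ := ord_ideal b c hq e4
          have e5 : w' - j ∈ Fil K g k := by
            have := add_mem hwq hj'
            simpa using this
          have e6 : v + w' * gen b c a = (v + j * gen b c a) + (w' - j) * gen b c a := by
            noncomm_ring
          rw [e6] at hu h
          exact ihk n _ _ p e5 (add_mem hv (hstab j hj)) hu hp h
    intro n u p hu hJ hp h
    have : u ∈ J b c (s : Set ι') ⊔ Submodule.span _ {gen b c a} := by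
      rw [J, ← Submodule.span_union]
      rw [J, Finset.coe_insert, Set.image_insert_eq] at hJ
      convert hJ using 2
      rw [Set.union_comm]; rfl
    obtain ⟨v, hv, x, hx, rfl⟩ := Submodule.mem_sup.mp this
    obtain ⟨w', rfl⟩ := Submodule.mem_span_singleton.mp hx
    obtain ⟨k, hk⟩ := exists_mem w'
    exact main k n v w' p hk hv hu hp h

theorem poly_zero (lam : g →ₗ[K] K) (M : Set ι') (h0 : ∀ j ∈ M, lam (b j) = 0)
    (hdual : ∀ i ∈ M, ∃ y : g, ∀ z : g, lam ⁅y, z⁆ = b.repr z i)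
    (p : MvPolynomial ι' K) (hp : p ∈ Ideal.span (X '' M : Set (MvPolynomial ι' K)))
    (hD : ∀ y, D b y p = 0) : p = 0 := by
  classical
  let τ : MvPolynomial ι' K →ₐ[K] MvPolynomial ι' K := aeval (fun i => X i + C (lam (b i)))
  let τ' : MvPolynomial ι' K →ₐ[K] MvPolynomial ι' K := aeval (fun i => X i - C (lam (b i)))
  have hττ : ∀ p, τ' (τ p) = p := by
    intro p
    have : τ'.comp τ = AlgHom.id K _ := by
      ext i; simp [τ, τ', algHom_C]
    exact DFunLike.congr_fun this p
  have hLin : ∀ y, τ (Lin b y) = Lin b y + C (lam y) := by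
    intro y
    have : τ.toLinearMap ∘ₗ Lin b = Lin b + (Algebra.linearMap K (MvPolynomial ι' K)) ∘ₗ lam := by
      apply b.ext
      intro i
      simp [Lin_basis, τ, algebraMap_eq]
    exact LinearMap.congr_fun this y
  have hτD : ∀ y q, τ (D b y q) = D b y (τ q) +
      mkDerivation K (fun i => (C (lam ⁅y, b i⁆) : MvPolynomial ι' K)) (τ q) := by
    intro y q
    induction q using MvPolynomial.induction_on with
    | C a => simp [τ, D]
    | add p q hp hq => simp only [map_add, hp, hq]; ring
    | mul_X p i hp =>
      have e : τ (X i) = X i + C (lam (b i)) := by simp [τ]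
      simp only [map_mul, Derivation.leibniz, smul_eq_mul, map_add, hp, D_X, hLin, e,
        derivation_C, mkDerivation_X]
      ring
  set q := τ p with hq
  have hqI : q ∈ Ideal.span (X '' M : Set (MvPolynomial ι' K)) := by
    have : Ideal.span (X '' M : Set (MvPolynomial ι' K)) ≤
        (Ideal.span (X '' M : Set (MvPolynomial ι' K))).comap τ.toRingHom := by
      rw [Ideal.span_le]
      rintro _ ⟨j, hj, rfl⟩
      have e : τ (X j) = X j := by simp [τ, h0 j hj]
      change τ (X j) ∈ Ideal.span (X '' M : Set (MvPolynomial ι' K))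
      rw [e]
      exact Ideal.subset_span ⟨j, hj, rfl⟩
    exact this hp
  have hpd : ∀ i ∈ M, ∃ y, pderiv i q = - D b y q := by
    intro i hi
    obtain ⟨y, hy⟩ := hdual i hi
    refine ⟨y, ?_⟩
    have h := hτD y p
    rw [hD y, map_zero, ← hq] at h
    have e : mkDerivation K (fun j => (C (lam ⁅y, b j⁆) : MvPolynomial ι' K)) = pderiv i := by
      rw [pderiv_def]
      congr 1
      funext j
      rw [hy, Module.Basis.repr_self]
      by_cases hij : j = i
      · subst hij; simp
      · simp [hij]
    rw [e] at h
    exact eq_neg_of_add_eq_zero_right h.symm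
  have hcomp : ∀ y k, homogeneousComponent k (D b y q) = D b y (homogeneousComponent k q) := by
    intro y k
    conv_lhs => rw [← sum_homogeneousComponent q, map_sum, map_sum]
    have : ∀ j, homogeneousComponent k (D b y (homogeneousComponent j q)) =
        if j = k then D b y (homogeneousComponent j q) else 0 := fun j => by
      have := homogeneousComponent_of_mem (m := k) (n := j)
        (D_hom b y (homogeneousComponent_isHomogeneous j q))
      rw [this]
      congr 1
      simp [eq_comm]
    simp only [this, Finset.sum_ite_eq', Finset.mem_range]
    split_ifs with hk
    · rfl
    · rw [homogeneousComponent_eq_zero _ _ (by omega), map_zero]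
  have hcoef : ∀ k, ∀ s : ι' →₀ ℕ, s.degree = k → coeff s q = 0 := by
    intro k
    induction k with
    | zero =>
      intro s hs
      by_contra hne
      obtain ⟨i, _, hi⟩ := mem_ideal_span_X_image.mp hqI s (mem_support_iff.mpr hne)
      rw [(Finsupp.degree_eq_zero_iff s).mp hs] at hi
      simp at hi
    | succ k ih =>
      intro s hs
      by_contra hne
      obtain ⟨i, hiM, hi⟩ := mem_ideal_span_X_image.mp hqI s (mem_support_iff.mpr hne)
      have hi' : Finsupp.single i 1 ≤ s := by
        rw [Finsupp.single_le_iff]; exact Nat.one_le_iff_ne_zero.mpr hi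
      have hs' : s - Finsupp.single i 1 + Finsupp.single i 1 = s := tsub_add_cancel_of_le hi'
      have hd : (s - Finsupp.single i 1).degree = k := by
        have := congrArg Finsupp.degree hs'
        rw [map_add, Finsupp.degree_single, hs] at this
        omega
      set t := s - Finsupp.single i 1
      obtain ⟨y, hy⟩ := hpd i hiM
      have h1 := coeff_pderiv (i := i) q t
      have hz : homogeneousComponent k q = 0 := by
        ext v
        rw [coeff_homogeneousComponent]
        split_ifs with hv
        · rw [ih v hv, coeff_zero]
        · rw [coeff_zero]
      have h2 : coeff t (D b y q) = 0 := by
        have := hcomp y k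
        rw [hz, map_zero] at this
        have := congrArg (coeff t) this
        rwa [coeff_homogeneousComponent, if_pos hd, coeff_zero] at this
      rw [hy, coeff_neg, h2, hs', neg_zero] at h1
      have h3 : ((t i : K) + 1) ≠ 0 := by exact_mod_cast Nat.succ_ne_zero (t i)
      rcases mul_eq_zero.mp h1.symm with h | h
      · exact hne h
      · exact h3 (by simpa using h)
  have hq0 : q = 0 := by
    ext s; rw [hcoef _ s rfl, coeff_zero]
  have := hττ p
  rw [← hq, hq0, map_zero] at this
  exact this.symm

theorem abstract_main (hι : Function.Injective (ι K : g → UniversalEnvelopingAlgebra K g))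
    (w : ι' → ℤ) (M : Finset ι')
    (hM : ∀ i ∈ M, ∀ a ∈ M, ι K ⁅b i, b a⁆ ∈
      Submodule.span K (gen b c '' {j | j ∈ M ∧ w j < w a}))
    (lam : g →ₗ[K] K) (h0 : ∀ j ∈ M, lam (b j) = 0)
    (hdual : ∀ i ∈ M, ∃ y : g, ∀ z : g, lam ⁅y, z⁆ = b.repr z i)
    (z : UniversalEnvelopingAlgebra K g)
    (hz : ∀ u, u * z = z * u) (hJ : z ∈ J b c (M : Set ι')) : z = 0 := by
  have : ∀ n, z ∈ Fil K g n → z = 0 := by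
    intro n
    induction n with
    | zero => intro h; simpa [Fil] using h
    | succ n ih =>
      intro h
      obtain ⟨p, hp, hpz⟩ := exists_symbol b h
      have hI := flag b c hι w M hM M subset_rfl (fun _ _ j hj _ => hj) n z p h hJ hp hpz
      have hD : ∀ y, D b y p = 0 := by
        intro y
        refine ord_inj b hι (D_hom b y hp) ?_
        have h1 := D_ord b y hp
        have h2 := comm_mem hpz y
        have h3 := hz (ι K y)
        have h4 := neg_mem (add_mem h1 h2)
        convert h4 using 1
        rw [mul_sub, sub_mul, h3]
        abel
      have hp0 := poly_zero b lam M h0 hdual p hI hD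
      rw [hp0, map_zero, sub_zero] at hpz
      exact ih hpz
  obtain ⟨n, hn⟩ := exists_mem z
  exact this n hn

end flag
section Concrete

universe u v

variable {K : Type u} {g : Type v} [Field K] [CharZero K] [LieRing g] [LieAlgebra K g]
  [FiniteDimensional K g]

theorem span_gen {ι' : Type*} (b : Module.Basis ι' K g) (χ : g →ₗ[K] K) (S : Set ι') (ξ : g)
    (hξ : ξ ∈ Submodule.span K (b '' S)) :
    ι K ξ - algebraMap K (UniversalEnvelopingAlgebra K g) (χ ξ) ∈
      Submodule.span K (gen b (fun i => χ (b i)) '' S) := by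
  let F : g →ₗ[K] UniversalEnvelopingAlgebra K g :=
    (ι K : g →ₗ⁅K⁆ UniversalEnvelopingAlgebra K g).toLinearMap -
      (Algebra.linearMap K (UniversalEnvelopingAlgebra K g)) ∘ₗ χ
  have : Submodule.span K (b '' S) ≤
      (Submodule.span K (gen b (fun i => χ (b i)) '' S)).comap F := by
    rw [Submodule.span_le]
    rintro _ ⟨i, hi, rfl⟩
    exact Submodule.subset_span ⟨i, hi, rfl⟩
  exact this hξ

theorem exists_ext {α : Type} (v : α → g) (hv : LinearIndependent K v) :
    ∃ (β : Type v) (b : Module.Basis (α ⊕ β) K g), ∀ p, b (Sum.inl p) = v p := by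
  refine ⟨_, Module.Basis.sumExtend hv, fun p => ?_⟩
  simp [Module.Basis.sumExtend]
  rfl

theorem exists_adapted (V : ℤ → Submodule K g) (hV : iSupIndep V) :
    ∃ (ι' : Type v) (_ : Finite ι') (b : Module.Basis ι' K g)
      (w : ι' → Option ℤ), ∀ k, V k = Submodule.span K (b '' {i | w i = some k}) := by
  classical
  have hex : ∀ k, ∃ f : Fin (Module.finrank K (V k)) → g, LinearIndependent K f ∧
      Submodule.span K (Set.range f) = V k := by
    intro k
    refine ⟨fun i => (Module.finBasis K (V k) i : g),
      (Module.finBasis K (V k)).linearIndependent.map' (V k).subtype (V k).ker_subtype, ?_⟩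
    have : (Set.range fun i => (Module.finBasis K (V k) i : g)) =
        (V k).subtype '' Set.range (Module.finBasis K (V k)) := by
      rw [← Set.range_comp]; rfl
    rw [this, ← Submodule.map_span, Module.Basis.span_eq, Submodule.map_top,
      Submodule.range_subtype]
  choose f hf hsp using hex
  have hv : LinearIndependent K (fun p : (Σ k, Fin (Module.finrank K (V k))) => f p.1 p.2) := by
    apply linearIndependent_iUnion_finite hf
    intro k t _ hkt
    simp only [hsp]
    refine (hV k).mono_right ?_
    refine iSup₂_le fun j hj => ?_
    exact le_iSup₂_of_le j (fun h => hkt (h ▸ hj)) le_rfl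
  obtain ⟨β, b, hb⟩ := exists_ext _ hv
  have := Module.Finite.finite_basis b
  refine ⟨_, this, b, Sum.elim (fun p => some p.1) (fun _ => none), ?_⟩
  intro k
  rw [← hsp k]
  congr 1
  ext x
  constructor
  · rintro ⟨i, rfl⟩
    exact ⟨Sum.inl ⟨k, i⟩, rfl, hb ⟨k, i⟩⟩
  · rintro ⟨i | i, hi, rfl⟩
    · obtain ⟨k', i⟩ := i
      have hi : k' = k := Option.some.inj hi
      subst hi
      exact ⟨i, (hb ⟨k', i⟩).symm⟩
    · exact absurd hi (Option.some_ne_none k).symm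

open Module.End in
theorem lie_eig {h x y : g} {i j : ℤ} (hx : x ∈ eigenspace (LieAlgebra.ad K g h) (i : K))
    (hy : y ∈ eigenspace (LieAlgebra.ad K g h) (j : K)) :
    ⁅x, y⁆ ∈ eigenspace (LieAlgebra.ad K g h) ((i + j : ℤ) : K) := by
  rw [mem_eigenspace_iff, LieAlgebra.ad_apply] at *
  rw [leibniz_lie, hx, hy, smul_lie, lie_smul, ← add_smul]
  push_cast
  rfl

open Module.End in
theorem kill_eig {h x y : g} {i j : ℤ} (hx : x ∈ eigenspace (LieAlgebra.ad K g h) (i : K))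
    (hy : y ∈ eigenspace (LieAlgebra.ad K g h) (j : K)) (hij : i + j ≠ 0) :
    killingForm K g x y = 0 := by
  rw [mem_eigenspace_iff, LieAlgebra.ad_apply] at *
  have h1 := LieModule.traceForm_apply_lie_apply' K g g h x y
  rw [hx, hy] at h1
  simp only [map_smul, LinearMap.smul_apply, smul_eq_mul] at h1
  have h2 : ((i + j : ℤ) : K) * killingForm K g x y = 0 := by
    push_cast
    rw [add_mul]
    exact eq_neg_iff_add_eq_zero.mp h1
  exact (mul_eq_zero.mp h2).resolve_left (by exact_mod_cast hij)

theorem iota_inj [LieAlgebra.IsKilling K g] :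
    Function.Injective (ι K : g → UniversalEnvelopingAlgebra K g) := by
  have h1 : Function.Injective (LieAlgebra.ad K g) := by
    rw [injective_iff_map_eq_zero]
    intro x hx
    refine (LieAlgebra.IsKilling.killingForm_nondegenerate K g).1 x fun y => ?_
    rw [killingForm_apply_apply, hx]
    simp
  intro x y hxy
  apply h1
  have := congrArg (lift K (LieAlgebra.ad K g)) hxy
  simpa only [lift_ι_apply] using this

theorem exists_dual [LieAlgebra.IsKilling K g] (h : g) (φ : g →ₗ[K] K)
    (hφ : ∀ x, ⁅h, x⁆ = 0 → φ x = 0) :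
    ∃ y : g, ∀ z : g, killingForm K g h ⁅y, z⁆ = φ z := by
  have h1 : φ ∈ LinearMap.range (LieAlgebra.ad K g h).dualMap := by
    rw [LinearMap.range_dualMap_eq_dualAnnihilator_ker, Submodule.mem_dualAnnihilator]
    intro x hx
    exact hφ x hx
  obtain ⟨ψ, rfl⟩ := h1
  let y := ((killingForm K g).toDual
    (LieAlgebra.IsKilling.killingForm_nondegenerate K g)).symm ψ
  have hy : ∀ z, killingForm K g y z = ψ z := fun z =>
    LinearMap.BilinForm.apply_toDual_symm_apply
      (hB := LieAlgebra.IsKilling.killingForm_nondegenerate K g) ψ z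
  refine ⟨-y, fun z => ?_⟩
  rw [LinearMap.dualMap_apply, LieAlgebra.ad_apply, ← hy]
  have e1 := LieModule.traceForm_apply_lie_apply K g g y h z
  have e2 := LieModule.traceForm_apply_lie_apply K g g h (-y) z
  have e3 : ⁅h, -y⁆ = ⁅y, h⁆ := by rw [lie_neg, lie_skew]
  rw [e3] at e2
  exact e2.symm.trans e1

open Module.End in
theorem concrete [LieAlgebra.IsKilling K g] (e h : g)
    (hhe : ⁅h, e⁆ = (2 : K) • e) (l : Submodule K g)
    (hl : l ≤ eigenspace (LieAlgebra.ad K g h) ((-1 : ℤ) : K))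
    (hiso : ∀ x ∈ l, ∀ y ∈ l, killingForm K g e ⁅x, y⁆ = 0)
    (z : UniversalEnvelopingAlgebra K g) (hz : ∀ u, u * z = z * u)
    (hzI : z ∈ Submodule.span (UniversalEnvelopingAlgebra K g)
      {u : UniversalEnvelopingAlgebra K g |
        ∃ ξ ∈ (l ⊔ ⨆ i : ℤ, ⨆ _ : i ≤ -2, eigenspace (LieAlgebra.ad K g h) (i : K)),
        u = ι K ξ - algebraMap K (UniversalEnvelopingAlgebra K g) (killingForm K g e ξ)}) :
    z = 0 := by
  classical
  let V : ℤ → Submodule K g := fun k =>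
    if k = -1 then l else eigenspace (LieAlgebra.ad K g h) (k : K)
  have hV1 : V (-1) = l := if_pos rfl
  have hV2 : ∀ k, k ≠ -1 → V k = eigenspace (LieAlgebra.ad K g h) (k : K) :=
    fun k hk => if_neg hk
  have hVle : ∀ k, V k ≤ eigenspace (LieAlgebra.ad K g h) (k : K) := by
    intro k
    by_cases hk : k = -1
    · subst hk; rw [hV1]; exact hl
    · rw [hV2 k hk]
  have hVi : iSupIndep V :=
    ((eigenspaces_iSupIndep (LieAlgebra.ad K g h)).comp
      (Int.cast_injective (α := K))).mono hVle
  obtain ⟨ι', hfin, b, w, hw⟩ := exists_adapted V hVi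
  have := Fintype.ofFinite ι'
  have hmem : ∀ i k, w i = some k → b i ∈ V k := by
    intro i k hi
    rw [hw k]
    exact Submodule.subset_span ⟨i, hi, rfl⟩
  let M : Finset ι' := Finset.univ.filter (fun i => ∃ k, w i = some k ∧ k ≤ -1)
  have hMm : ∀ i, i ∈ M ↔ ∃ k, w i = some k ∧ k ≤ -1 := by intro i; simp [M]
  have hVM : ∀ k ≤ -1, V k ≤ Submodule.span K (b '' (M : Set ι')) := by
    intro k hk
    rw [hw k]
    apply Submodule.span_mono
    apply Set.image_mono
    intro i hi
    exact (hMm i).2 ⟨k, hi, hk⟩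
  have he2 : e ∈ eigenspace (LieAlgebra.ad K g h) ((2 : ℤ) : K) := by
    rw [mem_eigenspace_iff, LieAlgebra.ad_apply, hhe]; norm_num
  have hh0 : h ∈ eigenspace (LieAlgebra.ad K g h) ((0 : ℤ) : K) := by
    rw [mem_eigenspace_iff, LieAlgebra.ad_apply]; simp
  refine abstract_main b (fun i => killingForm K g e (b i)) iota_inj
    (fun i => (w i).getD 0) M ?_ (killingForm K g h) ?_ ?_ z hz ?_
  · intro i hi a ha
    obtain ⟨k, hik, hk⟩ := (hMm i).1 hi
    obtain ⟨k', hak, hk'⟩ := (hMm a).1 ha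
    have hbr := lie_eig (hVle _ (hmem i k hik)) (hVle _ (hmem a k' hak))
    have hχ : killingForm K g e ⁅b i, b a⁆ = 0 := by
      by_cases hkk : k = -1 ∧ k' = -1
      · obtain ⟨rfl, rfl⟩ := hkk
        exact hiso _ (hV1 ▸ hmem i _ hik) _ (hV1 ▸ hmem a _ hak)
      · exact kill_eig he2 hbr (by omega)
    rw [← hV2 _ (by omega), hw] at hbr
    have := span_gen b (killingForm K g e) _ _ hbr
    rw [hχ, map_zero, sub_zero] at this
    refine Submodule.span_mono (Set.image_mono ?_) this
    intro j hj
    have hj : w j = some (k + k') := hj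
    refine ⟨(hMm j).2 ⟨_, hj, by omega⟩, ?_⟩
    simp only [hj, hak, Option.getD_some]
    omega
  · intro j hj
    obtain ⟨k, hjk, hk⟩ := (hMm j).1 hj
    exact kill_eig hh0 (hVle _ (hmem j k hjk)) (by omega)
  · intro i hi
    obtain ⟨k, hik, hk⟩ := (hMm i).1 hi
    refine exists_dual h (b.coord i) ?_
    intro x hx
    have hx0 : x ∈ V 0 := by
      rw [hV2 0 (by norm_num), mem_eigenspace_iff, LieAlgebra.ad_apply, hx]; simp
    rw [hw 0] at hx0
    have : Submodule.span K (b '' {i | w i = some 0}) ≤ LinearMap.ker (b.coord i) := by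
      rw [Submodule.span_le]
      rintro _ ⟨j, hj, rfl⟩
      have hij : j ≠ i := by
        rintro rfl
        have hj : w j = some 0 := hj
        rw [hik] at hj
        have := Option.some.inj hj
        omega
      simp [hij]
    exact this hx0
  · have hle : (l ⊔ ⨆ i : ℤ, ⨆ _ : i ≤ -2, eigenspace (LieAlgebra.ad K g h) (i : K)) ≤
        Submodule.span K (b '' (M : Set ι')) := by
      refine sup_le ?_ (iSup₂_le fun i hi => ?_)
      · rw [← hV1]; exact hVM _ le_rfl
      · rw [← hV2 i (by omega)]; exact hVM _ (by omega)
    refine Submodule.span_le.2 ?_ hzI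
    rintro _ ⟨ξ, hξ, rfl⟩
    have := span_gen b (killingForm K g e) _ _ (hle hξ)
    exact Submodule.span_le_restrictScalars K (UniversalEnvelopingAlgebra K g) _ this

end Concrete

end CIT


/-- The composition of the inclusion `Z(U) ⊆ U` of the center of `U` with the
quotient map `U → U/U·m_χ` is injective; i.e. `Z(U) ∩ U·m_χ = 0`. -/
theorem center_intersect_ideal_trivial
    (K : Type*) [Field K] [IsAlgClosed K] [CharZero K]
    (g : Type*) [LieRing g] [LieAlgebra K g] [FiniteDimensional K g]
    [LieAlgebra.IsSemisimple K g]
    (e h f : g) (he : e ≠ 0)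
    (hhe : ⁅h, e⁆ = (2 : K) • e) (hhf : ⁅h, f⁆ = (-2 : K) • f) (hef : ⁅e, f⁆ = h)
    (l : Submodule K g)
    (hl : l ≤ Module.End.eigenspace (LieAlgebra.ad K g h) ((-1 : ℤ) : K))
    (hiso : ∀ x ∈ l, ∀ y ∈ l, killingForm K g e ⁅x, y⁆ = 0)
    (hmax : ∀ l' : Submodule K g,
      l' ≤ Module.End.eigenspace (LieAlgebra.ad K g h) ((-1 : ℤ) : K) →
      (∀ x ∈ l', ∀ y ∈ l', killingForm K g e ⁅x, y⁆ = 0) → l ≤ l' → l' = l)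
    (m : Submodule K g)
    (hm : m = l ⊔ ⨆ i : ℤ, ⨆ _ : i ≤ -2,
      Module.End.eigenspace (LieAlgebra.ad K g h) (i : K))
    (I : Submodule (UniversalEnvelopingAlgebra K g) (UniversalEnvelopingAlgebra K g))
    (hI : I = Submodule.span (UniversalEnvelopingAlgebra K g)
      {u : UniversalEnvelopingAlgebra K g | ∃ ξ ∈ m,
        u = UniversalEnvelopingAlgebra.ι K ξ -
          algebraMap K (UniversalEnvelopingAlgebra K g) (killingForm K g e ξ)}) :
    ∀ z ∈ Subalgebra.center K (UniversalEnvelopingAlgebra K g), z ∈ I → z = 0 := by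
  intro z hz hzI
  subst hm hI
  exact CIT.concrete e h hhe l hl hiso z (fun u => (Subalgebra.mem_center_iff.1 hz u)) hzI
end

section
/- Assume e is even, i.e. g(i) = 0 for every odd i. Set p := ⊕_{i ≥ 0} g(i) and m := ⊕_{i < 0} g(i). Then U decomposes as the internal direct sum of K-vector spaces U = U(p) ⊕ U·m_χ, where U(p) denotes the subalgebra of U generated by (the image of) p. -/
namespace PBWEven

section Sl2
variable {K V : Type*} [Field K] [CharZero K] [AddCommGroup V] [Module K V]
  {H E F : Module.End K V}

lemma mem_gen_iff (c : K) (x : V) :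
    x ∈ H.maxGenEigenspace c ↔ ∃ k : ℕ, ((H - c • (1 : Module.End K V)) ^ k) x = 0 :=
  Module.End.mem_maxGenEigenspace H c x

lemma gen_shift (a c : K) (hHE : ∀ x, H (E x) = E (H x) + a • E x) {x : V}
    (hx : x ∈ H.maxGenEigenspace c) : E x ∈ H.maxGenEigenspace (c + a) := by
  rw [mem_gen_iff] at hx ⊢
  obtain ⟨k, hk⟩ := hx
  refine ⟨k, ?_⟩
  have key : ∀ (k : ℕ) (x : V), ((H - (c + a) • (1 : Module.End K V)) ^ k) (E x)
      = E (((H - c • (1 : Module.End K V)) ^ k) x) := by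
    intro k
    induction k with
    | zero => intro x; simp
    | succ k ih =>
      intro x
      rw [pow_succ, pow_succ, Module.End.mul_apply, Module.End.mul_apply, ← ih]
      congr 1
      simp [hHE, add_smul]
  rw [key, hk, map_zero]

lemma gen_sub (c a : K) {x : V} (hx : x ∈ H.maxGenEigenspace c) :
    H x - a • x ∈ H.maxGenEigenspace c := by
  refine Submodule.sub_mem _ ?_ (Submodule.smul_mem _ _ hx)
  have := gen_shift (H := H) (E := H) 0 c (by simp) hx
  simpa using this

lemma gen_eig_zero {c a : K} (hne : a ≠ c) {x : V} (hx : x ∈ H.maxGenEigenspace c)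
    (h : H x = a • x) : x = 0 := by
  have h1 : x ∈ H.maxGenEigenspace a := by
    rw [mem_gen_iff]
    exact ⟨1, by simp [h]⟩
  have := (Module.End.independent_maxGenEigenspace H).pairwiseDisjoint hne
  exact (Submodule.disjoint_def.mp this) x h1 hx

variable (hHE : ∀ x, H (E x) = E (H x) + (2 : K) • E x)
  (hHF : ∀ x, H (F x) = F (H x) + (-2 : K) • F x)
  (hEF : ∀ x, E (F x) = F (E x) + H x)

include hHF in
lemma H_F_pow (n : ℕ) (x : V) : H ((F ^ n) x) = (F ^ n) (H x) - (2 * n : K) • (F ^ n) x := by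
  induction n with
  | zero => simp
  | succ n ih =>
    rw [pow_succ', Module.End.mul_apply, Module.End.mul_apply, hHF, ih]
    simp only [map_sub, map_smul]
    push_cast
    module

include hHE in
lemma H_E_pow (n : ℕ) (x : V) : H ((E ^ n) x) = (E ^ n) (H x) + (2 * n : K) • (E ^ n) x := by
  induction n with
  | zero => simp
  | succ n ih =>
    rw [pow_succ', Module.End.mul_apply, Module.End.mul_apply, hHE, ih]
    simp only [map_add, map_smul]
    push_cast
    module

include hHF hEF in
lemma E_F_pow (n : ℕ) (x : V) (hx : E x = 0) :
    E ((F ^ (n + 1)) x) = (n + 1 : K) • (F ^ n) (H x - (n : K) • x) := by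
  induction n with
  | zero => simp [hEF, hx]
  | succ n ih =>
    rw [pow_succ', Module.End.mul_apply, hEF, ih, H_F_pow hHF]
    simp only [map_sub, map_smul]
    rw [pow_succ', Module.End.mul_apply, Module.End.mul_apply]
    push_cast
    module

include hHE hEF in
lemma F_E_pow (n : ℕ) (x : V) (μ : K) (hμ : H x = μ • x) (hx : E (F x) = 0) :
    F ((E ^ (n + 1)) x) = -((n + 1) * (μ + n) : K) • (E ^ n) x := by
  have e : ∀ y, F (E y) = E (F y) - H y := fun y => by rw [hEF]; abel
  induction n with
  | zero => simp [e, hx, hμ]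
  | succ n ih =>
    rw [pow_succ', Module.End.mul_apply, e, ih, H_E_pow hHE, hμ]
    simp only [map_smul]
    rw [pow_succ' E n, Module.End.mul_apply]
    push_cast
    module

include hHE hHF hEF in
lemma hw (c : K) (n : ℕ) : ∀ x : V, x ∈ H.maxGenEigenspace c → E x = 0 → (F ^ n) x = 0 →
    H x = c • x ∧ ((∀ i : ℕ, i < n → c ≠ i) → x = 0) := by
  induction n with
  | zero => intro x _ _ h; simp at h; simp [h]
  | succ n ih =>
    intro x hx hEx hF
    have h1 := E_F_pow hHF hEF n x hEx
    rw [hF, map_zero] at h1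
    have h2 : (F ^ n) (H x - (n : K) • x) = 0 :=
      (smul_eq_zero.mp h1.symm).resolve_left (by exact_mod_cast Nat.succ_ne_zero n)
    have hEH : E (H x) = 0 := by
      have := hHE x
      rw [hEx] at this
      simpa using this.symm
    obtain ⟨h3, h4⟩ := ih _ (gen_sub c n hx) (by simp [hEH, hEx]) h2
    by_cases hc : c = n
    · have h5 : H x - (n : K) • x = 0 := h4 (by
        intro i hi h
        rw [hc] at h
        have := Nat.cast_injective h
        omega)
      refine ⟨by rw [hc]; exact sub_eq_zero.mp h5, fun h => absurd hc (h n (Nat.lt_succ_self n))⟩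
    · have h5 : H x - c • x = 0 := by
        refine gen_eig_zero (a := (n : K)) (fun h => hc h.symm) (gen_sub c c hx) ?_
        simp only [map_sub, map_smul] at h3 ⊢
        linear_combination (norm := module) h3
      refine ⟨sub_eq_zero.mp h5, fun h => ?_⟩
      have h6 := h4 (fun i hi => h i (by omega))
      exact gen_eig_zero (a := (n : K)) (fun h => hc h.symm) hx (sub_eq_zero.mp h6)

variable [FiniteDimensional K V]

lemma exists_gen_bot (a : K) (ha : a ≠ 0) (c : K) : ∃ n : ℕ, H.maxGenEigenspace (c + n * a) = ⊥ := by
  by_contra! hcon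
  have hfin := (Module.End.independent_maxGenEigenspace H)
  have := WellFoundedGT.finite_ne_bot_of_iSupIndep hfin
  have hinj : Function.Injective (fun n : ℕ => c + n * a) := by
    intro m n h
    simpa [ha] using h
  exact (Set.infinite_range_of_injective hinj) (this.subset (by rintro _ ⟨n, rfl⟩; exact hcon n))

lemma gen_shift_pow (a c : K) (hHE : ∀ x, H (E x) = E (H x) + a • E x) {x : V}
    (hx : x ∈ H.maxGenEigenspace c) (n : ℕ) : (E ^ n) x ∈ H.maxGenEigenspace (c + n * a) := by
  induction n with
  | zero => simpa using hx
  | succ n ih =>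
    rw [pow_succ', Module.End.mul_apply]
    have := gen_shift a _ hHE ih
    convert this using 2
    push_cast
    ring

lemma exists_pow_zero (a c : K) (ha : a ≠ 0) (hHE : ∀ x, H (E x) = E (H x) + a • E x) {x : V}
    (hx : x ∈ H.maxGenEigenspace c) : ∃ n : ℕ, (E ^ n) x = 0 := by
  obtain ⟨n, hn⟩ := exists_gen_bot (H := H) a ha c
  refine ⟨n, ?_⟩
  have := gen_shift_pow a c hHE hx n
  rwa [hn, Submodule.mem_bot] at this

include hHE hEF in
lemma EF_inj (n : ℕ) (x : V) (hμ : H x = (n + 2 : K) • x) (hx : E (F x) = 0) : x = 0 := by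
  have hg : x ∈ H.maxGenEigenspace (n + 2 : K) := by
    rw [mem_gen_iff]; exact ⟨1, by simp [hμ]⟩
  obtain ⟨m, hm⟩ := exists_pow_zero 2 _ two_ne_zero hHE hg
  induction m with
  | zero => simpa using hm
  | succ m ih =>
    apply ih
    have := F_E_pow hHE hEF m x _ hμ hx
    rw [hm, map_zero] at this
    refine (smul_eq_zero.mp this.symm).resolve_left ?_
    refine neg_ne_zero.mpr ?_
    exact_mod_cast (by positivity : (m + 1) * (n + 2 + m) ≠ 0)

include hHE hHF hEF in
lemma gen_main (n : ℕ) : ∀ c : K, H.maxGenEigenspace (c + n * 2) = ⊥ →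
    ∀ x ∈ H.maxGenEigenspace c, H x = c • x ∧ (x ≠ 0 → ∃ i : ℤ, c = i) := by
  induction n with
  | zero =>
    intro c hc x hx
    simp at hc
    rw [hc, Submodule.mem_bot] at hx
    simp [hx]
  | succ n ih =>
    intro c hc
    have ih' := ih (c + 2) (by convert hc using 2; push_cast; ring)
    have prim : ∀ x ∈ H.maxGenEigenspace c, E x = 0 →
        H x = c • x ∧ (x ≠ 0 → ∃ i : ℕ, c = i) := by
      intro x hx hEx
      obtain ⟨k, hk⟩ := exists_pow_zero (-2) c (by simp) hHF hx
      obtain ⟨h1, h2⟩ := hw hHE hHF hEF c k x hx hEx hk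
      refine ⟨h1, fun hne => ?_⟩
      by_contra! hcon
      exact hne (h2 fun i _ => hcon i)
    intro x hx
    have hEx := gen_shift 2 c hHE hx
    constructor
    · by_contra hne
      have hu0 : H x - c • x ≠ 0 := fun h => hne (sub_eq_zero.mp h)
      have hEu : E (H x - c • x) = 0 := by
        have h1 := (ih' _ hEx).1
        rw [hHE] at h1
        simp only [map_sub, map_smul]
        linear_combination (norm := module) h1
      obtain ⟨l, hl⟩ := (prim _ (gen_sub c c hx) hEu).2 hu0
      -- `E F` is bijective on the generalized eigenspace at `c + 2`
      have hmaps : ∀ z ∈ H.maxGenEigenspace (c + 2), (E * F) z ∈ H.maxGenEigenspace (c + 2) := by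
        intro z hz
        have h1 := gen_shift (-2) _ hHF hz
        have h2 := gen_shift 2 _ hHE h1
        simpa using h2
      have hinj : Function.Injective ((E * F).restrict hmaps) := by
        rw [← LinearMap.ker_eq_bot, LinearMap.ker_eq_bot']
        rintro ⟨z, hz⟩ h0
        have h0' : E (F z) = 0 := congrArg Subtype.val h0
        have : z = 0 := EF_inj hHE hEF l z (by rw [← hl]; exact (ih' z hz).1) h0'
        exact Subtype.ext this
      have hsurj := LinearMap.injective_iff_surjective.mp hinj
      obtain ⟨⟨z, hz⟩, hzE⟩ := hsurj ⟨E x, hEx⟩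
      have hzE' : E (F z) = E x := congrArg Subtype.val hzE
      have hFz : F z ∈ H.maxGenEigenspace c := by
        simpa using gen_shift (-2) _ hHF hz
      have h1 := (prim (x - F z) (Submodule.sub_mem _ hx hFz) (by simp [hzE'])).1
      have h2 : H (F z) = c • F z := by
        rw [hHF, (ih' z hz).1, map_smul]; module
      apply hne
      rw [map_sub, h2] at h1
      linear_combination (norm := module) h1
    · intro hne
      by_cases hE0 : E x = 0
      · obtain ⟨i, hi⟩ := (prim x hx hE0).2 hne
        exact ⟨i, by simpa using hi⟩
      · obtain ⟨i, hi⟩ := (ih' _ hEx).2 hE0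
        exact ⟨i - 2, by push_cast; rw [← hi]; ring⟩

include hHE hHF hEF in
lemma iSup_int_eigenspace [IsAlgClosed K] : ⨆ i : ℤ, H.eigenspace (i : K) = ⊤ := by
  rw [eq_top_iff, ← Module.End.iSup_maxGenEigenspace_eq_top H]
  refine iSup_le fun c x hx => ?_
  obtain ⟨n, hn⟩ := exists_gen_bot (H := H) 2 two_ne_zero c
  obtain ⟨h1, h2⟩ := gen_main hHE hHF hEF n c hn x hx
  by_cases h0 : x = 0
  · rw [h0]; exact Submodule.zero_mem _
  · obtain ⟨i, hi⟩ := h2 h0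
    refine Submodule.mem_iSup_of_mem i ?_
    rw [Module.End.mem_eigenspace_iff, h1, hi]

end Sl2

section Env
attribute [local instance] LieRing.ofAssociativeRing
variable {K : Type*} [Field K]

lemma uea_adjoin {L : Type*} [LieRing L] [LieAlgebra K L] :
    Algebra.adjoin K (Set.range (UniversalEnvelopingAlgebra.ι K (L := L))) = ⊤ := by
  set S := Algebra.adjoin K (Set.range (UniversalEnvelopingAlgebra.ι K (L := L))) with hS
  let j : L →ₗ⁅K⁆ S :=
    { toFun := fun x => ⟨UniversalEnvelopingAlgebra.ι K x, Algebra.subset_adjoin ⟨x, rfl⟩⟩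
      map_add' := fun x y => Subtype.ext (map_add _ x y)
      map_smul' := fun c x => Subtype.ext (map_smul (UniversalEnvelopingAlgebra.ι K) c x)
      map_lie' := fun {x y} => Subtype.ext (LieHom.map_lie _ x y) }
  have h : S.val.comp (UniversalEnvelopingAlgebra.lift K j) = AlgHom.id K _ := by
    apply UniversalEnvelopingAlgebra.hom_ext
    ext x
    change ((UniversalEnvelopingAlgebra.lift K j (UniversalEnvelopingAlgebra.ι K x) : S) :
      UniversalEnvelopingAlgebra K L) = UniversalEnvelopingAlgebra.ι K x
    rw [UniversalEnvelopingAlgebra.lift_ι_apply]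
    rfl
  rw [eq_top_iff]
  intro u _
  have : u = ((UniversalEnvelopingAlgebra.lift K j u : S) : UniversalEnvelopingAlgebra K L) :=
    (DFunLike.congr_fun h u).symm
  rw [this]
  exact Subtype.property _

/-- A subspace containing a vector `v` and stable by generators contains everything. -/
lemma adjoin_smul_mem {A : Type*} [Ring A] [Algebra K A] (s : Set A) (S : Submodule K A)
    (hS : ∀ x ∈ s, ∀ v ∈ S, x * v ∈ S) {u : A} (hu : u ∈ Algebra.adjoin K s) :
    ∀ v ∈ S, u * v ∈ S := by
  induction hu using Algebra.adjoin_induction with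
  | mem x hx => exact hS x hx
  | algebraMap r => intro v hv; rw [← Algebra.smul_def]; exact S.smul_mem _ hv
  | add x y _ _ hx hy => intro v hv; rw [add_mul]; exact S.add_mem (hx v hv) (hy v hv)
  | mul x y _ _ hx hy => intro v hv; rw [mul_assoc]; exact hx _ (hy v hv)

lemma uea_induction {L : Type*} [LieRing L] [LieAlgebra K L]
    (S : Submodule K (UniversalEnvelopingAlgebra K L)) (h1 : 1 ∈ S)
    (hS : ∀ (x : L), ∀ v ∈ S, UniversalEnvelopingAlgebra.ι K x * v ∈ S)
    (u : UniversalEnvelopingAlgebra K L) : u ∈ S := by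
  have := adjoin_smul_mem (Set.range (UniversalEnvelopingAlgebra.ι K (L := L))) S
    (by rintro _ ⟨x, rfl⟩; exact hS x) (u := u) (by rw [uea_adjoin]; trivial) 1 h1
  simpa using this

variable {g : Type*} [LieRing g] [LieAlgebra K g]

local notation "U" => UniversalEnvelopingAlgebra K
local notation "ι'" => UniversalEnvelopingAlgebra.ι K

lemma ι_mul_ι {L : Type*} [LieRing L] [LieAlgebra K L] (x y : L) :
    (ι' x) * (ι' y) = (ι' y) * (ι' x) + ι' ⁅x, y⁆ := by
  rw [LieHom.map_lie, LieRing.of_associative_ring_bracket]; abel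

/-- The action of `P` on `Hom(g, U(P))`. -/
noncomputable def theta (P : LieSubalgebra K g) : P →ₗ⁅K⁆ Module.End K (g →ₗ[K] U P) where
  toFun q :=
    { toFun := fun φ => (LinearMap.mulLeft K (ι' q)).comp φ - φ.comp (LieAlgebra.ad K g (q : g))
      map_add' := fun φ ψ => by ext x; simp [mul_add]; abel
      map_smul' := fun c φ => by ext x; simp [smul_sub] }
  map_add' q r := by ext φ x; simp [add_mul]; abel
  map_smul' c q := by ext φ x; simp [smul_sub]
  map_lie' {q r} := by
    ext φ x
    simp only [LieRing.of_associative_ring_bracket, LinearMap.coe_mk, AddHom.coe_mk,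
      LinearMap.sub_apply, Module.End.mul_apply, LinearMap.comp_apply, LinearMap.mulLeft_apply,
      LieAlgebra.ad_apply, LieSubalgebra.coe_bracket, map_sub, LieHom.map_lie, lie_lie, mul_sub,
      sub_mul, mul_assoc]
    abel

lemma theta_apply (P : LieSubalgebra K g) (q : P) (φ : g →ₗ[K] U P) (x : g) :
    theta P q φ x = (ι' q) * φ x + φ ⁅x, (q : g)⁆ := by
  rw [← lie_skew, map_neg, ← sub_eq_add_neg]; rfl

/-- Candidate action of `g` on `U(P)`. -/
noncomputable def act (P : LieSubalgebra K g) (φ : g →ₗ[K] U P) : g →ₗ[K] Module.End K (U P) :=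
  LinearMap.flip
    { toFun := fun u => UniversalEnvelopingAlgebra.lift K (theta P) u φ
      map_add' := fun u v => by simp
      map_smul' := fun c u => by simp }

lemma act_one (P : LieSubalgebra K g) (φ : g →ₗ[K] U P) (x : g) : act P φ x 1 = φ x := by
  change UniversalEnvelopingAlgebra.lift K (theta P) 1 φ x = φ x
  simp

lemma act_mul (P : LieSubalgebra K g) (φ : g →ₗ[K] U P) (x : g) (q : P) (u : U P) :
    act P φ x ((ι' q) * u) = (ι' q) * act P φ x u + act P φ ⁅x, (q : g)⁆ u := by
  change UniversalEnvelopingAlgebra.lift K (theta P) ((ι' q) * u) φ x = _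
  rw [map_mul, UniversalEnvelopingAlgebra.lift_ι_apply, Module.End.mul_apply, theta_apply]
  rfl

lemma act_p (P : LieSubalgebra K g) (φ : g →ₗ[K] U P) (hφ : ∀ q : P, φ q = ι' q) (q : P) (u : U P) :
    act P φ q u = (ι' q) * u := by
  let S : Submodule K (U P) :=
    { carrier := {u | ∀ q : P, act P φ q u = (ι' q) * u}
      zero_mem' := by simp
      add_mem' := fun {a b} ha hb q => by rw [map_add, ha q, hb q, mul_add]
      smul_mem' := fun c a ha q => by rw [map_smul, ha q, mul_smul_comm] }
  refine uea_induction S (fun q => by rw [act_one, hφ, mul_one]) (fun r v hv q => ?_) u q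
  have h1 := hv ⁅q, r⁆
  rw [LieSubalgebra.coe_bracket] at h1
  rw [act_mul, hv q, h1, ← mul_assoc, ← mul_assoc, ι_mul_ι q r, add_mul]

lemma act_lie (P : LieSubalgebra K g) (m : Submodule K g)
    (htop : P.toSubmodule ⊔ m = ⊤) (hmlie : ∀ x ∈ m, ∀ y ∈ m, ⁅x, y⁆ ∈ m)
    (χ : g →ₗ[K] K) (hχ : ∀ x ∈ m, ∀ y ∈ m, χ ⁅x, y⁆ = 0)
    (φ : g →ₗ[K] U P) (hφ : ∀ q : P, φ q = ι' q) (hφm : ∀ x ∈ m, φ x = algebraMap K _ (χ x))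
    (x y : g) (u : U P) :
    act P φ ⁅x, y⁆ u = act P φ x (act P φ y u) - act P φ y (act P φ x u) := by
  let S : Submodule K (U P) :=
    { carrier := {u | ∀ x y, act P φ ⁅x, y⁆ u = act P φ x (act P φ y u) - act P φ y (act P φ x u)}
      zero_mem' := by simp
      add_mem' := fun {a b} ha hb x y => by simp only [map_add, ha x y, hb x y]; abel
      smul_mem' := fun c a ha x y => by simp only [map_smul, ha x y, smul_sub] }
  have hpl : ∀ (q : P) (y : g) (u : U P), act P φ ⁅(q : g), y⁆ u
      = act P φ q (act P φ y u) - act P φ y (act P φ q u) := by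
    intro q y u
    rw [act_p P φ hφ, act_p P φ hφ, act_mul, ← lie_skew, map_neg, LinearMap.neg_apply]
    abel
  refine uea_induction S ?_ ?_ u x y
  · intro x y
    obtain ⟨q, hq, x', hx', rfl⟩ := Submodule.mem_sup.mp (show x ∈ P.toSubmodule ⊔ m by simp [htop])
    obtain ⟨r, hr, y', hy', rfl⟩ := Submodule.mem_sup.mp (show y ∈ P.toSubmodule ⊔ m by simp [htop])
    have h1 := hpl ⟨q, hq⟩ (r + y') 1
    have h2 := hpl ⟨r, hr⟩ x' 1
    have h3 : act P φ ⁅x', y'⁆ 1 = act P φ x' (act P φ y' 1) - act P φ y' (act P φ x' 1) := by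
      simp only [act_one]
      rw [hφm _ (hmlie _ hx' _ hy'), hχ _ hx' _ hy', hφm _ hx', hφm _ hy',
        Algebra.algebraMap_eq_smul_one, Algebra.algebraMap_eq_smul_one,
        Algebra.algebraMap_eq_smul_one, map_smul, map_smul, act_one, act_one, hφm _ hx', hφm _ hy',
        Algebra.algebraMap_eq_smul_one, Algebra.algebraMap_eq_smul_one, smul_smul, smul_smul,
        mul_comm]
      simp
    have h4 : ⁅q + x', r + y'⁆ = ⁅q, r + y'⁆ - ⁅r, x'⁆ + ⁅x', y'⁆ := by
      rw [add_lie, lie_add x', ← lie_skew r x']; abel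
    rw [h4]
    simp only [map_add, map_sub, LinearMap.add_apply, LinearMap.sub_apply] at h1 h2 h3 ⊢
    rw [h1, h2, h3]
    abel
  · intro q v hv x y
    have e1 := hv ⁅x, (q : g)⁆ y
    have e2 := hv x ⁅y, (q : g)⁆
    have e3 := hv x y
    have e4 : ⁅⁅x, y⁆, (q : g)⁆ = ⁅⁅x, (q : g)⁆, y⁆ + ⁅x, ⁅y, (q : g)⁆⁆ := by
      rw [lie_lie x y, ← lie_skew y ⁅x, (q : g)⁆]
      abel
    simp only [act_mul, map_add, e1, e2, e3, e4, LinearMap.add_apply, mul_sub]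
    abel

theorem main (P : LieSubalgebra K g) (m : Submodule K g)
    (hc : IsCompl P.toSubmodule m) (hmlie : ∀ x ∈ m, ∀ y ∈ m, ⁅x, y⁆ ∈ m)
    (χ : g →ₗ[K] K) (hχ : ∀ x ∈ m, ∀ y ∈ m, χ ⁅x, y⁆ = 0)
    (I : Submodule (U g) (U g))
    (hI : I = Submodule.span (U g) {u : U g | ∃ ξ ∈ m, u = (ι' ξ) - algebraMap K (U g) (χ ξ)})
    (Up : Subalgebra K (U g))
    (hUp : Up = Algebra.adjoin K (⇑(UniversalEnvelopingAlgebra.ι K) '' (P : Set g))) :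
    Subalgebra.toSubmodule Up ⊓ Submodule.restrictScalars K I = ⊥ ∧
    Subalgebra.toSubmodule Up ⊔ Submodule.restrictScalars K I = ⊤ := by
  constructor
  · let φ : g →ₗ[K] U P :=
      ((ι' : P →ₗ⁅K⁆ U P) : P →ₗ[K] U P).comp (Submodule.projectionOnto P.toSubmodule m hc) +
      (Algebra.linearMap K (U P)).comp
        (χ.comp (m.subtype.comp (Submodule.projectionOnto m P.toSubmodule hc.symm)))
    have hφ : ∀ q : P, φ q = ι' q := by
      intro q
      have h1 := Submodule.projectionOnto_apply_left hc q
      have h2 := Submodule.projectionOnto_apply_right hc.symm q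
      simp only [φ, LinearMap.add_apply, LinearMap.comp_apply]
      erw [h1, h2]
      simp
    have hφm : ∀ x ∈ m, φ x = algebraMap K _ (χ x) := by
      intro x hx
      have h1 := Submodule.projectionOnto_apply_left hc.symm ⟨x, hx⟩
      have h2 := Submodule.projectionOnto_apply_right hc ⟨x, hx⟩
      simp only [φ, LinearMap.add_apply, LinearMap.comp_apply]
      erw [h1, h2]
      simp
    let ρ : g →ₗ⁅K⁆ Module.End K (U P) :=
      { act P φ with
        map_lie' := fun {x y} => by
          ext u
          exact act_lie P m hc.sup_eq_top hmlie χ hχ φ hφ hφm x y u }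
    let R := UniversalEnvelopingAlgebra.lift K ρ
    have hR : ∀ x u, R (ι' x) u = act P φ x u := fun x u => by
      simp only [R]
      rw [UniversalEnvelopingAlgebra.lift_ι_apply]; rfl
    let i : U P →ₐ[K] U g := UniversalEnvelopingAlgebra.lift K ((ι' : g →ₗ⁅K⁆ U g).comp P.incl)
    have hi : ∀ q : P, i (ι' q) = ι' (q : g) := fun q => by
      simp only [i]
      rw [UniversalEnvelopingAlgebra.lift_ι_apply]; rfl
    have hRi : ∀ w : U P, R (i w) 1 = w := by
      let S : Submodule K (U P) :=
        { carrier := {w | R (i w) 1 = w}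
          zero_mem' := by simp
          add_mem' := fun {a b} ha hb => by
            simp only [Set.mem_ofPred_eq, map_add, LinearMap.add_apply] at *
            rw [ha, hb]
          smul_mem' := fun c a ha => by
            simp only [Set.mem_ofPred_eq, map_smul, LinearMap.smul_apply] at *
            rw [ha] }
      refine uea_induction S (by simp [S]) ?_
      intro q v hv
      change R (i v) 1 = v at hv
      change R (i (_ * v)) 1 = _ * v
      rw [map_mul, map_mul, Module.End.mul_apply, hv, hi, hR, act_p P φ hφ]
    rw [eq_bot_iff]
    rintro z ⟨hz1, hz2⟩
    have hz3 : z ∈ i.range := by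
      have : Up ≤ i.range := by
        rw [hUp, Algebra.adjoin_le_iff]
        rintro _ ⟨x, hx, rfl⟩
        exact ⟨ι' (⟨x, hx⟩ : P), hi ⟨x, hx⟩⟩
      exact this hz1
    obtain ⟨w, rfl⟩ := hz3
    have hz4 : ∀ z ∈ I, R z 1 = 0 := by
      intro z hz
      rw [hI] at hz
      induction hz using Submodule.span_induction with
      | mem z hz =>
        obtain ⟨ξ, hξ, rfl⟩ := hz
        rw [map_sub, LinearMap.sub_apply, hR, act_one, hφm ξ hξ, AlgHom.commutes]
        simp [Algebra.algebraMap_eq_smul_one]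
      | zero => simp
      | add a b _ _ ha hb => rw [map_add, LinearMap.add_apply, ha, hb, add_zero]
      | smul a b _ hb => rw [smul_eq_mul, map_mul, Module.End.mul_apply, hb, map_zero]
    have := hz4 _ hz2
    change R (i w) 1 = 0 at this
    rw [hRi] at this
    simp [this]
  · set T := Subalgebra.toSubmodule Up ⊔ Submodule.restrictScalars K I with hT
    have hUT : ∀ u ∈ Up, u ∈ T := fun u hu => Submodule.mem_sup_left hu
    have hIT : ∀ u ∈ I, u ∈ T := fun u hu => Submodule.mem_sup_right hu
    have hPU : ∀ q ∈ P, (ι' q) ∈ Up := fun q hq => by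
      rw [hUp]; exact Algebra.subset_adjoin ⟨q, hq, rfl⟩
    have hPT : ∀ q ∈ P, ∀ t ∈ T, (ι' q) * t ∈ T := by
      intro q hq t ht
      obtain ⟨a, ha, b, hb, rfl⟩ := Submodule.mem_sup.mp ht
      rw [mul_add]
      exact T.add_mem (hUT _ (Up.mul_mem (hPU q hq) ha)) (hIT _ (I.smul_mem (ι' q) hb))
    let S : Submodule K (U g) :=
      { carrier := {u | u ∈ T ∧ ∀ x : g, (ι' x) * u ∈ T}
        zero_mem' := by simp
        add_mem' := fun {a b} ha hb => ⟨T.add_mem ha.1 hb.1, fun x => by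
          rw [mul_add]; exact T.add_mem (ha.2 x) (hb.2 x)⟩
        smul_mem' := fun c a ha => ⟨T.smul_mem c ha.1, fun x => by
          rw [mul_smul_comm]; exact T.smul_mem c (ha.2 x)⟩ }
    have hS1 : (1 : U g) ∈ S := by
      refine ⟨hUT _ Up.one_mem, fun x => ?_⟩
      obtain ⟨q, hq, y, hy, rfl⟩ := Submodule.mem_sup.mp
        (show x ∈ P.toSubmodule ⊔ m by simp [hc.sup_eq_top])
      rw [mul_one, map_add]
      refine T.add_mem (hUT _ (hPU q hq)) ?_
      have e : (ι' y) = algebraMap K (U g) (χ y) + ((ι' y) - algebraMap K (U g) (χ y)) := by abel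
      rw [e]
      refine T.add_mem (hUT _ (Up.algebraMap_mem _)) (hIT _ ?_)
      rw [hI]
      exact Submodule.subset_span ⟨y, hy, rfl⟩
    have hS2 : ∀ u ∈ Up, u ∈ S := by
      intro u hu
      rw [hUp] at hu
      have := adjoin_smul_mem _ S ?_ hu 1 hS1
      · simpa using this
      · rintro _ ⟨q, hq, rfl⟩ v ⟨hv1, hv2⟩
        refine ⟨hPT q hq v hv1, fun x => ?_⟩
        rw [← mul_assoc, ι_mul_ι x q, add_mul, mul_assoc]
        exact T.add_mem (hPT q hq _ (hv2 x)) (hv2 _)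
    rw [eq_top_iff]
    intro u _
    refine uea_induction T (hUT _ Up.one_mem) (fun x v hv => ?_) u
    obtain ⟨a, ha, b, hb, rfl⟩ := Submodule.mem_sup.mp hv
    rw [mul_add]
    exact T.add_mem ((hS2 a ha).2 x) (hIT _ (I.smul_mem (ι' x) hb))

end Env

section Grading
variable {K : Type*} [Field K] {g : Type*} [LieRing g] [LieAlgebra K g]

lemma lie_mem_graded (h : g) (s t r : ℤ → Prop) (hst : ∀ i j, s i → t j → r (i + j)) {x y : g}
    (hx : x ∈ ⨆ i : ℤ, ⨆ _ : s i, Module.End.eigenspace (LieAlgebra.ad K g h) (i : K))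
    (hy : y ∈ ⨆ i : ℤ, ⨆ _ : t i, Module.End.eigenspace (LieAlgebra.ad K g h) (i : K)) :
    ⁅x, y⁆ ∈ ⨆ i : ℤ, ⨆ _ : r i, Module.End.eigenspace (LieAlgebra.ad K g h) (i : K) := by
  set R := ⨆ i : ℤ, ⨆ _ : r i, Module.End.eigenspace (LieAlgebra.ad K g h) (i : K) with hR
  have h1 : (⨆ i : ℤ, ⨆ _ : s i, Module.End.eigenspace (LieAlgebra.ad K g h) (i : K)) ≤
      R.comap (LieAlgebra.ad K g y : g →ₗ[K] g) := by
    refine iSup₂_le fun i hi a ha => ?_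
    have h2 : (⨆ i : ℤ, ⨆ _ : t i, Module.End.eigenspace (LieAlgebra.ad K g h) (i : K)) ≤
        R.comap (LieAlgebra.ad K g a : g →ₗ[K] g) := by
      refine iSup₂_le fun j hj b hb => ?_
      rw [Submodule.mem_comap, hR]
      refine Submodule.mem_iSup_of_mem (i + j) (Submodule.mem_iSup_of_mem (hst i j hi hj) ?_)
      rw [Module.End.mem_eigenspace_iff] at ha hb ⊢
      simp only [LieAlgebra.ad_apply] at ha hb ⊢
      rw [leibniz_lie, ha, hb, smul_lie, lie_smul, ← add_smul]
      push_cast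
      rfl
    have h3 := h2 hy
    rw [Submodule.mem_comap, LieAlgebra.ad_apply] at h3 ⊢
    rw [← lie_skew]
    exact R.neg_mem h3
  have h3 := h1 hx
  rw [Submodule.mem_comap, LieAlgebra.ad_apply] at h3
  rw [← lie_skew]
  exact R.neg_mem h3

end Grading

end PBWEven

/-- Assume `e` is even, i.e. `g(i) = 0` for every odd `i`. Set
`p := ⊕_{i ≥ 0} g(i)` and `m := ⊕_{i < 0} g(i)`. Then `U` decomposes as the internal direct
sum of `K`-vector spaces `U = U(p) ⊕ U·m_χ`, where `U(p)` denotes the subalgebra of `U`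
generated by (the image of) `p`. -/
theorem pbw_decomposition_even_case
    (K : Type*) [Field K] [IsAlgClosed K] [CharZero K]
    (g : Type*) [LieRing g] [LieAlgebra K g] [FiniteDimensional K g]
    [LieAlgebra.IsSemisimple K g]
    (e h f : g) (he : e ≠ 0)
    (hhe : ⁅h, e⁆ = (2 : K) • e) (hhf : ⁅h, f⁆ = (-2 : K) • f) (hef : ⁅e, f⁆ = h)
    (heven : ∀ i : ℤ, Odd i →
      Module.End.eigenspace (LieAlgebra.ad K g h) (i : K) = ⊥)
    (p m : Submodule K g)
    (hp : p = ⨆ i : ℤ, ⨆ _ : 0 ≤ i,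
      Module.End.eigenspace (LieAlgebra.ad K g h) (i : K))
    (hm : m = ⨆ i : ℤ, ⨆ _ : i < 0,
      Module.End.eigenspace (LieAlgebra.ad K g h) (i : K))
    (I : Submodule (UniversalEnvelopingAlgebra K g) (UniversalEnvelopingAlgebra K g))
    (hI : I = Submodule.span (UniversalEnvelopingAlgebra K g)
      {u : UniversalEnvelopingAlgebra K g | ∃ ξ ∈ m,
        u = UniversalEnvelopingAlgebra.ι K ξ -
          algebraMap K (UniversalEnvelopingAlgebra K g) (killingForm K g e ξ)})
    (Up : Subalgebra K (UniversalEnvelopingAlgebra K g))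
    (hUp : Up = Algebra.adjoin K (⇑(UniversalEnvelopingAlgebra.ι K) '' (p : Set g))) :
    Subalgebra.toSubmodule Up ⊓ Submodule.restrictScalars K I = ⊥ ∧
    Subalgebra.toSubmodule Up ⊔ Submodule.restrictScalars K I = ⊤ := by
  have hH1 : ∀ x, LieAlgebra.ad K g h (LieAlgebra.ad K g e x)
      = LieAlgebra.ad K g e (LieAlgebra.ad K g h x) + (2 : K) • LieAlgebra.ad K g e x := by
    intro x
    simp only [LieAlgebra.ad_apply]
    rw [leibniz_lie h e x, hhe, smul_lie, add_comm]
  have hH2 : ∀ x, LieAlgebra.ad K g h (LieAlgebra.ad K g f x)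
      = LieAlgebra.ad K g f (LieAlgebra.ad K g h x) + (-2 : K) • LieAlgebra.ad K g f x := by
    intro x
    simp only [LieAlgebra.ad_apply]
    rw [leibniz_lie h f x, hhf, smul_lie, add_comm]
  have hH3 : ∀ x, LieAlgebra.ad K g e (LieAlgebra.ad K g f x)
      = LieAlgebra.ad K g f (LieAlgebra.ad K g e x) + LieAlgebra.ad K g h x := by
    intro x
    simp only [LieAlgebra.ad_apply]
    rw [leibniz_lie e f x, hef, add_comm]
  have htop := PBWEven.iSup_int_eigenspace hH1 hH2 hH3
  have hsup : p ⊔ m = ⊤ := by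
    rw [eq_top_iff, ← htop]
    refine iSup_le fun i => ?_
    rcases lt_or_ge i 0 with hi | hi
    · refine le_trans ?_ le_sup_right
      rw [hm]
      exact le_iSup₂_of_le i hi le_rfl
    · refine le_trans ?_ le_sup_left
      rw [hp]
      exact le_iSup₂_of_le i hi le_rfl
  have hdisj : Disjoint p m := by
    have hind : iSupIndep fun i : ℤ => Module.End.eigenspace (LieAlgebra.ad K g h) (i : K) :=
      (Module.End.eigenspaces_iSupIndep (LieAlgebra.ad K g h)).comp Int.cast_injective
    have := hind.disjoint_biSup_biSup (s := {i : ℤ | 0 ≤ i}) (t := {i : ℤ | i < 0})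
      (by rw [Set.disjoint_left]; intro i (hi : 0 ≤ i) (hi' : i < 0); omega)
    rw [hp, hm]
    exact this
  let P : LieSubalgebra K g :=
    { p with
      lie_mem' := by
        intro x y hx hy
        change x ∈ p at hx
        change y ∈ p at hy
        change ⁅x, y⁆ ∈ p
        rw [hp] at hx hy ⊢
        exact PBWEven.lie_mem_graded h (fun i => 0 ≤ i) (fun i => 0 ≤ i) (fun i => 0 ≤ i)
          (fun i j hi hj => add_nonneg hi hj) hx hy }
  have hm' : m ≤ ⨆ i : ℤ, ⨆ _ : i ≤ -2,
      Module.End.eigenspace (LieAlgebra.ad K g h) (i : K) := by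
    rw [hm]
    refine iSup₂_le fun i hi => ?_
    by_cases h1 : i = -1
    · rw [heven i (by rw [h1]; decide)]
      exact bot_le
    · exact le_iSup₂_of_le i (by omega) le_rfl
  refine PBWEven.main P m ⟨hdisj, codisjoint_iff.mpr hsup⟩ ?_ (killingForm K g e) ?_ I hI Up hUp
  · intro x hx y hy
    rw [hm] at hx hy ⊢
    exact PBWEven.lie_mem_graded h (fun i => i < 0) (fun i => i < 0) (fun i => i < 0)
      (fun i j hi hj => add_neg hi hj) hx hy
  · intro x hx y hy
    have hxy := PBWEven.lie_mem_graded h (fun i => i ≤ -2) (fun i => i ≤ -2) (fun i => i ≤ -4)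
      (fun i j hi hj => by omega) (hm' hx) (hm' hy)
    have hle : (⨆ i : ℤ, ⨆ _ : i ≤ -4, Module.End.eigenspace (LieAlgebra.ad K g h) (i : K)) ≤
        LinearMap.ker (killingForm K g e) := by
      refine iSup₂_le fun i hi z hz => ?_
      rw [Module.End.mem_eigenspace_iff, LieAlgebra.ad_apply] at hz
      rw [LinearMap.mem_ker]
      have h1 : killingForm K g ⁅h, e⁆ z = - killingForm K g e ⁅h, z⁆ :=
        LieModule.traceForm_apply_lie_apply' K g g h e z
      rw [hhe, hz] at h1
      simp only [map_smul, LinearMap.smul_apply, smul_eq_mul] at h1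
      have h2 : ((2 + i : ℤ) : K) * killingForm K g e z = 0 := by
        push_cast
        linear_combination h1
      refine (mul_eq_zero.mp h2).resolve_left ?_
      exact Int.cast_ne_zero.mpr (by omega)
    exact hle hxy
end
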